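/- Every finite simple graph G with at least one edge, with no K_8-minor, and containing no induced subgraph isomorphic to K_{2,2,2,2,2}, has an edge that belongs to at most 5 triangles. -/

import Mathlib

open SimpleGraph

/-- `H` is a minor of `G`: there is a family of nonempty, pairwise disjoint,
connected branch sets in `G`, one for each vertex of `H`, with an edge of `G`
between the branch sets corresponding to each edge of `H`. -/
def SimpleGraph.MinorOf {W V : Type} (H : SimpleGraph W) (G : SimpleGraph V) : Prop :=
  ∃ f : W → Set V,
    (∀ w, (f w).Nonempty) ∧
    (∀ w, (G.induce (f w)).Connected) ∧
    (∀ w₁ w₂, w₁ ≠ w₂ → Disjoint (f w₁) (f w₂)) ∧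
    (∀ w₁ w₂, H.Adj w₁ w₂ → ∃ v₁ ∈ f w₁, ∃ v₂ ∈ f w₂, G.Adj v₁ v₂)


/-- The complete multipartite graph `K_{2,2,2,2,2}` with five parts of size 2. -/
def K22222 : SimpleGraph (Σ _ : Fin 5, Fin 2) :=
  SimpleGraph.completeMultipartiteGraph fun _ : Fin 5 => Fin 2

namespace SixSearch

/-- Evaluates `n` to a numeral before passing it on. -/
def force {α : Type} (n : ℕ) (f : ℕ → α) : α :=
  Nat.rec (motive := fun _ => α) (f 0) (fun k _ => f (Nat.succ k)) n

def ifz {α : Type} (n : ℕ) (a b : α) : α :=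
  Nat.rec (motive := fun _ => α) a (fun _ _ => b) n

structure St where
  (M A Z : ℕ)

def pw (i : ℕ) : ℕ := Nat.pow 2 i

def row (M i : ℕ) : ℕ := Nat.land (Nat.shiftRight M (Nat.mul 11 i)) 2047

/-- The numbers of ones of the 11-bit numbers, in four bits each. -/
def popTable : ℕ := 7953204691407792021513110168509271019132552801827905252012948674223368191271757279648588588684491722981695745662814891086913572230386447784978108669521477018045895903963897708755899774510522605610348064447871429580720045975302520928963524379027996019561418598515031190916767463527465506873302928888764549187853941988358093208063467162326338079226132645935115056293122038847844844541439958084513732669028148252628987657711247330191089791456119804731876304518356964536713683508247423664359006065398410797462163410310010333291648690398651795902629285488788825304097671264299362778242152454857671277500137051329877274355525721995504548828493864089020431081370756955520795473529126124713690821295262901773807197795799399059917717517469124521051022343849681382749945990269938997255066843390663466421328918118967142391919071321362845536923410825898072737872171583750499710736842415009181364171610583073911258186678627788639444551275180234346538370082938448404110455842702091166437600700534886342697087029546105577618744115349794884036386159168317637856792277620489296085164110973608142809039335429633722889327924298724033274117189285717399398429745753164400981883057137510477375003389067029268829468704041761346074852364780580213756757674838218275072715574058752554805854102409233505534262005163681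22635136630391519342006695245620025668338972754381933810142786225533326103954354199204160000795216749198654753640598362266134352054632539240812937564362260783167343080686121469945907914711416320669422358258894213020568996952713338179327322506096496727675941051007800733360738807560919339040307930712470143564401040809113158401991568777029812055436371308538123689594148197900557717862944465827940172646486562529572109792881747814136071631987888038045792628010262264786237716230660903506073284625285026447191441775671239123753083788929774911180089968233116254362469645509636691811181216062413445353272600035987569741080180492380197411646325249302164390316093937489108374937307698136899982600895299957803150987367338036420037171652704791300661986600758032854865931293789212714426402424602492990958849737660665655254663320394476514371435641176048601915585653573488237026850933905421922665211930601841700204114676254080915982836353898427864194587277656310026539173699060841882894585330622493902478470638046010078334750569453627009927105675949960040076826587879246703706152030127851377160089716319207845613707170039654471293391757644879091139796606774841231133307312667257716416784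

def pop (r : ℕ) : ℕ := Nat.land (Nat.shiftRight popTable (Nat.mul 4 r)) 15

def cross (v : ℕ) : ℕ :=
  Nat.lor (Nat.shiftLeft 2047 (Nat.mul 11 v)) (Nat.shiftLeft 1298708349570020393652962442872833 v)

def pos (i j : ℕ) : ℕ := Nat.pow 2 (Nat.add (Nat.mul 11 i) j)

def ext (n D v : ℕ) (k : ℕ) : ℕ → ℕ → ℕ → ℕ → ℕ → List St → List St :=
  Nat.rec (motive := fun _ => ℕ → ℕ → ℕ → ℕ → ℕ → List St → List St)
    (fun _ _ M A Z acc => ⟨M, A, Z⟩ :: acc)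
    (fun k ih f need M A Z acc =>
      ifz need (⟨M, A, Z⟩ :: acc) <|
      force (Nat.sub n (Nat.succ k)) fun j =>
      ifz (Nat.land (Nat.lor (row M v) (Nat.lor A (pw v))) (pw j))
        (force (row M j) fun r =>
          ifz (Nat.land f (pw r))
            (force (Nat.pred need) fun need' =>
              force (Nat.lor M (Nat.lor (pos v j) (pos j v))) fun M' =>
              ifz (Nat.sub D (Nat.succ (pop r)))
                (force (Nat.lor A (pw j)) fun A' => force (Nat.lor Z (cross j)) fun Z' =>
                  ih f need' M' A' Z' (force (Nat.lor f (pw r)) fun f' => ih f' need M A Z acc))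
                (ih f need' M' A Z (force (Nat.lor f (pw r)) fun f' => ih f' need M A Z acc)))
            (ih f need M A Z acc))
        (ih f need M A Z acc))
    k

def requirements : List (ℕ × ℕ) → List ℕ
  | [] => []
  | (a, b) :: t =>
    t.foldr (fun c acc => force (Nat.lor (Nat.lor (pos a c.1) (pos a c.2))
      (Nat.lor (pos b c.1) (pos b c.2))) fun x => x :: acc)
      (bif Nat.beq a b then requirements t
       else force (pos a b) fun x => x :: requirements t)

def validBags (full : ℕ) : List (ℕ × ℕ) → ℕ → Bool
  | [], u => Nat.blt u full
  | (a, b) :: t, u => 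
      force (Nat.lor (pw a) (pw b)) fun m =>
      Nat.beq (Nat.land u m) 0 && force (Nat.lor u m) fun u' => validBags full t u'

def decodeBags : ℕ → ℕ → List (ℕ × ℕ)
  | 0, _ => []
  | k + 1, m => force (Nat.land m 15) fun a => force (Nat.land (Nat.shiftRight m 4) 15) fun b =>
      force (Nat.shiftRight m 8) fun m' => (a, b) :: decodeBags k m'

def decodeModels (full : ℕ) : ℕ → ℕ → List (List ℕ)
  | 0, _ => []
  | k + 1, m => bif Nat.beq m 0 then [] else
      bif validBags full (decodeBags 6 m) 0 then
        requirements (decodeBags 6 m) :: force (Nat.shiftRight m 48) fun m' => decodeModels full k m'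
      else []

def allR (K : ℕ) (l : List ℕ) : Bool :=
  List.rec (motive := fun _ => Bool) true (fun r _ ih => ifz (Nat.land K r) false ih) l

def anyM (K : ℕ) (l : List (List ℕ)) : Bool :=
  List.rec (motive := fun _ => Bool) false
    (fun rs _ ih => Bool.rec (motive := fun _ => Bool) ih true (allR K rs)) l

def covered (E full diag : ℕ) (models : List (List ℕ)) (s : St) : Bool :=
  (Nat.beq s.M E && Nat.beq s.A full) ||
  force (Nat.xor s.Z (Nat.land s.Z (Nat.lor s.M diag))) fun K => anyM K models

def tb (m i : ℕ) : Bool := ifz (Nat.land m (pw i)) false true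

def deficient (D M A rv : ℕ) (k : ℕ) : Bool :=
  Nat.rec (motive := fun _ => Bool) false
    (fun u ih => ifz (Nat.land A (pw u)) ih
      (ifz (Nat.land rv (pw u)) (ifz (Nat.sub D (pop (row M u))) ih true) ih)) k

def pruned (n D v : ℕ) (s : St) : Bool :=
  force (row s.M v) fun rv =>
    ifz (Nat.sub D (pop rv)) false (deficient D s.M s.A rv n)

def finish (v : ℕ) (s : St) : St :=
  force (Nat.lor s.A (pw v)) fun A' => force (Nat.lor s.Z (cross v)) fun Z' => ⟨s.M, A', Z'⟩

def expand (n D : ℕ) (maxl : Bool) (E full diag : ℕ) (c : ℕ) (s : St) (rest : List St) :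
    List St :=
  force (Nat.land c 15) fun v =>
  bif Nat.blt v n && !tb s.A v then
    (fun models => (ext n D v n 0 (Nat.sub D (pop (row s.M v))) s.M s.A s.Z []).foldr (fun t acc =>
      bif (maxl && pruned n D v t) || covered E full diag models (finish v t) then acc
      else finish v t :: acc) rest) (decodeModels full 30 (Nat.shiftRight c 4))
  else s :: rest

def search (n D : ℕ) (maxl : Bool) (E full diag : ℕ) : List ℕ → List St → List St
  | [], l => l
  | _ :: _, [] => []
  | c :: cs, s :: l => search n D maxl E full diag cs (expand n D maxl E full diag c s l)

def emptySt : St := ⟨0, 0, 0⟩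

def diag : ℕ := 1329552593586084350528447794605199361

theorem force_eq {α : Type} (n : ℕ) (f : ℕ → α) : force n f = f n := by cases n <;> rfl

theorem ifz_eq {α : Type} (n : ℕ) (a b : α) : ifz n a b = if n = 0 then a else b := by
  cases n <;> rfl

/-- The entry in row `i` and column `j` of the `11 × 11` bit matrix `M`. -/
def bit (M i j : ℕ) : Bool := M.testBit (11 * i + j)

theorem land_pw (m i : ℕ) : Nat.land m (pw i) = 0 ↔ m.testBit i = false := by
  change m &&& 2 ^ i = 0 ↔ _
  rw [Nat.and_two_pow]
  cases m.testBit i <;> simp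

theorem testBit_row (M i j : ℕ) : (row M i).testBit j = (decide (j < 11) && bit M i j) := by
  change (M >>> (11 * i) &&& 2047).testBit j = _
  rw [Nat.testBit_and, Nat.testBit_shiftRight, show 2047 = 2 ^ 11 - 1 by norm_num,
    Nat.testBit_two_pow_sub_one, Bool.and_comm]
  rfl

theorem row_lt (M i : ℕ) : row M i < 2048 :=
  Nat.and_lt_two_pow _ (n := 11) (by norm_num)

theorem row_eq_iff (M N i k : ℕ) : row M i = row N k ↔ ∀ j < 11, bit M i j = bit N k j := by
  constructor
  · intro h j hj
    simpa [testBit_row, hj] using congrArg (fun r => r.testBit j) h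
  · intro h
    apply Nat.eq_of_testBit_eq
    intro j
    by_cases hj : j < 11 <;> simp [testBit_row, hj]
    exact h j hj

theorem pop_table {r : ℕ} (hr : r < 2048) :
    pop r = ((Finset.range 11).filter (fun j => r.testBit j)).card := by
  have h : (List.range 2048).all (fun r => Nat.beq (pop r)
      (r % 2 + r / 2 % 2 + r / 4 % 2 + r / 8 % 2 + r / 16 % 2 + r / 32 % 2 + r / 64 % 2 +
        r / 128 % 2 + r / 256 % 2 + r / 512 % 2 + r / 1024 % 2)) = true := by decide +kernel
  rw [List.all_eq_true] at h
  rw [Nat.eq_of_beq_eq_true (h r (List.mem_range.2 hr)), Finset.card_filter]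
  have (i : ℕ) : (if r.testBit i = true then 1 else 0) = r / 2 ^ i % 2 := by
    rw [← Nat.toNat_testBit]
    cases r.testBit i <;> rfl
  simp only [this, Finset.sum_range_succ, Finset.sum_range_zero]
  norm_num

theorem pop_row (M i : ℕ) : pop (row M i) = ((Finset.range 11).filter (fun j => bit M i j)).card := by
  rw [pop_table (row_lt M i)]
  congr 1
  ext j
  simp +contextual [testBit_row]

theorem bit_lor (M N i j : ℕ) : bit (Nat.lor M N) i j = (bit M i j || bit N i j) :=
  Nat.testBit_or ..

theorem bit_pos (a b i j : ℕ) (hb : b < 11) (hj : j < 11) :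
    bit (pos a b) i j = decide (a = i ∧ b = j) := by
  change (2 ^ (11 * a + b)).testBit _ = _
  rw [Nat.testBit_two_pow]
  congr 1
  apply propext
  omega

theorem bit_cross (v i j : ℕ) (hv : v < 11) (hi : i < 11) (hj : j < 11) :
    bit (cross v) i j = decide (v = i ∨ v = j) := by
  have : ∀ v < 11, ∀ i < 11, ∀ j < 11, bit (cross v) i j = decide (v = i ∨ v = j) := by
    decide +kernel
  exact this v hv i hi j hj

theorem testBit_lor_pw (m i j : ℕ) :
    (Nat.lor m (pw i)).testBit j = (m.testBit j || decide (i = j)) := by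
  change (m ||| 2 ^ i).testBit j = _
  rw [Nat.testBit_or, Nat.testBit_two_pow]

theorem tb_eq (m i : ℕ) : tb m i = m.testBit i := by
  rw [tb, ifz_eq]
  have := land_pw m i
  split_ifs with h <;> grind

/-- What is known about the graph `R`: `M` consists of edges, `A` of vertices all of whose
incident edges are in `M`, and `Z` of pairs that meet `A`. -/
structure Inv (R : SimpleGraph ℕ) (M A Z : ℕ) : Prop where
  symm : ∀ i < 11, ∀ j < 11, bit M i j = bit M j i
  adj : ∀ i < 11, ∀ j < 11, bit M i j → R.Adj i j
  known : ∀ i < 11, ∀ j < 11, A.testBit i → R.Adj i j → bit M i j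
  pair : ∀ i < 11, ∀ j < 11, bit Z i j → A.testBit i ∨ A.testBit j

open Classical in
/-- The degree of `i` in `R`. -/
noncomputable def deg (R : SimpleGraph ℕ) (i : ℕ) : ℕ := ((Finset.range 11).filter (R.Adj i)).card

structure Admissible (n D : ℕ) (maxl : Bool) (R : SimpleGraph ℕ) : Prop where
  lt : ∀ i j, R.Adj i j → i < n
  deg_le : ∀ i, deg R i ≤ D
  maximal : maxl → ∀ i < n, ∀ j < n, i ≠ j → ¬ R.Adj i j → D ≤ deg R i ∨ D ≤ deg R j

def Preserves (n : ℕ) (σ : Equiv.Perm ℕ) : Prop := ∀ i, σ i < n ↔ i < n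

theorem Preserves.trans {n : ℕ} {σ τ : Equiv.Perm ℕ} (hσ : Preserves n σ) (hτ : Preserves n τ) :
    Preserves n (σ.trans τ) := fun i => (hτ _).trans (hσ i)

theorem Preserves.swap {n a b : ℕ} (ha : a < n) (hb : b < n) : Preserves n (Equiv.swap a b) := by
  intro i
  rw [Equiv.swap_apply_def]
  split_ifs <;> grind

theorem deg_comap {n : ℕ} {R : SimpleGraph ℕ} (hn : n ≤ 11) (hR : ∀ i j, R.Adj i j → i < n)
    {σ : Equiv.Perm ℕ} (hσ : Preserves n σ) (i : ℕ) : deg (R.comap σ) i = deg R (σ i) := by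
  classical
  unfold deg
  refine Finset.card_equiv σ fun j => ?_
  simp only [Finset.mem_filter, Finset.mem_range, SimpleGraph.comap_adj]
  constructor
  · rintro ⟨-, h⟩
    exact ⟨(hR _ _ h.symm).trans_le hn, h⟩
  · rintro ⟨-, h⟩
    exact ⟨((hσ _).1 (hR _ _ h.symm)).trans_le hn, h⟩

theorem Admissible.comap {n D : ℕ} {maxl : Bool} {R : SimpleGraph ℕ} (hn : n ≤ 11)
    (h : Admissible n D maxl R) {σ : Equiv.Perm ℕ} (hσ : Preserves n σ) :
    Admissible n D maxl (R.comap σ) where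
  lt i j hij := (hσ i).1 (h.lt _ _ hij)
  deg_le i := by rw [deg_comap hn h.lt hσ]; exact h.deg_le _
  maximal hm i hi j hj hij hR := by
    rw [deg_comap hn h.lt hσ, deg_comap hn h.lt hσ]
    exact h.maximal hm _ ((hσ i).2 hi) _ ((hσ j).2 hj) (by simpa using hij) hR

theorem Inv.pop_le_deg {R : SimpleGraph ℕ} {M A Z i : ℕ} (h : Inv R M A Z) (hi : i < 11) :
    pop (row M i) ≤ deg R i := by
  classical
  rw [pop_row, deg]
  refine Finset.card_le_card fun j => ?_
  simp only [Finset.mem_filter, Finset.mem_range]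
  exact fun hj => ⟨hj.1, h.adj i hi j hj.1 hj.2⟩

theorem Inv.pop_eq_deg {R : SimpleGraph ℕ} {M A Z i : ℕ} (h : Inv R M A Z) (hi : i < 11)
    (hA : A.testBit i) : pop (row M i) = deg R i := by
  classical
  refine (h.pop_le_deg hi).antisymm ?_
  rw [pop_row, deg]
  refine Finset.card_le_card fun j => ?_
  simp only [Finset.mem_filter, Finset.mem_range]
  exact fun hj => ⟨hj.1, h.known i hi j hj.1 hA hj.2⟩

theorem Inv.saturated {R : SimpleGraph ℕ} {M A Z i : ℕ} (h : Inv R M A Z) (hi : i < 11)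
    (hd : deg R i ≤ pop (row M i)) {j : ℕ} (hj : j < 11) (hij : R.Adj i j) : bit M i j := by
  classical
  rw [pop_row, deg] at hd
  have hs : (Finset.range 11).filter (fun j => bit M i j) ⊆ (Finset.range 11).filter (R.Adj i) := by
    intro j
    simp only [Finset.mem_filter, Finset.mem_range]
    exact fun hj => ⟨hj.1, h.adj i hi j hj.1 hj.2⟩
  have := Finset.eq_of_subset_of_card_le hs hd
  have hm : j ∈ (Finset.range 11).filter (R.Adj i) := by simp [hj, hij]
  rw [← this] at hm
  simpa using (Finset.mem_filter.1 hm).2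

theorem ext_unfold (n D v k f need M A Z : ℕ) (acc : List St) :
    ext n D v (k + 1) f need M A Z acc =
      ifz need (⟨M, A, Z⟩ :: acc) (force (Nat.sub n (Nat.succ k)) fun j =>
        ifz (Nat.land (Nat.lor (row M v) (Nat.lor A (pw v))) (pw j))
          (force (row M j) fun r =>
            ifz (Nat.land f (pw r))
              (force (Nat.pred need) fun need' =>
                force (Nat.lor M (Nat.lor (pos v j) (pos j v))) fun M' =>
                ifz (Nat.sub D (Nat.succ (pop r)))
                  (force (Nat.lor A (pw j)) fun A' => force (Nat.lor Z (cross j)) fun Z' =>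
                    ext n D v k f need' M' A' Z'
                      (force (Nat.lor f (pw r)) fun f' => ext n D v k f' need M A Z acc))
                  (ext n D v k f need' M' A Z
                    (force (Nat.lor f (pw r)) fun f' => ext n D v k f' need M A Z acc)))
              (ext n D v k f need M A Z acc))
          (ext n D v k f need M A Z acc)) := rfl

theorem ext_succ (n D v k f need M A Z : ℕ) (acc : List St) :
    ext n D v (k + 1) f need M A Z acc =
      if need = 0 then ⟨M, A, Z⟩ :: acc else
      if (Nat.lor (row M v) (Nat.lor A (pw v))).testBit (n - (k + 1)) then
        ext n D v k f need M A Z acc else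
      if f.testBit (row M (n - (k + 1))) then ext n D v k f need M A Z acc else
      if D ≤ pop (row M (n - (k + 1))) + 1 then
        ext n D v k f (need - 1)
          (Nat.lor M (Nat.lor (pos v (n - (k + 1))) (pos (n - (k + 1)) v)))
          (Nat.lor A (pw (n - (k + 1)))) (Nat.lor Z (cross (n - (k + 1))))
          (ext n D v k (Nat.lor f (pw (row M (n - (k + 1))))) need M A Z acc)
      else ext n D v k f (need - 1)
          (Nat.lor M (Nat.lor (pos v (n - (k + 1))) (pos (n - (k + 1)) v))) A Z
          (ext n D v k (Nat.lor f (pw (row M (n - (k + 1))))) need M A Z acc) := by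
  have hs : ∀ a b : ℕ, a.sub b.succ = a - (b + 1) := fun _ _ => rfl
  have hp : need.pred = need - 1 := rfl
  rw [ext_unfold, hs]
  generalize n - (k + 1) = j
  simp only [force_eq, ifz_eq, land_pw, hs, hp, Nat.sub_eq_zero_iff_le, ite_not,
    ← Bool.not_eq_true]

theorem mem_ext_of_mem {n D v : ℕ} : ∀ (k f need M A Z : ℕ) (acc : List St) (t : St),
    t ∈ acc → t ∈ ext n D v k f need M A Z acc := by
  intro k
  induction k with
  | zero => intro f need M A Z acc t ht; exact List.mem_cons_of_mem _ ht
  | succ k ih =>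
    intro f need M A Z acc t ht
    rw [ext_succ]
    split_ifs
    all_goals first
      | exact List.mem_cons_of_mem _ ht
      | exact ih _ _ _ _ _ _ _ (ih _ _ _ _ _ _ _ ht)
      | exact ih _ _ _ _ _ _ _ ht

theorem Inv.comap_swap {R : SimpleGraph ℕ} {M A Z a b : ℕ} (h : Inv R M A Z)
    (ha : a < 11) (hb : b < 11) (hA : A.testBit a = false) (hB : A.testBit b = false)
    (hab : row M a = row M b) : Inv (R.comap (Equiv.swap a b)) M A Z := by
  rw [row_eq_iff] at hab
  have hlt : ∀ i < 11, Equiv.swap a b i < 11 := fun i hi => (Preserves.swap ha hb i).2 hi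
  have key : ∀ i < 11, ∀ j < 11, bit M (Equiv.swap a b i) j = bit M i j := by
    intro i hi j hj
    rw [Equiv.swap_apply_def]
    split_ifs <;> grind
  have key' : ∀ i < 11, ∀ j < 11, bit M (Equiv.swap a b i) (Equiv.swap a b j) = bit M i j := by
    intro i hi j hj
    rw [key i hi _ (hlt j hj), h.symm i hi _ (hlt j hj), key j hj i hi, h.symm j hj i hi]
  refine ⟨h.symm, fun i hi j hj hij => ?_, fun i hi j hj hi' hij => ?_, h.pair⟩
  · exact h.adj _ (hlt i hi) _ (hlt j hj) (by rwa [key' i hi j hj])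
  · rw [← key' i hi j hj]
    refine h.known _ (hlt i hi) _ (hlt j hj) ?_ hij
    rwa [Equiv.swap_apply_of_ne_of_ne] <;> rintro rfl <;> simp_all

theorem Inv.insert_edge {R : SimpleGraph ℕ} {M A Z v j : ℕ} (h : Inv R M A Z) (hv : v < 11)
    (hj : j < 11) (hR : R.Adj v j) : Inv R (Nat.lor M (Nat.lor (pos v j) (pos j v))) A Z := by
  have e : ∀ a < 11, ∀ b < 11, bit (Nat.lor M (Nat.lor (pos v j) (pos j v))) a b =
      (bit M a b || (decide (v = a ∧ j = b) || decide (j = a ∧ v = b))) := by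
    intro a ha b hb
    rw [bit_lor, bit_lor, bit_pos _ _ _ _ hj hb, bit_pos _ _ _ _ hv hb]
  refine ⟨fun a ha b hb => ?_, fun a ha b hb hab => ?_, fun a ha b hb hA hab => ?_, h.pair⟩
  · rw [e a ha b hb, e b hb a ha, h.symm a ha b hb]
    grind
  · rw [e a ha b hb] at hab
    have := h.adj a ha b hb
    have := hR.symm
    grind
  · rw [e a ha b hb, h.known a ha b hb hA hab]
    rfl

theorem Inv.insert_vertex {R : SimpleGraph ℕ} {M A Z v : ℕ} (h : Inv R M A Z) (hv : v < 11)
    (hR : ∀ j < 11, R.Adj v j → bit M v j) :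
    Inv R M (Nat.lor A (pw v)) (Nat.lor Z (cross v)) := by
  refine ⟨h.symm, h.adj, fun a ha b hb hA hab => ?_, fun a ha b hb hab => ?_⟩
  · rw [testBit_lor_pw] at hA
    have := h.known a ha b hb
    have := hR b hb
    grind
  · rw [testBit_lor_pw, testBit_lor_pw]
    rw [bit_lor, bit_cross v a b hv ha hb] at hab
    have := h.pair a ha b hb
    grind

theorem pop_insert {M v j : ℕ} (hj : j < 11) (h : bit M v j = false) :
    pop (row M v) + 1 ≤ pop (row (Nat.lor M (Nat.lor (pos v j) (pos j v))) v) := by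
  rw [pop_row, pop_row]
  have : insert j ((Finset.range 11).filter (fun i => bit M v i)) ⊆
      (Finset.range 11).filter (fun i => bit (Nat.lor M (Nat.lor (pos v j) (pos j v))) v i) := by
    intro i
    simp only [Finset.mem_insert, Finset.mem_filter, Finset.mem_range]
    rintro (rfl | ⟨hi, hm⟩)
    · exact ⟨hj, by rw [bit_lor, bit_lor, bit_pos _ _ _ _ hj hj]; simp⟩
    · exact ⟨hi, by rw [bit_lor, hm]; rfl⟩
  have := Finset.card_le_card this
  rwa [Finset.card_insert_of_notMem (by simp [h])] at this

theorem ext_sound {n D v : ℕ} {maxl : Bool} (hn : n ≤ 11) (hv : v < n) :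
    ∀ (k f need M A Z : ℕ) (acc : List St) (R : SimpleGraph ℕ), k ≤ n → Admissible n D maxl R →
    Inv R M A Z → A.testBit v = false →
    (∀ i < n - k, R.Adj v i → bit M v i) →
    (∀ i < n, n - k ≤ i → A.testBit i = false → i ≠ v → f.testBit (row M i) → ¬ R.Adj v i) →
    D ≤ pop (row M v) + need →
    ∃ σ, Preserves n σ ∧ ∃ t ∈ ext n D v k f need M A Z acc, Inv (R.comap σ) t.M t.A t.Z ∧
      t.A.testBit v = false ∧ ∀ i < 11, (R.comap σ).Adj v i → bit t.M v i := by
  intro k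
  have hv' : v < 11 := hv.trans_le hn
  induction k with
  | zero =>
    intro f need M A Z acc R _ hR hI hA hp _ _
    exact ⟨Equiv.refl _, fun _ => Iff.rfl, ⟨M, A, Z⟩, List.mem_cons_self, hI, hA,
      fun i _ h => hp i (hR.lt _ _ h.symm) h⟩
  | succ k ih =>
    intro f need M A Z acc R hk hR hI hA hp hf hneed
    rw [ext_succ]
    have hjn : n - (k + 1) < n := by omega
    have hjk : n - k = n - (k + 1) + 1 := by omega
    rw [hjk] at ih
    generalize n - (k + 1) = j at *
    have hj : j < 11 := hjn.trans_le hn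
    split_ifs with h1 h2 h3 h4
    · exact ⟨Equiv.refl _, fun _ => Iff.rfl, ⟨M, A, Z⟩, List.mem_cons_self, hI, hA,
        fun i hi h => hI.saturated hv' ((hR.deg_le v).trans (by omega)) hi h⟩
    · refine ih _ _ _ _ _ _ R (by omega) hR hI hA ?_ (fun i hi hi' => hf i hi (by omega)) hneed
      intro i hi h
      rcases Nat.lt_succ_iff_lt_or_eq.1 hi with hi | rfl
      · exact hp i hi h
      · have e : (Nat.lor (row M v) (Nat.lor A (pw v))).testBit i =
            ((row M v).testBit i || (A.testBit i || decide (v = i))) := by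
          rw [← testBit_lor_pw]
          exact Nat.testBit_or ..
        rw [e, testBit_row] at h2
        have := h.ne
        have := hI.known i hj v hv'
        have := hI.symm i hj v hv'
        have := h.symm
        grind
    · refine ih _ _ _ _ _ _ R (by omega) hR hI hA ?_ (fun i hi hi' => hf i hi (by omega)) hneed
      intro i hi h
      rcases Nat.lt_succ_iff_lt_or_eq.1 hi with hi | rfl
      · exact hp i hi h
      · by_cases hAi : A.testBit i
        · rw [hI.symm v hv' i hj]
          exact hI.known i hj v hv' hAi h.symm
        · exact absurd h (hf i hjn le_rfl (by simpa using hAi) h.ne' h3)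
    all_goals
      have e : (Nat.lor (row M v) (Nat.lor A (pw v))).testBit j =
            ((row M v).testBit j || (A.testBit j || decide (v = j))) := by
          rw [← testBit_lor_pw]
          exact Nat.testBit_or ..
      rw [e, testBit_row] at h2
      have hvj : v ≠ j := by grind
      have hAj : A.testBit j = false := by grind
      have hMj : bit M v j = false := by grind
      by_cases hex : ∃ j', j ≤ j' ∧ j' < n ∧ A.testBit j' = false ∧ j' ≠ v ∧
        row M j' = row M j ∧ R.Adj v j'
      · obtain ⟨j', hjj, hj'n, hAj', hj'v, hrow, hadj⟩ := hex
        have hP : Preserves n (Equiv.swap j j') := Preserves.swap hjn hj'n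
        have hI' := hI.comap_swap hj (hj'n.trans_le hn) hAj hAj' hrow.symm
        have hR' := hR.comap hn hP
        have hadj' : (R.comap (Equiv.swap j j')).Adj v j := by
          rw [SimpleGraph.comap_adj, Equiv.swap_apply_left, Equiv.swap_apply_of_ne_of_ne hvj hj'v.symm]
          exact hadj
        have hI2 := hI'.insert_edge hv' hj hadj'
        have hb : ∀ i < 11, bit M v i → bit (Nat.lor M (Nat.lor (pos v j) (pos j v))) v i := by
          intro i _ h
          rw [bit_lor, h]
          rfl
        have hp' : ∀ i < j + 1, (R.comap (Equiv.swap j j')).Adj v i →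
            bit (Nat.lor M (Nat.lor (pos v j) (pos j v))) v i := by
          intro i hi h
          rcases Nat.lt_succ_iff_lt_or_eq.1 hi with hi | rfl
          · refine hb i (by omega) (hp i hi ?_)
            rwa [SimpleGraph.comap_adj, Equiv.swap_apply_of_ne_of_ne hvj hj'v.symm,
              Equiv.swap_apply_of_ne_of_ne (by omega) (by omega)] at h
          · rw [bit_lor, bit_lor, bit_pos _ _ _ _ hj hj]
            simp
        have hrow' : ∀ i < 11, i ≠ v → i ≠ j →
            row (Nat.lor M (Nat.lor (pos v j) (pos j v))) i = row M i := by
          intro i _ h1 h2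
          rw [row_eq_iff]
          intro b hb
          rw [bit_lor, bit_lor, bit_pos _ _ _ _ hj hb, bit_pos _ _ _ _ hv' hb]
          grind
        have hf' : ∀ i < n, j + 1 ≤ i → A.testBit i = false → i ≠ v →
            f.testBit (row (Nat.lor M (Nat.lor (pos v j) (pos j v))) i) →
            ¬ (R.comap (Equiv.swap j j')).Adj v i := by
          intro i hi hi' hAi hiv hfi
          rw [hrow' i (by omega) hiv (by omega)] at hfi
          have hij' : i ≠ j' := by
            rintro rfl
            rw [hrow] at hfi
            exact h3 hfi
          rw [SimpleGraph.comap_adj, Equiv.swap_apply_of_ne_of_ne hvj hj'v.symm,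
              Equiv.swap_apply_of_ne_of_ne (by omega) hij']
          exact hf i hi (by omega) hAi hiv hfi
        have hneed' : D ≤ pop (row (Nat.lor M (Nat.lor (pos v j) (pos j v))) v) + (need - 1) := by
          have := pop_insert hj hMj
          omega
        first
        | have hdeg : deg (R.comap (Equiv.swap j j')) j ≤
              pop (row (Nat.lor M (Nat.lor (pos v j) (pos j v))) j) := by
            have := pop_insert (M := M) hv' ((hI.symm j hj v hv').trans hMj)
            have e : Nat.lor (pos v j) (pos j v) = Nat.lor (pos j v) (pos v j) := Nat.lor_comm _ _
            rw [e]
            exact (hR'.deg_le j).trans (h4.trans this)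
          obtain ⟨σ, hσ, t, ht, h⟩ := ih f (need - 1)
            (Nat.lor M (Nat.lor (pos v j) (pos j v))) (Nat.lor A (pw j)) (Nat.lor Z (cross j))
            (ext n D v k (Nat.lor f (pw (row M j))) need M A Z acc) _ (by omega) hR'
            (hI2.insert_vertex hj fun i hi h => hI2.saturated hj hdeg hi h)
            (by rw [testBit_lor_pw, hA]; simpa using hvj.symm) hp'
            (fun i hi hi' hAi => hf' i hi hi' (by rw [testBit_lor_pw] at hAi; grind)) hneed'
          exact ⟨σ.trans (Equiv.swap j j'), hσ.trans hP, t, ht, h⟩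
        | obtain ⟨σ, hσ, t, ht, h⟩ := ih f (need - 1)
            (Nat.lor M (Nat.lor (pos v j) (pos j v))) A Z
            (ext n D v k (Nat.lor f (pw (row M j))) need M A Z acc) _ (by omega) hR'
            hI2 hA hp' hf' hneed'
          exact ⟨σ.trans (Equiv.swap j j'), hσ.trans hP, t, ht, h⟩
      · push Not at hex
        obtain ⟨σ, hσ, t, ht, h⟩ := ih (Nat.lor f (pw (row M j))) need M A Z acc R (by omega) hR hI hA
          (by
            intro i hi h
            rcases Nat.lt_succ_iff_lt_or_eq.1 hi with hi | rfl
            · exact hp i hi h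
            · exact absurd h (hex i le_rfl hjn hAj hvj.symm rfl))
          (by
            intro i hi hi' hAi hiv hfi
            rw [testBit_lor_pw] at hfi
            rcases Bool.or_eq_true_iff.1 hfi with hfi | hfi
            · exact hf i hi (by omega) hAi hiv hfi
            · exact hex i (by omega) hi hAi hiv (by simpa using Eq.symm (of_decide_eq_true hfi)))
          hneed
        exact ⟨σ, hσ, t, mem_ext_of_mem _ _ _ _ _ _ _ _ ht, h⟩

/-- `l` is a family of disjoint singletons and pairs of numbers below `n`, any two of which are
related by `r`, as are the two elements of each pair. -/
def Bags (r : ℕ → ℕ → Prop) (n : ℕ) (l : List (ℕ × ℕ)) : Prop :=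
  (∀ p ∈ l, p.1 < n ∧ p.2 < n ∧ (p.1 = p.2 ∨ r p.1 p.2)) ∧
  l.Pairwise fun p q => (p.1 ≠ q.1 ∧ p.1 ≠ q.2 ∧ p.2 ≠ q.1 ∧ p.2 ≠ q.2) ∧
    (r p.1 q.1 ∨ r p.1 q.2 ∨ r p.2 q.1 ∨ r p.2 q.2)

/-- Six bags missing a vertex. -/
def SixModel (R : SimpleGraph ℕ) (n : ℕ) : Prop :=
  ∃ l, l.length = 6 ∧ Bags (fun i j => ¬ R.Adj i j) n l ∧ ∃ x < n, ∀ p ∈ l, p.1 ≠ x ∧ p.2 ≠ x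

theorem validBags_sound {n : ℕ} : ∀ (l : List (ℕ × ℕ)) (u : ℕ), u < 2 ^ n →
    validBags (2 ^ n - 1) l u = true →
    (∀ p ∈ l, p.1 < n ∧ p.2 < n ∧ u.testBit p.1 = false ∧ u.testBit p.2 = false) ∧
    (l.Pairwise fun p q => p.1 ≠ q.1 ∧ p.1 ≠ q.2 ∧ p.2 ≠ q.1 ∧ p.2 ≠ q.2) ∧
    ∃ x < n, u.testBit x = false ∧ ∀ p ∈ l, p.1 ≠ x ∧ p.2 ≠ x := by
  intro l
  induction l with
  | nil =>
    intro u hu h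
    refine ⟨by simp, by simp, ?_⟩
    by_contra! hx
    have : u = 2 ^ n - 1 := by
      apply Nat.eq_of_testBit_eq
      intro i
      rw [Nat.testBit_two_pow_sub_one]
      by_cases hi : i < n
      · have := hx i hi
        cases hb : u.testBit i <;> simp_all
      · rw [Nat.testBit_lt_two_pow (hu.trans_le (Nat.pow_le_pow_right (by norm_num) (by omega)))]
        simp [hi]
    simp [validBags, Nat.blt_eq, this] at h
  | cons p l ih =>
    obtain ⟨a, b⟩ := p
    intro u hu h
    simp only [validBags, force_eq, Bool.and_eq_true] at h
    obtain ⟨h1, h2⟩ := h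
    have h1 := Nat.eq_of_beq_eq_true h1
    have tb : ∀ i, (Nat.lor u (Nat.lor (pw a) (pw b))).testBit i =
        (u.testBit i || (decide (a = i) || decide (b = i))) := by
      intro i
      change (u ||| (2 ^ a ||| 2 ^ b)).testBit i = _
      simp [Nat.testBit_or, Nat.testBit_two_pow]
    have hd : ∀ i, ¬ (u.testBit i ∧ (a = i ∨ b = i)) := by
      rintro i ⟨h3, h4⟩
      have h5 : (u &&& (2 ^ a ||| 2 ^ b)).testBit i = (0 : ℕ).testBit i :=
        congrArg (fun r => r.testBit i) h1
      simp [Nat.testBit_or, Nat.testBit_and, Nat.testBit_two_pow] at h5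
      grind
    have hlt : Nat.lor u (Nat.lor (pw a) (pw b)) < 2 ^ n := by
      by_contra! hge
      have : ∀ (l : List (ℕ × ℕ)) (w : ℕ), 2 ^ n ≤ w → validBags (2 ^ n - 1) l w = false := by
        intro l
        induction l with
        | nil =>
          intro w hw
          rw [validBags, Bool.eq_false_iff, Ne, Nat.blt_eq]
          omega
        | cons p l ih =>
          intro w hw
          simp only [validBags, force_eq]
          rw [ih (Nat.lor w (Nat.lor (pw p.1) (pw p.2))) (hw.trans Nat.left_le_or), Bool.and_false]
      rw [this _ _ hge] at h2
      exact absurd h2 (by simp)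
    have han : ∀ i, a = i ∨ b = i → i < n := by
      intro i hi
      by_contra! hin
      have h6 := Nat.testBit_lt_two_pow (hlt.trans_le (Nat.pow_le_pow_right (by norm_num) hin))
      rw [tb] at h6
      grind
    obtain ⟨i1, i2, x, hx, i3, i4⟩ := ih _ hlt h2
    simp only [tb] at i1 i3
    refine ⟨?_, ?_, x, hx, ?_, ?_⟩
    · intro p hp
      rcases List.mem_cons.1 hp with rfl | hp
      · have := hd a
        have := hd b
        have := han a
        have := han b
        grind
      · have := i1 p hp
        grind
    · refine List.Pairwise.cons ?_ i2
      intro q hq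
      have := i1 q hq
      grind
    · grind
    · intro p hp
      rcases List.mem_cons.1 hp with rfl | hp
      · grind
      · exact i4 p hp

theorem decodeBags_length (m : ℕ) : ∀ k, (decodeBags k m).length = k := by
  intro k
  induction k generalizing m with
  | zero => rfl
  | succ k ih => simp [decodeBags, force_eq, ih]

theorem mem_decodeModels {full : ℕ} {rs : List ℕ} : ∀ (k m : ℕ), rs ∈ decodeModels full k m →
    ∃ l, l.length = 6 ∧ validBags full l 0 = true ∧ rs = requirements l := by
  intro k
  induction k with
  | zero => intro m h; simp [decodeModels] at h
  | succ k ih =>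
    intro m h
    simp only [decodeModels, force_eq] at h
    cases h1 : Nat.beq m 0 <;> simp only [h1, cond_true, cond_false] at h
    · cases h2 : validBags full (decodeBags 6 m) 0 <;> simp only [h2, cond_true, cond_false] at h
      · simp at h
      · rcases List.mem_cons.1 h with rfl | h
        · exact ⟨_, decodeBags_length _ _, h2, rfl⟩
        · exact ih _ h
    · simp at h

theorem requirements_cons (a b : ℕ) (t : List (ℕ × ℕ)) :
    requirements ((a, b) :: t) =
      t.map (fun c => Nat.lor (Nat.lor (pos a c.1) (pos a c.2))
        (Nat.lor (pos b c.1) (pos b c.2))) ++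
      (if a = b then requirements t else pos a b :: requirements t) := by
  have : ∀ (g : ℕ × ℕ → ℕ) (l : List (ℕ × ℕ)) (base : List ℕ),
      l.foldr (fun c acc => g c :: acc) base = l.map g ++ base := by
    intro g l base
    induction l with
    | nil => rfl
    | cons c l ih => simp [ih]
  simp only [requirements, force_eq, this]
  congr 1
  by_cases h : a = b
  · simp [h]
  · have hb : Nat.beq a b = false := Bool.eq_false_iff.2 fun hb => h (Nat.eq_of_beq_eq_true hb)
    rw [if_neg h, hb]
    rfl

theorem land_ne_zero {K r : ℕ} (h : Nat.land K r ≠ 0) : ∃ i, K.testBit i ∧ r.testBit i := by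
  by_contra! hc
  refine h (Nat.eq_of_testBit_eq fun i => ?_)
  change (K &&& r).testBit i = _
  rw [Nat.testBit_and, Nat.zero_testBit]
  have := hc i
  grind

theorem testBit_pos (a b i : ℕ) : (pos a b).testBit i = decide (11 * a + b = i) :=
  Nat.testBit_two_pow

theorem requirements_sound {K : ℕ} : ∀ l : List (ℕ × ℕ),
    (∀ r ∈ requirements l, Nat.land K r ≠ 0) →
    (∀ p ∈ l, p.1 = p.2 ∨ bit K p.1 p.2) ∧
    l.Pairwise fun p q => bit K p.1 q.1 ∨ bit K p.1 q.2 ∨ bit K p.2 q.1 ∨ bit K p.2 q.2 := by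
  intro l
  induction l with
  | nil => simp
  | cons p l ih =>
    obtain ⟨a, b⟩ := p
    intro h
    rw [requirements_cons] at h
    simp only [List.mem_append, List.mem_map] at h
    obtain ⟨h1, h2⟩ := ih fun r hr => h r (Or.inr (by split_ifs <;> simp [hr]))
    refine ⟨?_, List.Pairwise.cons ?_ h2⟩
    · intro p hp
      rcases List.mem_cons.1 hp with rfl | hp
      · by_cases hab : a = b
        · exact Or.inl hab
        · obtain ⟨i, hi, hi'⟩ := land_ne_zero (h (pos a b) (Or.inr (by simp [hab])))
          rw [testBit_pos] at hi'
          rw [← of_decide_eq_true hi'] at hi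
          exact Or.inr hi
      · exact h1 p hp
    · intro q hq
      obtain ⟨i, hi, hi'⟩ := land_ne_zero (h _ (Or.inl ⟨q, hq, rfl⟩))
      have e : (Nat.lor (Nat.lor (pos a q.1) (pos a q.2)) (Nat.lor (pos b q.1) (pos b q.2))).testBit i
          = ((decide (11 * a + q.1 = i) || decide (11 * a + q.2 = i)) ||
            (decide (11 * b + q.1 = i) || decide (11 * b + q.2 = i))) := by
        change ((_ ||| _) ||| (_ ||| _) : ℕ).testBit i = _
        simp only [Nat.testBit_or, testBit_pos]
      rw [e] at hi'
      simp only [Bool.or_eq_true, decide_eq_true_eq] at hi'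
      rcases hi' with (rfl | rfl) | (rfl | rfl)
      · exact Or.inl hi
      · exact Or.inr (Or.inl hi)
      · exact Or.inr (Or.inr (Or.inl hi))
      · exact Or.inr (Or.inr (Or.inr hi))

theorem allR_eq (K : ℕ) (l : List ℕ) : allR K l = true ↔ ∀ r ∈ l, Nat.land K r ≠ 0 := by
  induction l with
  | nil => simp [allR]
  | cons r l ih =>
    change ifz (Nat.land K r) false (allR K l) = true ↔ _
    rw [ifz_eq]
    split_ifs with h
    · simp only [List.mem_cons, forall_eq_or_imp, ne_eq, h]
      simp
    · simp only [List.mem_cons, forall_eq_or_imp, ne_eq, h, ih]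
      simp

theorem anyM_eq (K : ℕ) (l : List (List ℕ)) : anyM K l = true ↔ ∃ rs ∈ l, allR K rs = true := by
  induction l with
  | nil => simp [anyM]
  | cons r l ih =>
    have : anyM K (r :: l) = (allR K r || anyM K l) := by
      change Bool.rec (motive := fun _ => Bool) (anyM K l) true (allR K r) = _
      cases allR K r <;> rfl
    simp [this, ih]

theorem anyM_sound {n : ℕ} (hn : n ≤ 11) {R : SimpleGraph ℕ} {M A Z fuel c : ℕ}
    (hI : Inv R M A Z) (h : anyM (Nat.xor Z (Nat.land Z (Nat.lor M diag)))
      (decodeModels (2 ^ n - 1) fuel c) = true) : SixModel R n := by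
  rw [anyM_eq] at h
  obtain ⟨rs, hrs, h⟩ := h
  obtain ⟨l, hl, hv, rfl⟩ := mem_decodeModels _ _ hrs
  rw [allR_eq] at h
  obtain ⟨h1, h2⟩ := requirements_sound l h
  obtain ⟨v1, v2, x, hx, -, v3⟩ := validBags_sound l 0 (by positivity) hv
  have key : ∀ a < n, ∀ b < n,
      bit (Nat.xor Z (Nat.land Z (Nat.lor M diag))) a b → ¬ R.Adj a b := by
    intro a ha b hb hab hR
    have ha := ha.trans_le hn
    have hb := hb.trans_le hn
    have e : bit (Nat.xor Z (Nat.land Z (Nat.lor M diag))) a b =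
        (bit Z a b ^^ (bit Z a b && (bit M a b || bit diag a b))) := by
      change (Z ^^^ (Z &&& (M ||| diag))).testBit _ = _
      simp only [Nat.testBit_xor, Nat.testBit_and, Nat.testBit_or]
      rfl
    rw [e] at hab
    have := hI.pair a ha b hb
    have := hI.known a ha b hb
    have := hI.known b hb a ha
    have := hI.symm a ha b hb
    have := hR.symm
    grind
  refine ⟨l, hl, ⟨fun p hp => ⟨(v1 p hp).1, (v1 p hp).2.1, (h1 p hp).imp_right
    (key _ (v1 p hp).1 _ (v1 p hp).2.1)⟩, ?_⟩, x, hx, v3⟩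
  refine (v2.and h2).imp_of_mem ?_
  rintro p q hp hq ⟨hd, hb⟩
  obtain ⟨p1, p2, -⟩ := v1 p hp
  obtain ⟨q1, q2, -⟩ := v1 q hq
  exact ⟨hd, hb.imp (key _ p1 _ q1) (Or.imp (key _ p1 _ q2) (Or.imp (key _ p2 _ q1) (key _ p2 _ q2)))⟩

/-- `R` is the graph with adjacency matrix `E`. -/
def HasMatrix (R : SimpleGraph ℕ) (n E : ℕ) : Prop :=
  ∀ i < n, ∀ j < n, R.Adj i j ↔ bit E i j

theorem covered_sound {n E fuel c : ℕ} (hn : n ≤ 11) {R : SimpleGraph ℕ} {s : St}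
    (hI : Inv R s.M s.A s.Z)
    (h : covered E (2 ^ n - 1) diag (decodeModels (2 ^ n - 1) fuel c) s = true) :
    SixModel R n ∨ HasMatrix R n E := by
  simp only [covered, force_eq, Bool.or_eq_true, Bool.and_eq_true] at h
  rcases h with ⟨h1, h2⟩ | h
  · right
    intro i hi j hj
    rw [← Nat.eq_of_beq_eq_true h1]
    refine ⟨hI.known i (hi.trans_le hn) j (hj.trans_le hn) ?_,
      hI.adj i (hi.trans_le hn) j (hj.trans_le hn)⟩
    rw [Nat.eq_of_beq_eq_true h2, Nat.testBit_two_pow_sub_one]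
    simpa using hi
  · exact Or.inl (anyM_sound hn hI h)

theorem deficient_sound {D M A rv : ℕ} : ∀ k, deficient D M A rv k = true →
    ∃ u < k, A.testBit u = true ∧ rv.testBit u = false ∧ pop (row M u) < D := by
  intro k
  induction k with
  | zero => simp [deficient]
  | succ k ih =>
    intro h
    change ifz (Nat.land A (pw k)) (deficient D M A rv k) (ifz (Nat.land rv (pw k))
      (ifz (Nat.sub D (pop (row M k))) (deficient D M A rv k) true) (deficient D M A rv k)) = true at h
    simp only [ifz_eq, land_pw] at h
    have hs : ∀ a b : ℕ, a.sub b = a - b := fun _ _ => rfl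
    have : (∃ u < k, A.testBit u = true ∧ rv.testBit u = false ∧ pop (row M u) < D) →
      ∃ u < k + 1, A.testBit u = true ∧ rv.testBit u = false ∧ pop (row M u) < D :=
      fun ⟨u, hu, h⟩ => ⟨u, hu.trans (Nat.lt_succ_self k), h⟩
    split_ifs at h with h1 h2 h3
    · exact this (ih h)
    · exact this (ih h)
    · rw [hs] at h3
      exact ⟨k, Nat.lt_succ_self k, by simpa using h1, h2, by omega⟩
    · exact this (ih h)

theorem pruned_sound {n D v M A Z : ℕ} (hn : n ≤ 11) {R : SimpleGraph ℕ}
    (hR : Admissible n D true R) (hI : Inv R M A Z) (hv : v < n) (hA : A.testBit v = false)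
    (hvM : ∀ i < 11, R.Adj v i → bit M v i) : pruned n D v ⟨M, A, Z⟩ = false := by
  rw [Bool.eq_false_iff]
  intro h
  simp only [pruned, force_eq, ifz_eq] at h
  split_ifs at h with h1
  have hs : ∀ a b : ℕ, a.sub b = a - b := fun _ _ => rfl
  rw [hs] at h1
  obtain ⟨u, hu, hu1, hu2, hu3⟩ := deficient_sound _ h
  have hI' := hI.insert_vertex (hv.trans_le hn) hvM
  have e1 := hI'.pop_eq_deg (hv.trans_le hn) (by rw [testBit_lor_pw]; simp)
  have e2 := hI.pop_eq_deg (hu.trans_le hn) hu1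
  have hne : v ≠ u := by
    rintro rfl
    simp [hA] at hu1
  have hna : ¬ R.Adj v u := by
    intro h
    rw [testBit_row, hvM u (hu.trans_le hn) h] at hu2
    simp [hu.trans_le hn] at hu2
  rcases hR.maximal rfl v hv u hu hne hna with h | h <;> omega

theorem mem_foldr_cond (p : St → Bool) (g : St → St) (rest : List St) (t : St) :
    ∀ l : List St, t ∈ l → p t = false →
      g t ∈ l.foldr (fun t acc => bif p t then acc else g t :: acc) rest := by
  intro l
  induction l with
  | nil => simp
  | cons a l ih =>
    intro ht hp
    rw [List.foldr_cons]
    rcases List.mem_cons.1 ht with rfl | ht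
    · rw [hp]
      exact List.mem_cons_self
    · cases p a
      · exact List.mem_cons_of_mem _ (ih ht hp)
      · exact ih ht hp

theorem mem_foldr_cond_of_mem (p : St → Bool) (g : St → St) (rest : List St) (t : St)
    (ht : t ∈ rest) : ∀ l : List St,
      t ∈ l.foldr (fun t acc => bif p t then acc else g t :: acc) rest := by
  intro l
  induction l with
  | nil => exact ht
  | cons a l ih =>
    rw [List.foldr_cons]
    cases p a
    · exact List.mem_cons_of_mem _ ih
    · exact ih

theorem expand_eq (n D : ℕ) (maxl : Bool) (E full diag : ℕ) (c : ℕ) (s : St) (rest : List St) :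
    expand n D maxl E full diag c s rest =
      bif Nat.blt (Nat.land c 15) n && !tb s.A (Nat.land c 15) then
        (ext n D (Nat.land c 15) n 0 (Nat.sub D (pop (row s.M (Nat.land c 15)))) s.M s.A s.Z []).foldr
          (fun t acc =>
            bif (maxl && pruned n D (Nat.land c 15) t) || covered E full diag
              (decodeModels full 30 (Nat.shiftRight c 4)) (finish (Nat.land c 15) t) then acc
            else finish (Nat.land c 15) t :: acc) rest
      else s :: rest := by
  simp only [expand, force_eq]

theorem finish_eq (v : ℕ) (s : St) :
    finish v s = ⟨s.M, Nat.lor s.A (pw v), Nat.lor s.Z (cross v)⟩ := by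
  simp only [finish, force_eq]

/-- Some relabelling of `R` has a six-bag model or is the graph with matrix `E`. -/
def Resolved (R : SimpleGraph ℕ) (n E : ℕ) : Prop :=
  ∃ σ, Preserves n σ ∧ (SixModel (R.comap σ) n ∨ HasMatrix (R.comap σ) n E)

theorem Resolved.of_comap {R : SimpleGraph ℕ} {n E : ℕ} {σ : Equiv.Perm ℕ} (hσ : Preserves n σ)
    (h : Resolved (R.comap σ) n E) : Resolved R n E := by
  obtain ⟨τ, hτ, h⟩ := h
  exact ⟨τ.trans σ, hτ.trans hσ, h⟩

theorem expand_sound {n D E c : ℕ} {maxl : Bool} (hn : n ≤ 11) {R : SimpleGraph ℕ}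
    (hR : Admissible n D maxl R) {s : St} (hI : Inv R s.M s.A s.Z) (rest : List St) :
    Resolved R n E ∨ ∃ σ, Preserves n σ ∧
      ∃ t ∈ expand n D maxl E (2 ^ n - 1) diag c s rest, Inv (R.comap σ) t.M t.A t.Z := by
  rw [expand_eq]
  generalize Nat.land c 15 = v
  cases hc : Nat.blt v n && !tb s.A v
  · exact Or.inr ⟨Equiv.refl _, fun _ => Iff.rfl, s, List.mem_cons_self, hI⟩
  rw [cond_true]
  rw [Bool.and_eq_true, Nat.blt_eq, tb_eq, Bool.not_eq_true'] at hc
  obtain ⟨hv, hA⟩ := hc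
  have hs : ∀ a b : ℕ, a.sub b = a - b := fun _ _ => rfl
  obtain ⟨σ, hσ, t, ht, hI', hA', hvM⟩ := ext_sound hn hv n 0
    (Nat.sub D (pop (row s.M v))) s.M s.A s.Z [] R le_rfl hR hI hA (by simp) (by simp)
    (by rw [hs]; omega)
  have hI2 := hI'.insert_vertex (hv.trans_le hn) hvM
  have hR' := hR.comap hn hσ
  cases hb : (maxl && pruned n D v t) || covered E (2 ^ n - 1) diag
              (decodeModels (2 ^ n - 1) 30 (Nat.shiftRight c 4)) (finish v t)
  · refine Or.inr ⟨σ, hσ, finish v t, ?_, by rw [finish_eq]; exact hI2⟩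
    exact mem_foldr_cond _ (finish v) rest t _ ht hb
  · left
    rw [Bool.or_eq_true, Bool.and_eq_true] at hb
    rcases hb with ⟨rfl, h⟩ | h
    · rw [pruned_sound hn hR' hI' hv hA' hvM] at h
      exact absurd h (by simp)
    · rw [finish_eq] at h
      exact ⟨σ, hσ, covered_sound hn hI2 h⟩

theorem search_sound {n D E : ℕ} {maxl : Bool} (hn : n ≤ 11) :
    ∀ (cs : List ℕ) (l : List St) (R : SimpleGraph ℕ) (s : St), Admissible n D maxl R →
      s ∈ l → Inv R s.M s.A s.Z →
      (search n D maxl E (2 ^ n - 1) diag cs l).isEmpty = true → Resolved R n E := by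
  intro cs
  induction cs with
  | nil =>
    intro l R s _ hs _ h
    rw [search, List.isEmpty_iff] at h
    simp [h] at hs
  | cons c cs ih =>
    intro l R s hR hs hI h
    cases l with
    | nil => simp at hs
    | cons a l =>
      rw [search] at h
      rcases List.mem_cons.1 hs with rfl | hs
      · rcases expand_sound (E := E) (c := c) hn hR hI l with h' | ⟨σ, hσ, t, ht, hI'⟩
        · exact h'
        · exact (ih _ _ t (hR.comap hn hσ) ht hI' h).of_comap hσ
      · refine ih _ R s hR ?_ hI h
        rw [expand_eq]
        cases Nat.blt (Nat.land c 15) n && !tb a.A (Nat.land c 15)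
        · exact List.mem_cons_of_mem _ hs
        · exact mem_foldr_cond_of_mem _ (finish _) l s hs _

theorem resolved_of_search {n D E : ℕ} {maxl : Bool} (hn : n ≤ 11) {cs : List ℕ}
    (h : (search n D maxl E (2 ^ n - 1) diag cs [emptySt]).isEmpty = true) {R : SimpleGraph ℕ}
    (hR : Admissible n D maxl R) : Resolved R n E := by
  refine search_sound hn cs [emptySt] R emptySt hR (by simp) ?_ h
  constructor <;> simp [emptySt, bit]

end SixSearch

namespace SimpleGraph

variable {V : Type*} {G H : SimpleGraph V} {S T A B : Finset V}

/-- There is an edge between `S` and `T`. -/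
def Touch (G : SimpleGraph V) (S T : Finset V) : Prop := ∃ a ∈ S, ∃ b ∈ T, G.Adj a b

theorem Touch.symm (h : G.Touch S T) : G.Touch T S := by
  obtain ⟨a, ha, b, hb, hab⟩ := h
  exact ⟨b, hb, a, ha, hab.symm⟩

theorem Touch.mono {S' T' : Finset V} (h : G.Touch S T) (hS : S ⊆ S') (hT : T ⊆ T') :
    G.Touch S' T' := by
  obtain ⟨a, ha, b, hb, hab⟩ := h
  exact ⟨a, hS ha, b, hT hb, hab⟩

variable [DecidableEq V]

/-- `S` is nonempty and every partition of `S` into two parts is crossed by an edge. -/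
def Conn (G : SimpleGraph V) (S : Finset V) : Prop :=
  S.Nonempty ∧ ∀ A ⊆ S, A.Nonempty → A ≠ S → G.Touch A (S \ A)

theorem conn_singleton (G : SimpleGraph V) (v : V) : G.Conn {v} := by
  refine ⟨Finset.singleton_nonempty v, fun A hA hne hA' => ?_⟩
  exact absurd ((Finset.subset_singleton_iff.1 hA).resolve_left hne.ne_empty) hA'

/-- A criterion for connectedness: every partition into two parts, the first of which contains a
given vertex, is crossed by an edge. -/
theorem conn_of_forall {v : V} (hv : v ∈ S)
    (h : ∀ A ⊆ S, v ∈ A → A ≠ S → G.Touch A (S \ A)) : G.Conn S := by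
  refine ⟨⟨v, hv⟩, fun A hA hne hA' => ?_⟩
  by_cases hvA : v ∈ A
  · exact h A hA hvA hA'
  · have := h (S \ A) Finset.sdiff_subset (by simp [hv, hvA]) (by
      intro h
      obtain ⟨a, ha⟩ := hne
      have := hA ha
      rw [← h] at this
      simp [ha] at this)
    rw [Finset.sdiff_sdiff_eq_self hA] at this
    exact this.symm

/-- A connected set meeting `A` but not contained in it has an edge leaving `A`. -/
theorem Conn.touch_inter (hS : G.Conn S) {a b : V} (ha : a ∈ S) (haA : a ∈ A) (hb : b ∈ S)
    (hbA : b ∉ A) : G.Touch (S ∩ A) (S \ A) := by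
  have := hS.2 (S ∩ A) Finset.inter_subset_left ⟨a, by simp [ha, haA]⟩ (by
    intro h
    rw [← h] at hb
    simp [hbA] at hb)
  rwa [Finset.sdiff_inter_self_left] at this

theorem Conn.union_of_forall (hS : G.Conn S) (hT : ∀ y ∈ T, G.Touch S {y}) : G.Conn (S ∪ T) := by
  obtain ⟨v, hv⟩ := hS.1
  refine conn_of_forall (Finset.mem_union_left T hv) fun A hA hvA hne => ?_
  by_cases hSA : S ⊆ A
  · obtain ⟨y, hy, hyA⟩ := Finset.exists_of_ssubset (Finset.ssubset_iff_subset_ne.2 ⟨hA, hne⟩)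
    have hyT : y ∈ T := (Finset.mem_union.1 hy).resolve_left fun h => hyA (hSA h)
    exact (hT y hyT).mono hSA (by simp [hy, hyA])
  · obtain ⟨y, hy, hyA⟩ := Finset.not_subset.1 hSA
    exact (hS.touch_inter hv hvA hy hyA).mono Finset.inter_subset_right
      (Finset.sdiff_subset_sdiff Finset.subset_union_left le_rfl)

theorem Conn.union (hS : G.Conn S) (hT : G.Conn T) (h : G.Touch S T) : G.Conn (S ∪ T) := by
  obtain ⟨a, ha, b, hb, hab⟩ := h
  refine conn_of_forall (Finset.mem_union_left T ha) fun A hA haA hne => ?_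
  by_cases hSA : S ⊆ A
  · by_cases hbA : b ∈ A
    · obtain ⟨y, hy, hyA⟩ := Finset.exists_of_ssubset (Finset.ssubset_iff_subset_ne.2 ⟨hA, hne⟩)
      have hyT : y ∈ T := (Finset.mem_union.1 hy).resolve_left fun h => hyA (hSA h)
      exact (hT.touch_inter hb hbA hyT hyA).mono Finset.inter_subset_right
        (Finset.sdiff_subset_sdiff Finset.subset_union_right le_rfl)
    · exact ⟨a, haA, b, by simp [hb, hbA], hab⟩
  · obtain ⟨y, hy, hyA⟩ := Finset.not_subset.1 hSA
    exact (hS.touch_inter ha haA hy hyA).mono Finset.inter_subset_right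
      (Finset.sdiff_subset_sdiff Finset.subset_union_left le_rfl)

theorem Conn.mono (hS : G.Conn S) (h : ∀ a ∈ S, ∀ b ∈ S, G.Adj a b → H.Adj a b) : H.Conn S := by
  refine ⟨hS.1, fun A hA hne hA' => ?_⟩
  obtain ⟨a, ha, b, hb, hab⟩ := hS.2 A hA hne hA'
  exact ⟨a, ha, b, hb, h a (hA ha) b (Finset.sdiff_subset hb) hab⟩

theorem conn_pair {a b : V} (h : a = b ∨ G.Adj a b) : G.Conn {a, b} := by
  rcases h with rfl | h
  · simpa using conn_singleton G a
  · exact (conn_singleton G a).union (conn_singleton G b) ⟨a, by simp, b, by simp, h⟩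

/-- `C` is a connected component of the subgraph induced on `S`. -/
structure IsComp (G : SimpleGraph V) (S C : Finset V) : Prop where
  subset : C ⊆ S
  conn : G.Conn C
  not_adj : ∀ x ∈ C, ∀ y ∈ S, y ∉ C → ¬ G.Adj x y

theorem Conn.exists_isComp {D : Finset V} (hD : G.Conn D) (hDS : D ⊆ S) :
    ∃ C, G.IsComp S C ∧ D ⊆ C := by
  classical
  obtain ⟨C, hC, hmax⟩ := Finset.exists_max_image
    (S.powerset.filter fun C => G.Conn C ∧ D ⊆ C) Finset.card ⟨D, by simp [hDS, hD]⟩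
  simp only [Finset.mem_filter, Finset.mem_powerset] at hC hmax
  refine ⟨C, ⟨hC.1, hC.2.1, fun x hx y hy hyC hxy => ?_⟩, hC.2.2⟩
  have := hmax (C ∪ {y}) ⟨Finset.union_subset hC.1 (by simpa using hy),
    hC.2.1.union (conn_singleton G y) ⟨x, hx, y, by simp, hxy⟩,
    hC.2.2.trans Finset.subset_union_left⟩
  rw [Finset.card_union_of_disjoint (by simpa using hyC), Finset.card_singleton] at this
  omega

theorem exists_isComp_of_mem {v : V} (hv : v ∈ S) : ∃ C, G.IsComp S C ∧ v ∈ C := by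
  obtain ⟨C, hC, h⟩ := (conn_singleton G v).exists_isComp (by simpa using hv : {v} ⊆ S)
  exact ⟨C, hC, h (by simp)⟩

/-- A connected subset of `S` that meets a component of `S` is contained in it. -/
theorem IsComp.subset_of_mem {C D : Finset V} (hC : G.IsComp S C) (hD : G.Conn D) (hDS : D ⊆ S)
    {v : V} (hvC : v ∈ C) (hvD : v ∈ D) : D ⊆ C := by
  intro y hy
  by_contra hyC
  obtain ⟨a, ha, b, hb, hab⟩ := hD.touch_inter hvD hvC hy hyC
  rw [Finset.mem_inter] at ha
  rw [Finset.mem_sdiff] at hb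
  exact hC.not_adj a ha.2 b (hDS hb.1) hb.2 hab

theorem Conn.sdiff_isComp {P C : Finset V} (hS : G.Conn S) (hP : G.Conn P) (hPS : P ⊆ S)
    (hC : G.IsComp (S \ P) C) : G.Conn (S \ C) := by
  obtain ⟨v, hv⟩ := hP.1
  have hdis : ∀ x ∈ C, x ∉ P := fun x hx => (Finset.mem_sdiff.1 (hC.subset hx)).2
  have hPC : P ⊆ S \ C := fun x hx =>
    Finset.mem_sdiff.2 ⟨hPS hx, fun h => hdis x h hx⟩
  refine conn_of_forall (hPC hv) fun A hA hvA hne => ?_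
  by_cases hPA : P ⊆ A
  · obtain ⟨y, hy, hyA⟩ := Finset.exists_of_ssubset (Finset.ssubset_iff_subset_ne.2 ⟨hA, hne⟩)
    rw [Finset.mem_sdiff] at hy
    obtain ⟨a, ha, b, hb, hab⟩ := hS.touch_inter (A := A ∪ C) (hPS hv) (by simp [hvA]) hy.1
      (by simp [hyA, hy.2])
    simp only [Finset.mem_inter, Finset.mem_union, Finset.mem_sdiff, not_or] at ha hb
    rcases ha.2 with haA | haC
    · exact ⟨a, haA, b, by simp [hb], hab⟩
    · exact absurd hab (hC.not_adj a haC b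
        (Finset.mem_sdiff.2 ⟨hb.1, fun h => hb.2.1 (hPA h)⟩) hb.2.2)
  · obtain ⟨y, hy, hyA⟩ := Finset.not_subset.1 hPA
    exact (hP.touch_inter hv hvA hy hyA).mono Finset.inter_subset_right
      (Finset.sdiff_subset_sdiff hPC le_rfl)

/-- A component of `S \ P` sends an edge to `P`. -/
theorem IsComp.touch {P C : Finset V} (hC : G.IsComp (S \ P) C) (hS : G.Conn S)
    (hPS : P ⊆ S) (hP : P.Nonempty) : G.Touch C P := by
  obtain ⟨v, hv⟩ := hP
  obtain ⟨c, hc⟩ := hC.conn.1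
  have hvC : v ∉ C := fun h => (Finset.mem_sdiff.1 (hC.subset h)).2 hv
  obtain ⟨a, ha, b, hb, hab⟩ := hS.touch_inter (Finset.sdiff_subset (hC.subset hc)) hc (hPS hv) hvC
  rw [Finset.mem_inter] at ha
  rw [Finset.mem_sdiff] at hb
  refine ⟨a, ha.2, b, ?_, hab⟩
  by_contra hbP
  exact hC.not_adj a ha.2 b (by simp [hb, hbP]) hb.2 hab

theorem Conn.biUnion {W : Type*} [DecidableEq W] {H : SimpleGraph W} {S : Finset W}
    {g : W → Finset V} (hS : H.Conn S) (hg : ∀ a ∈ S, G.Conn (g a))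
    (hH : ∀ a ∈ S, ∀ b ∈ S, H.Adj a b → G.Touch (g a) (g b)) : G.Conn (S.biUnion g) := by
  obtain ⟨v, hv⟩ := hS.1
  obtain ⟨u, hu⟩ := (hg v hv).1
  refine conn_of_forall (Finset.mem_biUnion.2 ⟨v, hv, hu⟩) fun A hA huA hne => ?_
  by_cases hsplit : ∃ a ∈ S, (∃ x ∈ g a, x ∈ A) ∧ ∃ y ∈ g a, y ∉ A
  · obtain ⟨a, ha, ⟨x, hx, hxA⟩, y, hy, hyA⟩ := hsplit
    exact ((hg a ha).touch_inter hx hxA hy hyA).mono Finset.inter_subset_right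
      (Finset.sdiff_subset_sdiff (Finset.subset_biUnion_of_mem g ha) le_rfl)
  · push Not at hsplit
    obtain ⟨y, hy, hyA⟩ := Finset.exists_of_ssubset (Finset.ssubset_iff_subset_ne.2 ⟨hA, hne⟩)
    obtain ⟨b, hb, hyb⟩ := Finset.mem_biUnion.1 hy
    obtain ⟨c, hc, d, hd, hcd⟩ := hS.touch_inter (A := S.filter fun a => g a ⊆ A) hv
      (Finset.mem_filter.2 ⟨hv, fun x hx => hsplit v hv ⟨u, hu, huA⟩ x hx⟩) hb
      (fun h => hyA ((Finset.mem_filter.1 h).2 hyb))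
    simp only [Finset.mem_inter, Finset.mem_filter, Finset.mem_sdiff, not_and] at hc hd
    obtain ⟨p, hp, q, hq, hpq⟩ := hH c hc.1 d hd.1 hcd
    refine ⟨p, hc.2.2 hp, q, Finset.mem_sdiff.2 ⟨Finset.mem_biUnion.2 ⟨d, hd.1, hq⟩, fun hqA => ?_⟩, hpq⟩
    exact hd.2 hd.1 fun x hx => hsplit d hd.1 ⟨q, hq, hqA⟩ x hx

/-- The subgraph induced on `A` has a complete minor on `t` vertices. -/
def KModel (G : SimpleGraph V) (t : ℕ) (A : Finset V) : Prop :=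
  ∃ f : Fin t → Finset V, (∀ i, G.Conn (f i) ∧ f i ⊆ A) ∧
    ∀ i j, i ≠ j → Disjoint (f i) (f j) ∧ G.Touch (f i) (f j)

theorem KModel.mono {t : ℕ} (h : G.KModel t A) (hAB : A ⊆ B) : G.KModel t B := by
  obtain ⟨f, hf, hf'⟩ := h
  exact ⟨f, fun i => ⟨(hf i).1, (hf i).2.trans hAB⟩, hf'⟩

theorem KModel.lift {W : Type*} [DecidableEq W] {H : SimpleGraph W} {A : Finset W} {t : ℕ}
    {g : W → Finset V} (h : H.KModel t A)
    (hg : ∀ a ∈ A, G.Conn (g a) ∧ g a ⊆ B)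
    (hdis : ∀ a ∈ A, ∀ b ∈ A, a ≠ b → Disjoint (g a) (g b))
    (hH : ∀ a ∈ A, ∀ b ∈ A, H.Adj a b → G.Touch (g a) (g b)) : G.KModel t B := by
  obtain ⟨f, hf, hf'⟩ := h
  refine ⟨fun i => (f i).biUnion g, fun i => ⟨(hf i).1.biUnion (fun a ha => (hg a ((hf i).2 ha)).1)
    fun a ha b hb => hH a ((hf i).2 ha) b ((hf i).2 hb), ?_⟩, fun i j hij => ⟨?_, ?_⟩⟩
  · exact Finset.biUnion_subset.2 fun a ha => (hg a ((hf i).2 ha)).2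
  · rw [Finset.disjoint_biUnion_left]
    intro a ha
    rw [Finset.disjoint_biUnion_right]
    intro b hb
    refine hdis a ((hf i).2 ha) b ((hf j).2 hb) ?_
    rintro rfl
    exact Finset.disjoint_left.1 (hf' i j hij).1 ha hb
  · obtain ⟨a, ha, b, hb, hab⟩ := (hf' i j hij).2
    exact (hH a ((hf i).2 ha) b ((hf j).2 hb) hab).mono (Finset.subset_biUnion_of_mem g ha)
      (Finset.subset_biUnion_of_mem g hb)

theorem KModel.cone {t : ℕ} {Z : Finset V} (h : G.KModel t A) (hZ : G.Conn Z)
    (hdis : Disjoint Z A) (hadj : ∀ y ∈ A, G.Touch Z {y}) : G.KModel (t + 1) (Z ∪ A) := by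
  obtain ⟨f, hf, hf'⟩ := h
  have key : ∀ i, Disjoint Z (f i) ∧ G.Touch Z (f i) := by
    intro i
    obtain ⟨y, hy⟩ := (hf i).1.1
    exact ⟨Finset.disjoint_of_subset_right (hf i).2 hdis,
      (hadj y ((hf i).2 hy)).mono le_rfl (by simpa using hy)⟩
  refine ⟨Fin.cons Z f, fun i => ?_, fun i j hij => ?_⟩
  · cases i using Fin.cases with
    | zero => exact ⟨hZ, Finset.subset_union_left⟩
    | succ i => exact ⟨(hf i).1, (hf i).2.trans Finset.subset_union_right⟩
  · cases i using Fin.cases with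
    | zero =>
      cases j using Fin.cases with
      | zero => exact absurd rfl hij
      | succ j => exact key j
    | succ i =>
      cases j using Fin.cases with
      | zero => exact ⟨(key i).1.symm, (key i).2.symm⟩
      | succ j => exact hf' i j fun h => hij (by rw [h])

/-- A model all of whose bags are singletons. -/
theorem kModel_of_isClique {t : ℕ} (hA : ∀ a ∈ A, ∀ b ∈ A, a ≠ b → G.Adj a b) (ht : t ≤ A.card) :
    G.KModel t A := by
  obtain ⟨B, hBA, rfl⟩ := Finset.exists_subset_card_eq ht
  refine ⟨fun i => {(B.equivFin.symm i : V)}, fun i => ⟨conn_singleton G _, ?_⟩, fun i j hij => ?_⟩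
  · simpa using hBA (B.equivFin.symm i).2
  · have hne : (B.equivFin.symm i : V) ≠ B.equivFin.symm j := fun h =>
      hij (B.equivFin.symm.injective (Subtype.ext h))
    exact ⟨by simpa using hne, _, Finset.mem_singleton_self _, _, Finset.mem_singleton_self _,
      hA _ (hBA (B.equivFin.symm i).2) _ (hBA (B.equivFin.symm j).2) hne⟩

theorem kModel_of_bags {r : ℕ → ℕ → Prop} {n : ℕ} {l : List (ℕ × ℕ)} {φ : ℕ → V}
    (hl : SixSearch.Bags r n l) (hφ : ∀ i < n, ∀ j < n, φ i = φ j → i = j)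
    (hr : ∀ i < n, ∀ j < n, i ≠ j → r i j → G.Adj (φ i) (φ j))
    (hA : ∀ p ∈ l, φ p.1 ∈ A ∧ φ p.2 ∈ A) : G.KModel l.length A := by
  obtain ⟨h1, h2⟩ := hl
  rw [List.pairwise_iff_getElem] at h2
  have key : ∀ i j : Fin l.length, i < j →
      Disjoint ({φ l[i].1, φ l[i].2} : Finset V) {φ l[j].1, φ l[j].2} ∧
      G.Touch {φ l[i].1, φ l[i].2} {φ l[j].1, φ l[j].2} := by
    intro i j hij
    obtain ⟨hd, ht⟩ := h2 i j i.2 j.2 hij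
    obtain ⟨a1, a2, -⟩ := h1 _ (List.getElem_mem i.2)
    obtain ⟨b1, b2, -⟩ := h1 _ (List.getElem_mem j.2)
    constructor
    · rw [Finset.disjoint_left]
      intro x hx hx'
      simp only [Finset.mem_insert, Finset.mem_singleton, Fin.getElem_fin] at hx hx'
      have c1 := hφ _ a1 _ b1
      have c2 := hφ _ a1 _ b2
      have c3 := hφ _ a2 _ b1
      have c4 := hφ _ a2 _ b2
      grind
    · rcases ht with h | h | h | h
      · exact ⟨_, by simp, _, by simp, hr _ a1 _ b1 hd.1 h⟩
      · exact ⟨_, by simp, _, by simp, hr _ a1 _ b2 hd.2.1 h⟩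
      · exact ⟨_, by simp, _, by simp, hr _ a2 _ b1 hd.2.2.1 h⟩
      · exact ⟨_, by simp, _, by simp, hr _ a2 _ b2 hd.2.2.2 h⟩
  refine ⟨fun i => {φ l[i].1, φ l[i].2}, fun i => ⟨conn_pair ?_, ?_⟩, fun i j hij => ?_⟩
  · obtain ⟨a1, a2, a3⟩ := h1 _ (List.getElem_mem i.2)
    by_cases h : l[i].1 = l[i].2
    · exact Or.inl (by rw [h])
    · exact Or.inr (hr _ a1 _ a2 h (a3.resolve_left h))
  · have := hA _ (List.getElem_mem i.2)
    intro x hx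
    simp only [Finset.mem_insert, Finset.mem_singleton, Fin.getElem_fin] at hx
    rcases hx with rfl | rfl
    · exact this.1
    · exact this.2
  · rcases lt_or_gt_of_ne hij with h | h
    · exact key i j h
    · exact ⟨(key j i h).1.symm, (key j i h).2.symm⟩

end SimpleGraph

namespace SixSearch

/-- Guidance for `search` on eight vertices. -/
def cert8 : List ℕ :=
  [0, 2, 4, 2093612230981222, 1196283271456085, 3, 1690050088805717, 109062409122884, 1, 3,
   338956439080965, 1990267282669572, 2, 2099105154482996, 605029143744515, 2342153249860]

theorem search_eight :
    (search 8 1 false 9680851866906509338216450 255 diag cert8 [emptySt]).isEmpty = true := by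
  decide +kernel

/-- Guidance for `search` on nine vertices. -/
def cert9 : List ℕ :=
  [0, 1, 3, 132518570570006, 1797151826998612, 625098148370295, 1504687031530085, 2096038851919876,
   2, 1205636565504004, 3, 1498867386843509, 1522690896964, 899818465806468, 3, 2024278759867460,
   4683415632004, 2, 3, 306085813830916, 1694503253782804, 3, 301421937784324, 90316594025268,
   143105948139796, 1, 2, 3, 603735875403780, 1416730986692884, 3, 2047395877827108,
   973163926127684, 897219884880420, 2, 3, 1145828613326165, 302582396377220, 1199039011951412, 3,
   2259982030751284, 2398053170483748, 3, 307047754315908, 599608626514052, 2256504699957796, 1, 2,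
   2392568007562308, 1447263068381187, 4961617453412, 1795877259707188, 3, 655611188949268,
   703719472906516, 2, 3, 993362119299076, 8187840578356, 3, 902149376644980, 6696802067524,
   1525590557220, 2, 1451909788745731, 92647562839924, 6739214939204, 3, 599334604264516,
   4683149293700, 3, 107909030679348, 2025648722034692, 396392248902180]

theorem search_nine :
    (search 9 2 false 59469507253547130808243857414 511 diag cert9 [emptySt]).isEmpty = true := by
  decide +kernel

/-- Guidance for `search` on ten vertices. -/
def cert10 : List ℕ :=
  [0, 1, 2, 1196788901165188, 3, 372959935357476, 1205635992742180, 2780794282836, 3,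
   599665534850932, 977484233462036, 2, 3, 1988288072725028, 1691549407712052, 2093917123396404, 4,
   2398186107191571, 1428474321577795, 1267132144953747, 3, 1691225901254788, 678687247767684,
   2100218422706452, 899579044186197, 898818610702677, 361583859293310625193801117700,
   338916460111743423175781007909, 114047840325098300184161821492, 1268151263306548, 3,
   899576744079700, 2098976960099396, 729231466282936992400666805044, 958884001153572,
   907133721862692, 2, 3, 1007449026996356, 897581633856580, 3, 2538190419472660, 148954873540884,
   634819208500097188846323908612, 2297528384033860, 687827612337220, 3, 2693151530098692,
   1710369525745796, 987723300704532, 2, 1799085952086019, 2094673907221300, 1293577161416980,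
   2534462404568948, 3, 132500296385364, 1184595627671830, 86702219784341747447062663718,
   85766734440844173297912591975, 181232578671231260637658714198, 3, 899832163146132,
   87143407897415936060940648726, 4679527457620, 916397079691268, 1724073716762755,
   2700748836258341, 687836131524613, 4, 1711115009755539, 2693945630082821,
   757624471346126061631676350742, 156938956722713796110140417471706821469602339,
   110587038474231641899254696341, 121810323495517905742554292771, 4, 408573882401859,
   607494233724757, 338268940810856551564406526771, 2693151458481219, 3, 2041252624274228,
   337745546451635143151117013812, 608662197847300, 725592776908284638573427164501,
   601665217824580, 907732854075942, 2695182477056006, 714334274238358729693225025831,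
   904151287042422, 4, 2696283650785829, 1690599844815941, 1446083563057253, 598504658716694,
   655624935403526, 1196626075522936, 758596522248555180732709425429, 2699590553899558,
   1709965119083048, 389365951121288, 116370463985678644206846169637,
   759012450913381878137049612568, 1164591406479460, 604082873268358,
   422140129862514882847441523241, 675359500695238313826346738020, 592102880935704596364219593253,
   3, 1443741253527684, 599681747931956, 280260608963266884304505340452, 302591594614884,
   1990294661776182, 159534450685286, 505159741172555395050343974534, 125724448212580,
   710719716134919, 333442977974664632690653200937, 508045291239135543337765241110,
   507385302341929960865818701831, 758342729120701315919557963782, 3, 898405313422852,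
   2693954756083988, 601669239341332, 641736900036865912351084339748,
   421562409411188197563413316133, 262774715822946095804372439590, 942351866954276, 4,
   2295200813679682, 2402713539392035, 1692359255533971, 2, 2258504866019187, 604117490308149,
   352629159529155626750020522259, 899542523607171, 2, 91887172616467, 167681550590771,
   302581861619843, 2, 989836978262563, 1447238679760899, 413967541478963, 862516442139029,
   574733635936870262852807065701, 675616987948305009718703264293, 759014881417334387847485559875,
   1200016096071685, 424576629625927, 259354870860208190421227221545,
   253209018398046468777698202147, 574874843324943117943070589751, 757740816750116663031527637267,
   5, 309325163168290, 2693151190111298, 598784350753858, 643735120439523481956341355858,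
   168464273472660497723581547043, 758938657975711222355377870438, 390708951810594, 2,
   1206405435576323, 1732844101145667, 2963537659877887036645392659, 145483749757475,
   2262323074191635, 2, 3, 2098182390951940, 2402572027769108, 299636033688100, 3, 114637820883220,
   309591767531620, 3, 2577809580438596, 309607555154740, 2102478028481604,
   485605200369388774134218175556, 423109833822267635425980133925, 84965216301926422705060024870,
   1464859365052420, 3, 1252758619562260, 106735176479268, 109606065642324541993747321924,
   110514769371412, 1200018837409796, 3, 2395098330894340, 301425238435700, 413966199313252, 1, 2,
   3, 672372907151636, 397552695379012, 3, 902855812802420, 1268239955288884,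
   760120888958267147533690358164, 2700705775432228, 1727558377885700, 3, 2402661194339396,
   2700406316806692, 602821485492628, 2, 3, 1206379562952836, 2698360466650180, 1196790796988692,
   3, 1694425419383876, 123210469754673032728150347571905372652449797, 1285698997486388,
   8008020091476, 2695127531585812, 2, 1467200020419651, 90312013267220, 389749228647492, 3,
   2100282645823764, 899699035303941, 416108450247690271368429572, 1292031443214340, 3,
   2557876402406196, 2276020100284964, 108101982782260, 3, 119898349128765521769399878180,
   2254177431864116, 2396047752445956, 897506792280613, 757624404538951500043685233189,
   607493966285141, 255502240813947282634351870228, 601778978625669, 1213899814151783,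
   253861237444944220217132714393, 674820211531966682895971537988, 338294199155604932991571198775,
   199396673605071854691771699476, 5, 604251458058099, 2697471659094595, 598767653388563,
   252549560180459024780800660275, 254109560965225254381228068868, 86158105502685772632642984070,
   2309153028919571, 3, 4707591624564, 2611856353394964, 418914595845350849090745303044,
   1287961925789828, 2560231198425908, 2, 3, 391976020235060, 722878572004148, 2393706979738148, 3,
   1003924521887604, 1691204601877332, 3, 2102405167649860, 2400255680791076, 1690053148881988,
   86814578326649854072185893956, 337483807479464416033463546949, 100992692524984376471852157334,
   2695272505418004, 3, 443328711061508, 988001731610484, 184532190165785451626039030308,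
   2287010278118468, 2397224018845700, 3, 1277160686235924, 2027783606788372, 299558188108180, 2,
   3, 985173446641524, 937406981240420, 1094768833668496359303504964, 1277156139676196,
   2399139006980916, 3, 1725655988584452, 995682409391172, 1733401824740212, 3, 2012175136930196,
   506723911930206534389039391269, 2698210799010068, 392076597396276, 1286774099313460, 1, 2, 3,
   2612583347520308, 708401538532148, 113753150734612, 3, 658923467444228, 1460192535659044, 3,
   907381097727860, 2693151727104548, 2044344942563332, 734747056495885703451578082100,
   338701296474445514456514958405, 757629061119809614974357705526, 2695320954217540, 3,
   3524312658516, 8191413129764, 759555338276646894728297805956, 1997302070002484,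
   2573146320344948, 3, 2595427882964036, 2691626328932900, 1205624852448052, 2, 3,
   2587525202067460, 1293585416126740, 121810307833394524259601560100, 1743089015332868,
   2400548323066404, 3, 2402649337299220, 2402657403019540, 655599001338132, 3, 668522451145044,
   347079656979701868993655604021, 987723395076100, 2093822887081028, 1269186190064020, 2, 3,
   2269418360182644, 696610696217396, 302883247047204, 644765551725945076540628374052,
   338373611887763739330388112725, 426946150586464525610759890534, 1715513138450980, 3,
   2103593513795860, 722753929379844, 760135156394246129316788263204, 2700556351254804,
   109234582787140, 3, 7873891492660, 394932317864484, 976921718563908, 3, 90334054912820,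
   119601776505831868239426164869, 390981610652196, 373325339697156, 907724766711812, 1, 2,
   7860219360323, 906577823678468, 2719624534148, 3, 2098181987381796, 3717387659125,
   760141450050701576001162940692, 2696278835728932, 3, 601851359938964, 4969918468372,
   2562072981860, 3, 955005037254788, 411533384491012, 6911282196756, 608387360384789,
   759536962652069361976086135333, 607481904059189, 560887632026376624807121879156,
   2339791148823077, 1804515296674071, 336730728725209351521922466617,
   351682651207300383621557666068, 430807030326098418487360750119, 564505819932473765523520784660,
   5, 299356893898883, 1005471259496451, 2691888588542771, 428278952211550616263536915,
   204014800213186569250395492900, 757782676180091482429746840102, 985193180909843, 3,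
   2028154446290948, 935165795764628, 104111754569167097349397618964, 2700681377165316,
   601658506694756, 2, 3, 1449431229109044, 1206809442455556, 2691610159031364, 3, 407199561024580,
   995682142004292, 3, 389401115887940, 1273413030117652, 2630690116404,
   253858217318581422718314975236, 337191338021542092024164000565, 264950081608826115358721118214,
   967924727747652, 3, 897551872520740, 3874758082836, 759563483527724597105519002420,
   5053064766260, 1187330425684, 3, 2395080078274836, 2103577539650628, 89715481125956, 2, 3,
   90576908401044, 713821148746820, 569877984240997505384477569028, 2700542565696308,
   2400377031045124, 3, 98136096277300, 2102547016131380, 308423212348484, 3, 374424786383396,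
   506404595209624352237951358021, 2323336843072100, 1266644161800052, 2695389980394564, 2, 3,
   1484283586628, 2023142484099620, 2610446887690516, 758030641202887344558832824324,
   86137510973534427022500636229, 725557926357842061706169366934, 2297516541346612, 3,
   976955845378324, 2699511768556612, 2216665899426749422758298148, 3510469028244,
   1258395724361732, 3, 1183424201316, 10138310218820, 2694290215288836, 3, 1287770817429780,
   175040825208843286879714689573, 599302695654196, 1258400184865588, 1285411507959940]

theorem search_ten :
    (search 10 3 false 65964917098430996810070086486030 1023 diag cert10 [emptySt]).isEmpty = true := by
  decide +kernel

/-- Guidance for `search` on eleven vertices. -/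

def cert11_0 : List ℕ :=
  [0, 1, 2, 1981410788526483, 2051251517067812, 739439975822132, 3, 2872573455532308,
   2818568333328996, 2894057949067668, 1699050854818612, 695168970856036, 2818478991092115, 3,
   2878075861147652, 1292029957197828, 899573411248532, 758615479764144884827520327684,
   560664284758626973856884470036, 95809523327252, 758379809104584095457302037300,
   714667534887919151092275486997, 760761642370283986409738273044, 195974891673483800711218402100,
   3, 1698834102649380, 934181836767332, 2993391500013844, 119880301393379654256991617844, 3,
   2586611064206404, 1284756276912948, 2, 3, 2891853079869572, 2541076652631108, 2697111251925572,
   939062834249732, 3, 2542639064162580, 1735271327043861, 1699381794984213, 2995371009863956, 3,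
   1522374236836, 2992076625630005, 898610276952742, 237655679031592969774171595238679379675095316,
   130067575589371193407115116821, 342756436549323756554146566964, 2306200030028868,
   141924034046355, 2023464766935587, 3, 747084214985524, 1696656319463972, 2909413047730725,
   3000928932602133, 2544438358381636, 398643460263276579432712775700, 1990267718904212,
   749416365445940, 3, 1696637328243364, 899544548812036, 2611454573617156, 2905956634980,
   1716971200200708, 843680704737272214792931056196, 1979203495567908,
   567035267309247084376781816356, 99261293892404, 31028674730432051536875659268,
   124831447635264677082106077813, 843660152879663989597407423140, 392124077544244, 3,
   609479269845397, 2615335913467908, 3000945243943461, 495843393109127171180709755204, 3,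
   1980883310748469, 2702909123265332, 36000026759405126013573871396, 2625773143923365,
   1558176387304101, 2621791828918821, 196407385142856342319408571012,
   500460885239033379462310416661, 339547796149187708424436126788, 758672316820675756178922497413,
   501426738487145740830171071284, 418765439057204341444726923813, 337513237640779809496409387012,
   3, 409720827553924, 433916406539060, 572745921037668439210505900308,
   116437257502534914016176329525, 3, 655227140601933260878386301604,
   844043612590029534760970451348, 252668708125789603742353621844, 591762261767955620281108927829,
   726253828527105912400464266036, 203143475498826224206915146005, 759856233079319840932313117221,
   268769153858444522710781809460, 844688786123633648776947835701, 255829960720612428922064824326,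
   161212716977612837560673816085073539637010982, 92041413525214305988190627082620858230178612,
   274013315561819998198207975974, 481639084687885361442863542356, 582170347109414416312447881493,
   491513765334132925075844199493, 201079478426398255209451215604181822128549894,
   635499753475987022245541407126, 237556318169640544854833048975919699460378902,
   141663982928179007543694984949047374516323445, 658703364619600773830090588168,
   118658346486676517393669288697175187388830517, 422294045944066016364197138437,
   48015387374442227510189763047091332926618276, 798880661378983120221544661269,
   140991397046082965787734191197474053221918037, 798220347840065142246126125605,
   842852541500865648700670646948, 502373509392716396605047047509, 3, 907406605984340,
   609856389448500, 194678945557150168502692217460, 843155807679639118973899061924,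
   651973875463475712461213231701, 181553557478351124474462103958,
   75402843537811675974985701190505354480788276, 843714812569836407514994906005,
   555259948448142729176690074965, 202721310430142767339199046213001445741253157, 3,
   1029718749544996, 2991123732042276, 565864445379264148725867036676,
   33000744686596741446192698436, 561487422705340270911900824101, 4, 2344436262658325,
   1295922718859538]

def cert11_1 : List ℕ :=
  [2, 448631402678947, 2625910542606981, 575954730565654063789088781379, 1020862884233571, 5,
   1971516063950914, 2991261201101074, 2255396088156434, 814285992991823016989916678818,
   2993386102735122, 565507169333106366945617877594, 332106478929295099960380113270,
   86489439989016975736456959527, 843385367873901567593970749718, 1302329465344274,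
   183554196564519573127284809735, 74517299167993624217816865770366479181645143, 6,
   2944914543443975, 3000844075239010, 2858736513463634, 492701742616929026266236076306,
   421066979103108836406184009735, 590266048037554762915603894551, 2, 3, 2895119381835780,
   1768105063322148, 2575265093142660, 427878488121348, 122135930090354469214585248420,
   1996739863745060, 264943850485023759367558681396, 265240934011714467190097910437,
   31038741404061885512756275604, 1993664864293412, 3, 129893680107845, 8977580135252,
   268720149839929867529980842532, 2910424762911125, 986788607382053, 416320441635637,
   30160622144655355074102637636, 189815262238218082019409830437, 841944416854017865273277897220,
   122133493550305841200117654325, 423455783137291026383136764452, 421647501628634604484484674085,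
   497974232854590987830575652980, 3, 349919990138101083071983270212,
   413813666743658929753806744228, 844043462174166132176344677028, 190473936784736486058520881015,
   120161588160264277856577228884, 42907361378024645493113696533, 643848813203161831263724503861,
   34238748368616610872911659998449284962492693, 179834181452008562488459581575037833049295524,
   843482520178814727844613456693, 758908252816275466887373325111, 803182586665651323667038147204,
   32217355167276176116770093063, 498006340288718796094885765396, 332258124713343774346086798405,
   422846217538483207508445234245, 160821990746681392357396256629317853052743685,
   156558612292736150850225728420969773256512310, 200376331352049681616713425991,
   102635465588555743948425336107524526123261957, 714176649890237254549139134056,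
   56381412507802443801620441763101250250236759, 339862166017220017231681045031,
   72010706565322883586239744691213941372903428, 119350088984418927230335603299238422602252565,
   496772418520911458400779392135, 587452139411771124259647605415, 186514380011034387586966688564,
   651506389496692112154478211079, 4, 2569220565059, 89581012296227, 3000654210696035,
   32520759246947431252712067621, 97705495622854574149486614061971497887607189,
   664295371750387650700448646454, 2994599494041603, 1480497131094837,
   27100803702404671795175559175, 273126898318599581276774073194, 5, 130406534369558,
   2369044654348550, 714395608492879025239435145491, 724312767968098336391671460116,
   1761046469025798, 2644540760606854, 760119864813484794012523733542,
   255027856966746005243934560259, 844305481152312005314745684246, 634652829783382, 5,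
   434098903945542065655161170323, 421696824573306163445256841891, 842850204159888090526927917331,
   71568967174712178308989929105663952749151571, 230338308422316581590450448793924413896874660,
   725459509642036934899897033251, 561181186093744941003494233398, 844279154569831444537764552982,
   718705691504460974802016469271, 87282732180133643128208532022, 418436622740350819428858856039,
   323846076526036607705668035110, 674726901967814340222193833799, 262586255808661275535334320806,
   634490683194984346068931647891, 486618155702696422661819805699,
   182794732175435412995999827268867704935257715, 158295691413244534387910605289474095525027844,
   759535017699704077375138848775, 117781470631870658199962702362604870736126227,
   188342455726029598914462830600, 237078277489852748558406143562364073811604823,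
   96394919896099562342537658375, 13250133245087059451037497841668066212471334,
   59325279907040915104878002944645874289291267, 724572233707874470148624781591,
   793332881317698431988895058599, 248851866723168121532619333910, 505782683253317542851790443863,
   6, 415656573424181, 508377679576758851923658412035, 2913226763538981,
   47942604673473059722379501067767340098128275, 675674706058920517564024103988, 598661069354373,
   2017225953857813, 1558214303970915, 750351417812677901344014009911,
   794800069461464818826388705834, 3, 252696048353391140732363514677, 2871432627531798195143250740,
   90642495684087854015024242952808828857877301, 580680926809452948134465720692,
   206312206177417684013561293476]

def cert11_2 : List ℕ :=
  [1202359334302245, 759266334435548877837804536629, 142352561348907899433954455596895695956892325,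
   502357160854912511407062067333, 252701331702624434847593476101, 724900985862494912362039492612,
   119660716735010099142477877798, 590386357190626318871819673879, 505277901138013382991244075012,
   844340542047163303936661299476, 121661201865938545834828044020869415573938453, 1805554977820679,
   758095807061134826028415488007, 675360702748568190433333817623, 121672600221861185612469920567,
   799767705884062932871722258436, 676251496070846920902026865320, 4,
   40061637223997858654690164741, 243306018365341498051921330181, 639813295247547510985668765829,
   641024861311595278817234590374, 431462255206454408825898869015, 674489114151238792868371366983,
   713563820658738719452347961352, 506164634913992025448209908537, 797338818664276884213939639098,
   50839148862349882871083373637, 843425848638003146992230998836, 424190805591103182368047505685,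
   844140330807328828790268929095, 262601177720282355926616455850, 359624156164438186404003201305,
   35459657950093316811891288740, 31937820310531756414324708693,
   47424231871435880264766896871221943158281511, 487580653734872512535735638693,
   259974820398038117385905832757, 720541750453168062815449268500, 900106346324246,
   70595414504683956921811002265257202088621686, 640720030933623778884185514806,
   163348552636872919649544459344333266527262852, 557889690240793232689503839029,
   431792795666886868011137437700, 34881203975118409886567977954323772978405477,
   34996312944998828610820590199, 122188604475325186898710061332061233083916565,
   227570496508608492865286699375234249075748868, 71128662735057273873286760595664474698485766,
   268194773114579703074699829527, 11608076597893713474059203982350514003188007,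
   138117429649900883898799589617126923069063447,
   9872661533274504127135212304450080095484210100855341593940,
   32985687474389384746937961657670592583010981, 122797700597500552999488358280271408350798100, 5,
   589977146311291588604849306276, 252687357983805891320794710836, 505742356304978120805196112692,
   204087861233703873645117899030, 253865140629875246057594581270, 527714520097249052457407374678,
   654707176485565475564093266596, 339922319468294149779636967703,
   166237685095631619480662910915186751107707287, 140257023105827266379064405268873421607047988,
   337229208410210040641676154201, 237491744488090907934216877687672925575271492,
   267579444281609355722659027620, 255828657591911182687368925461, 844341685452342190547806994980,
   9247200266695088126370480962777482671948868,
   2489025382221653170936189500202283250409469032868339683332,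
   71466487431975444794875289187846446897116532, 71965772139567403124511269616926392427369268,
   35655199419785903663547034277, 45846355220016460642303238276, 260790839352761351278773413127,
   841917188334513076373471630708, 201170727177148135781758414922157460376879653, 443340493849128,
   262782545869592144288470271816, 24568185194713899340453075312422517135925252,
   351576797118625563863066747703, 282445298485611735632029683812, 7,
   506076221332161318612881134388, 168848584098088661730913821492, 656929545887598703080831988260,
   675747476359704263998040967848, 277481650600990239409181891237, 120768234083512700958272987141,
   117961103749366693058678107603939187704373797, 144351948938834663473276304160591476252957188,
   486594085532636401134667518232, 589377495773397096310452650260, 85503056917361649687021823865,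
   115729571204799011071683660517465711857211252, 580158685849013556430447851380,
   843415665017767194969809098023, 86447114628815358424627249748,
   20108123181244542519297180357449903476619223636368645857828,
   36777916864443566102197960093016743076241684, 102384520984158134468371027448184634107774804,
   94823927268473740910225528750347923468879700, 488083509037219079518249065127,
   433286617409092070543352890436, 4, 674722281131903064694962784935,
   120460576334495063356909096965, 254486323149275218351319372053,
   142207268551382840703864274589705238457045269, 100764436829817503074480251973,
   35309149192194234605691322363533844842508837, 723059144907601180851915890967,
   842790890921117383128838115876, 329699584331933432287316099173,
   27920363889706810990695453731106108429860869, 842497482131234724970223472645,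
   91295848390369606504106718652057837541261973, 597042530859472180574428472391,
   337785444396191697298896483124, 191287540141895265144099063941, 255780993331054668644899496759,
   3, 757721345420844081704324826228, 842846869629659701394638334356,
   9068612990388748013772849696266587281728036, 1976089981124994588977070357,
   408289929890517388677274288676, 673641579940141726954200068104, 574505010532674522688336171556,
   842854777154251271858695017573, 322528375060056240796653424762, 171658325683716887697838641976,
   253885314453438988516935246373, 203027867478148738286147047059230574541746453,
   140019435115780875065484583486403000494477428, 237241922101925945335555782382771872053433381,
   75316766331672543176154137015116862920786196, 158297533838321526670473343804246101904859413,
   198562837064532391194388357668, 48027327657209603518730176443826272919881044,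
   57518045572197386318149741445155683937882948,
   39288589539687250218656426775379080711317120325902805342884, 26134759826703987283783207591,
   169663112720134300635262054676, 95002434895335578226745554986623093217382676,
   144015667952574101901792523262020115706955636]

def cert11_3 : List ℕ :=
  [497478439482232114066428805668, 4, 2292015113007109, 35719531915392017924443673128,
   714719547614579696699721798725, 71554943328358575079798436442338287056684101,
   11614202163317148814420932727262785980998757, 337712608792013382978109900117, 3,
   2312351605103268, 562347117798180473671874351652, 844651239003652249785115644180,
   337670097642983594542987760005, 254177451958438043900235424021,
   204036924722177281512782799702721903949201957, 579550691188000227353051152388,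
   255833191649412325072186286900, 1206538088100117, 490380786107514179081881359205,
   159025611678243199273607103945424326824845589, 3, 1030414318769220, 2569646595138354,
   309583025742642, 2992223002574852, 2817539738506034, 1523241417106, 1479434136126258,
   2993442758656274, 2996341945274372, 970422269264146, 707505846051906, 2544963143545922,
   115631914762514, 396590024185809122743838597942, 2, 208076126048229827987613310980,
   2965808965765491750485754133, 844006120859331993508729479990,
   54819021968895507181472844280856302268588308, 477575360396022501645114954552,
   33452259119618785938107159834430365988697174, 436552333313013356917622335352,
   844322599693530175745822233396, 640946048922555527849345110021, 4, 2050600602906978,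
   1693635412301954, 2850361506894914, 2395051218567989, 2692129811350325,
   116431817168786448798491812950, 362465554133390611148404505250, 507275195686597890757005288518,
   4, 2700632504542274, 2851468653627794, 2725719127138, 844592379337881803583626062230,
   844649893912960858798973737634, 669223976462704474429320139336, 86968058117418117521787266310,
   182785537415820321721836628480281232034304822, 166266460134668935416513454003652038097898151,
   198508813966876663911439958290, 638785694299409004652098890138, 809343829895401642649105928742,
   795247735883437242867365601288, 95399232849535894885492072725, 4, 1197883612866962,
   170025693759266, 907239230186562, 760718390495768752399867843650, 310759951459122,
   592077012971875088595259330570, 1202467111995797, 719382819140457011419323582869,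
   2995574609613621, 605479730644235301493568176730, 96268147952024797191501011334719222740911174,
   673641831033686278488345302631, 926084241704681075932725534056382726603846, 180484475947410,
   1224388775387413, 843675891087151051070102804071,
   87767969458629132097507201377066209687674363036522927991, 6, 306120094929010,
   844092809318599960137443669602, 2587711997674562, 641082826641320708980299342098,
   2306179647021061, 507560486000140275010477701797, 200987321802325209879578037950171978022463080,
   591238815019062977440243134471, 4, 2588830370906386, 2991123445388354,
   255042397242057604445572202777, 729536443852827843031845778498, 2049628741802658,
   224402471815428353905992752935816572390744342, 2, 252990137043683130007153299625,
   282393069646344955984544371238, 1991836805769353, 438564926087643377572809681573,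
   184075864742406728090430247264015815854294086, 591242721006931273767616320311,
   34376695505930707461516716225139772005579430, 2822893633491218, 2592787754669125,
   178614313359728689874609077709683768484645271, 84326384585328213794320056601, 9,
   1465071618760706, 1767059609565586, 258247210897348864173735621234, 1259585076888402,
   576284838591397339909165756533, 2041419985867573, 85793888892519465034834843946,
   92557178943814292564079889489129604189852470, 95059453758566947771401742567598326323295494,
   252739629806216755365158267511, 237039514285014266051187539523711219797101222,
   634261960617660254686657532178, 190204763942257436669876194039402814075728695,
   86143235071162299566507296359, 184075864699894594033696682709442523469345591,
   190433738014516295663825640365964146753643591, 6, 1797291684993154, 1484796655505410,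
   421047339094510518357909902946, 262936559066333882060203499799, 52484477040429430883050864921,
   337176916519626212126612734775, 210741768423553890538906768276062087154188567,
   142910788902539787438468953218191754379462247, 3, 2015716221256500, 2887942288211970,
   2009447872402498, 1305692070318452, 732976837125186, 2999609874203442, 1975149068980562,
   86041258276329668721423065370]

def cert11_4 : List ℕ :=
  [4, 970497543397378, 144764306859074, 3000916852753205, 358757357256358102116526527269,
   342794663652111255038765736210, 195967300529391602021525648725, 4, 2695113891906626,
   2536000555528466, 2591554853839938, 842131862627809332170054829130,
   283566294906833063155982664501, 118566457180997582553033040024591714481289893,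
   278944672501375051798063436678, 183702948533950203967615483909, 2576663791605074,
   278950155382215194826821043542, 406239438519299797104954909768, 2, 2016874900697365,
   189173351936921188170485879605, 2294764876242949, 107014537750392, 2314572711461416,
   125447136867616470809800938837, 2, 5, 670251927034531, 1499332148301827, 968126802601299,
   7840522914467, 803183227154737876442852008211, 508376657056354394917931397670,
   168558597749707315169829482771, 724030586497997968866199163427, 844286225406287773032354496515,
   2098513280585732, 724317289433396882711383740420, 52482502198893506383423088500,
   1038043474514149466449187364, 193615086150186888479984926995, 363399852520177487385872008532,
   759245422793833412186934222851, 3, 2997437328785684, 2999575736954884, 697804497391892,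
   478021906619709056988469342760, 166316184066724, 757777920088787046047815926308,
   254846877846705569846180200725, 86415908936797418723441004548, 119918364034860414870553444901,
   363986593236398654204605538580, 87069454683556746684624568597,
   165962954672759827993804762355404304562557205, 57527952612134687084446317181183477052363029,
   160337423005711683081513669083351619254516389, 102376675199423224249151885915302928252506933,
   758966076389074359716141019412, 478523702177437200020581974568, 89629435245092,
   203888163982690141879495838532008754844693573, 433453015516776, 958199239282696,
   601795258249496, 108109501668004, 131686358732132142730613899369, 4,
   130125301489502036872713995333, 505745981640313080379885658389,
   71731914196980887215402725494499327614529813, 590694874677365636086172626952, 1217603657965576,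
   244003134620592224337220879161, 935001890784329, 126933839446971536996136227640,
   337368303117508016077248213544, 2274920800332452, 178961689503692117921830816031994618175750965,
   1485947723583496, 86836206728247652751142839096, 961665043071524,
   487914023167029170472353284376, 5, 424839195828227, 606082725602643, 1504231382753283,
   270693022959015826315807466835, 2034790249611811, 591781552152344146345447537050,
   760834225630658360436836417814, 589652624161490524531048273527, 413833023570382106946093475158,
   1588146701738259, 242765194022367372398526083351, 541548863519588533948085881616668559757959, 6,
   1462526687076631, 2257549321728275, 1540459614069283, 285543903365394208315426378515,
   169394706525108465891193390695, 506345813316275423119417807399, 3, 2993386203328789,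
   168699783202206049872214299172, 337060089029360356632937201748, 413631861403160864156675160741,
   255828684428663379371284908437, 636847300192261, 2624750211898021,
   335067122886184105776241582357, 694932592464693, 178632806844904175744001046235769772302835991,
   675436720540497945529397281045, 416134798453483862024648796565, 196416616191970439139262798501,
   569945861207537239902121058308, 794780953288735518178682147638, 87074582249397566473313272086,
   11778626318584531387898879713558720702138774, 34072878011235722032713247822891915962237476,
   237132984141512093701314988971659060032741509, 185603746103300235485069081978132435569345604,
   721293525938975535041961071141, 3, 121021527180321166767707877925,
   237039770538161534767521338221030683837112868, 322989189670954506643026030693,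
   758355653265006985930998811300, 592419978782772429792632398709, 171648659640554769947811855012,
   719137416150745886121653649685, 166327391957029840221848639149604961854386181,
   119259145632281987951206058193893865765759381, 178517281309184715626079756696732809953805109,
   27105540715458177774783689422725676554852757, 204422254210521971439832448343136457911173941,
   592358192215989752952112456312, 193277286257593656639104383653, 195617973938037385611390396437,
   193245709150215918204952275621, 34324733303140408373576192784551541449163620,
   33005197572576080831556719989, 10560541391631849652378653973206838471309909,
   674178721068806834827370310310, 237160823788984683760973413222275906747764853,
   584776915591952236327918056790]

def cert11_5 : List ℕ :=
  [53751906974914962659192238512098712324616469, 95407030729145148759370034902561845535674372,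
   527188991104868311058142005350, 226152203398007339345466493075008234583108262,
   119122736667421639349075520374324310489825558, 165919430746741570113434530036548533137652390,
   27499611502375696647856293746065461521379621056000649802276,
   137520088903022141605929908331432362134018725, 34073601136577263735795134567233207666946324,
   237131999563033438630321772311861436344313877, 639544296372475019071424262964,
   227985875184092979894404234398764651306570006, 432261166493704, 416287577782178842356348318520,
   80979128682541595068070753371751400737085300, 54494193508865131002706224840629507994592053,
   438544133343168955997145797988, 5, 1748368579221528302622085220, 720255411638383515964072362084,
   338328057894557828376312291604, 166045461650733387341569267032, 570111378375254074717042117286,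
   715070334429976570545506234758, 71655473105201985604527972328935170948603910,
   50805870145136428084164231348858202338373636, 843762830213658338380275479400,
   267537180540662999339700192052, 254441453221235848002803929913,
   118522881430253298431594657285144866885566468, 337458573131395234301262181732,
   161215239873096758872335870575674584827380261, 843118623279966130746810439540,
   250216775878345783831410351004441000014794098724659480980,
   54731027969342023774524290883874186053814132, 94959997760534433808739474395258022858676084,
   54821024825235283221123095471600367006262069, 423995985965565899435874208420, 4,
   433454913160307, 162128078741779, 145425754136851, 634161547836947402721020518403,
   2572284393181187, 590886231377494954277989879818, 1206510036269733,
   485459459848760610467075852693, 113632396584005, 640080292536353750182292619546,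
   237503505490020475030696040353197411963904278, 259467099365541379043249651991,
   237168650119566973924857609577580238525053606, 204091264910476124160235577347, 1224385443266837,
   418426336383908132713877543319, 40081221013603900419587473744368514366637812909136363024663, 6,
   308972003478179, 1022083973144579, 2870293652987907, 199684654621365370491576464451,
   3000658636988421, 45829581922010560955589133925, 237130728610028459664335261680955835939059304,
   46542531189764178468214690103, 3, 842283341924443934411811000916, 2696574448119813,
   634158003047629241185348949061, 119030437784119799208733546787299735779214133,
   285540445368085794822953394181, 662624358957876, 201339364011260885775027589613244723158728709,
   2033024424313928, 1733329893266232, 2381751064498456, 4, 274253289868371305936421662725,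
   142445098260735964004366995422291442605851765, 495335100161032842689837936917,
   590291928951770965533809252762, 90329440338312, 2858821356655688, 41211333371666763621624449433,
   164733696021657524337788875032, 337225416133062606585839849482, 433917159489540,
   209657385931055796788968133701, 1764856159081272, 130611681251781873381732878746,
   842563386777041394261101120165, 436087577893238858926611075892, 2818535891019094,
   337477963014529084081930068518, 118775242000965805351211371129550136228737574,
   24509183612280183432305650075765131015635764, 237731857078966232620199847196234882918604805,
   659350589167577323888958717956, 237256273984389719160994469312787821103809334, 109158831034920,
   87471093409070036166935970344, 119096191242223560192109939340693763796268420, 5,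
   590981602513267852025510842468, 490385803759024745752202086260, 713811711844666598888529076500,
   591839317054430362869086759226, 169726689312759493998893355286,
   11610245725209480679821890835591394447954054, 660789655041092687797383959350,
   140077652819428646942350213147347787248313140, 210782791738705731526094645128,
   37294953404737243773393203528, 25921525405207429938129593242480907543577940,
   130068513258199723765294973204, 661391695182127398720649630788, 35709426796365034831183782005,
   795251144834822737550259561860, 78515929757435737623813791426982174827516180,
   178874896244162190218779732548997383723614756, 322609143813697348120502022420, 1724689002076840,
   2395106619527172, 223374449370375637045603888389675914986013493, 2322527876964905,
   843122060755721567165274547268, 8, 556016617825468526528852992276, 449161861742596,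
   1252763079018628, 130342150694560438836896691001, 7107191288299980919511887361903687299715077,
   12840709984560772185611868419871757067917381, 166237657581693504319847971443335835975712773,
   46433413246759658225953565879569966061662212, 1451907947573529, 337052609711191351624576749716,
   84900760785029237432536740932, 792617978430724712985014610052, 843396535033467709927086047236,
   75360304212724483334536991637835621863002665, 1444234364426104,
   47855485160490712254753369481125886269346933, 976462430880296, 4, 85468148963491825302296994072,
   76802453337947892755263981613194651833631320, 278954901737015353751624819781,
   268053503769123630869007454485, 12927823353345487741979098298953777143613845]

def cert11_6 : List ℕ :=
  [305893107794472, 196414503785129537252749492500, 254803510566223026104271270165,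
   163255315334905411482197528578265927511576581, 2858130414645256, 4,
   760721578946209694995213452355, 662624083182659, 307004302445219,
   48022818526217452922708058997766093574190197, 979253912036419, 85559508086145205856554817401, 3,
   715038708627730973341510161477, 339837933033281686452354294041, 121079557317763143525653098505,
   715069522360493245175563985176, 237642684479645024122379472387040983614822741,
   259993203598252275746012939094, 237410253126411679503994024928136230732067365,
   204327173632796840433410130470, 236978623632021929256422248833689216367481109,
   338306456028079810945843505555, 577211732063623620326621585414,
   74059425693075800607968095567888134119653654, 142958513495740920173896721785226115818324246,
   142632576156963859153568173844761312049127702, 137519525901971378631854249575440996396835205,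
   2277317662016035, 119178161235408608059819938697528926301394262, 605042531931480,
   121943608708828023652899496329, 5, 1027104268828675, 1242663281317891, 1504219460218883,
   353187869485080748620514545942, 101020275118830393354069762326,
   28170129725332690291294851820799426108412054, 122142106964160910141231297881,
   142908754270548635357086401347851523759305014, 9, 339528253852261810602286129427,
   2029976045589027, 2695394073513987, 342469221155363, 843102458810994096321665837370,
   2633425979651793360878269528, 94044967758041147556445852644672984264501557, 607038702921592, 4,
   309214694220867, 2993245252555875, 609823468061779, 508370406969879742333687239482,
   84359161763152622074131139237, 201410498645218357378473462042833219006075973,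
   505276706676899453508431155750, 577221769431677991588305408613, 676440448522643,
   86668668581959300413418181702, 812752635377941410370714616360, 3, 301766022943541,
   502440470336911168182577029397, 170030565233189, 2568465666037624, 668860499498056,
   168844045283718927475454125397, 5, 87375426027394449288996062067, 303837001458214,
   252879864142218802045394162211, 675663852445809482905580278310, 168699569516428102945038838166,
   309603596380166, 2994323021250838, 143115039233126, 511680389258849239848402846246,
   51549897744890922373048959523, 607357113757975, 668824047515096938216168227367,
   827278003505531132133003182087, 86241831345382616291399435574, 1360578173841570464795197991,
   85525957719297417691326382630, 5, 508374236825445699889261446950,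
   496824353464578008742446071811, 175904874262092626345987614742,
   237741497703599582784560596020837477648784035, 797353698553987518897428123654,
   237039764429424511690672332626700271375178131, 422842591201630220617351078214,
   237158122501411809650625738320518672500724819, 201198844773312751059385766078938487431204980,
   421411245758017781411770180470, 71565808706710107933071358785001301186449414,
   140167180068591162448587779240612765531132454, 384636719557117300802632189426130916435286,
   20113046729144685496995940307786064834747619181392676868100,
   213873727276953908084911248662491478207438854, 203790699275712234507478492723935364683759620,
   2534465480062534, 2275141455650822, 424911315838294,
   57276335010857577846470104757326973212492327, 1574596332134950, 505903501624299726789762118182,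
   347649070300007339264401895975, 415955610444819965280945058070,
   139434467093864876136006358795010968272658819, 1206578620605783, 759563379679474939359039743047,
   843136489641711420077614708759, 1979245760266998269904163367, 843781974324058592416836426406,
   358268280492472392629315246216, 715077966063828139047934902550,
   95568709713342101621137531158524890167121507, 45545186534381456921726702663, 1499053720805384,
   348945635809427262501264177752, 166409334919095955201313017821855926474773031,
   566137649313241656177563296022, 338445319380758044393554486615, 6,
   209948802912764945070111589699, 505178155647468118276640503363, 273145107608112507995526530627,
   187229147322622861637089591748718534405275651, 142304776601000476468744426288248693225579124,
   597312350408285298627346582183, 171150534919781393002579101719, 506690018867777882595925829768,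
   2314377585776235162918811240, 100687310967486319850790543911, 179908295587766863386584811113,
   47684886590857651333805486078409210576843303, 792965076262621715264578428935,
   566483396904503566610925502854, 204122344734414412896958437262378208343457795,
   30679625765347993211018580519, 48261678403878834296155371870651390879036439,
   169208140524819731834539277991223628541604247, 507897088898590665560883036726,
   804488454145602649697670223463, 7, 146519069534613, 760097953552895903643374100483]

def cert11_7 : List ℕ :=
  [674757264316906037820783067684, 841897868155937446580743411715, 95469630311547040242469610021,
   842133461686048659587655079939, 413784047951473451830370472212, 362109506561909,
   179071325614089415868180186960439624192295460, 340056049623589, 345943045531653,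
   339245215295937661021055312426, 3, 2991842042082100, 352420087834485,
   168689374330562927915330724696, 160689668960581, 254844591177128628097514610965,
   598797161215861, 5, 252878673968666411859907340083, 180948708111700,
   338993794559181261154665710932, 2872508589350099225341994324, 125465968471840241597760555412,
   252680388478313995816642254163, 95952855293284672791969478980, 679024266596358,
   437077473776193033988995306022, 47863315242863050389174218387303858752856342,
   119018382433196671625160486899034891682525572, 84337627083158049194648939171,
   337688758263231469549561139204, 203001295110438255468657066547213761191031062, 2536183692751672,
   655288674024492961981564154680, 24322576131239623527749034946828392760166404, 3,
   255422456782784790063882594628, 844664925897229342096765322036, 194116425613321502495589468564,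
   191290109029709818761759511354, 87071684858215402167159960166,
   71568409590514173789941788887038099224404790, 164771099473046296999790908230,
   33833453403198825266578796930223918237112724, 337773885613782569937524982584,
   254805372481801422320555087736, 156384721891278661713997094388607433958335556,
   99779268716705692730733643092, 190962168462113502736497869076, 721299886671234263467624007059,
   713867407123982179119636101524, 229189750771606438521029802759626666812756,
   138381290925214970127189527357357615751853396, 40431434154332869367858599252,
   323846040984566946508839276550, 843505561332299186373443746195, 1215039697626679,
   740955575754938173122613281319, 119505070470129824249282848087, 843836682419884349102227865910,
   71227616047548953038238872832063028307952979, 265587067278590179995559592487, 1744514873136200,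
   270539842469591192988756808776, 97099584156451738438625474978436370799395367, 6,
   244289408938002592247391012963, 338430479406418472593672189571,
   78433736504701369570562008036160473499070467, 664495773087515478912393623139,
   146999943729928973029410764143223180568848644, 640827419003462807954234943767,
   344478760888338238725550329863, 739788225661369353761246937370,
   124924594325980349343510030277822439181257384, 50276922857435069273740691048,
   166733668372022428226464356367802484648981575, 324970528882420190972388595303,
   119809939679158580204154652535, 496910378133101804245338957462, 590906810816561004097686626307,
   744149835406769170885936111895, 704879400271729755298396791711498781164615,
   516589048938721459721607661159, 194754373002244955130034720872, 338993159034336019669646991763,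
   756378568247493456972812294, 1196844840588633, 283587861935203262964393198425, 8,
   753655540119532127510967317843, 46362124102658995694559079789178753251618819,
   3155832753103455305398827139, 338934486831142812272858462355,
   187695039201260385459530914067994801197955172, 767088343221737989680353830,
   180876535968159578439756825126, 358560298705759272499314766102,
   190200574615486271755781624339765595272712759, 673619743053594607418999177769,
   95638323037691162986121683226, 713798781117488314274867796105, 194764241079289471157585399817,
   656926923950409048771533149528, 87033489730834882124251276627, 842482614978075792062759061638,
   40565077794263170957260760953, 516639362416273526616909484585, 3,
   841977190407067783328998966612, 47669234344890121844029907973785124913423156,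
   591225182139776219303570932260, 265241518436846552800231429460, 757741949535855458882783642964,
   94908945156118750584485522130495980111856164, 487516946818557479195082246404,
   95328790743441133898280117779363252856750356,
   50669500691023674825584763617229410224974873531313747795972, 253862510252945954957601829684,
   841921637895556690550117863427, 423378683764785657209671533364, 337745514438487136182550999044,
   131597951348099596852863907188, 33407664266604713309934874738771451637767499086350172571012,
   253856979569662187798801978164, 5, 564839549996629875078811615619,
   579843288534584005384707605844, 96714595955819909602837135797334398058332707,
   203877954117344402002669438308258761764517204, 41250442988600768565238568275,
   423147507784009652813624418580, 843426896595457822461547025747, 800201465323665596133670211732,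
   25683148662321501810108943914490097794315286886666177106196,
   126236769722247566324369905521554588287731284, 179285029431579649314114829062099643664962628,
   255831013385637991606047175043, 491947750627936580307795412308, 663733011101876855833094526294,
   447671610959844982003810869255, 715319191025203328521872822278, 715360198816412130489301271079,
   45264046369380500575688667686, 230256956561124719035591198898109384502095875,
   718753094582321685811119337751, 36528771297940425229005646950193848979371895,
   204199182088241694681337671183150839026184471, 581948561167548236784571138326,
   725210525448313059345298436647]

def cert11_8 : List ℕ :=
  [359819043063637990535401744264, 842790646576038094972161427523, 424195835515884484346256183574,
   759933019252388509378953625, 337676585292318563188560888217, 357287570963550070769276240152,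
   170090066126526563839563273571, 3, 416125831538534735017450873654,
   254215374346018279547298014004, 14124874412600578626889252906881933025772886,
   844610309849745600175843787300, 189934454903772560025757691692224529643799350,
   713388954677894251445567706180, 123278188753792197450145092139144752448824116,
   26737961559736774613624292617502514133015467222238578644308,
   47759512905777333049907207818316512807321609, 421372314646749386021405021252,
   842175378999486702146702105256, 798841829383607456666441746569,
   180324296298259666195697196735035845888253955, 99783117477517377214144923779,
   86972126671416844979563485705, 507248515875330390569871614230, 196413217078383607706867292280,
   50782560984633854150997784707, 511677419295461174970672448038, 5,
   719907258164471820194394165523, 843503965955262078494821523459, 416105587677988975946153223507,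
   252680348553793912658149942612, 843432674855646191922195865875, 85817575434752317245620226454,
   842468231691627673118534955286, 322025436536146838824296865799, 842747639189927709366816447078,
   555267676236415516874144131331, 170863580951791421938545669460, 412324260396242202141289355124,
   84842985530894557591319627012, 6747818956623600146576284080681192310135139743044005267860,
   125535397898374425152137544500, 566157680992342353302541047128, 758010025451600817225561677827,
   567311637314787456048058277894, 843972129961521658364684768051, 354391944634191522615658825044,
   3, 4, 1198894889376085, 109476663403589, 2998600272598085, 2836212263523397,
   2314121987614649422108598279, 2307157720636069, 30775795972096352448934868037,
   477911896633231788668002394933, 897770397770005, 4, 2994401624293381, 2095846383445413,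
   500265074732945203543507575333, 2998378166510389, 367494569759998496144348971285,
   90478681337198940721976615736, 55251482262021724456990472861253345395515669,
   423202815467194876943415710789, 905380742079016, 442167694165064,
   169685222092820164008931824437, 95243057451540579272616040908090956139674277,
   421663751936093112414532344485, 6, 1796207405136276, 1796980914929668, 2895091969767012,
   651860532489877565228814307332, 445485416658501, 589614014145316684202297734757,
   24481118604298797697596228257234296259162392, 505795839766389477865860695975, 4,
   47859564960083373583311725637, 427319306101560, 508279581916521705988291768485,
   46554095207792382085134867797783794219516182, 2122359753429544, 970147636446824,
   2611827655725064, 2099212550685064, 903979072558168, 9, 337755817481521603101249343764,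
   679036343833396, 1251670265270436, 902020835414180, 330116016148302229400598973098,
   255643262424546216475787028504, 47882183867000065160681402684421172199031333, 905491048974744,
   4, 146941876966197, 574585987665266558925008446533, 657748918273141, 89619495875656,
   1724757738328888, 422875117397793200183479804181, 5, 677304687868582,
   40605752856086548565577504292, 2343267956597014, 2263492214199094, 2925079006614326,
   555915358940791588272291918452, 85173208841014070939817679446, 442023811762565881232508977972,
   338366441675527818159482818564, 8, 308995019154229, 85167202232683860455285952516,
   716308208238552522718009954308, 44907387810051573804872913717, 897830073997381, 899782902718741,
   121146957126446521488353825045, 2120980120027957, 95531894640078944045260343799069443497202295,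
   497811045023032686425978251780, 590913920985067730876563145317,
   76752168663226035427538207221030004573151236, 51458123509935388282872678484, 4,
   2939081607643751, 301717330883381, 2255309156674213, 426208538566134570305084213925,
   336915042633698505567337185911, 498022243094122207248275608104, 5,
   841939779560475115989979312676, 2875714299854856, 337370122723942770584985048436,
   124048707961868434120676014389417878670960918, 842538184836443952851148345462,
   338624013406728187339647170056, 718668018200805624255874102934,
   26016359507878231031445698233252565109207860, 2818264733810968, 107921594855816]

def cert11_9 : List ℕ :=
  [607413217740120, 338675926703322192123772756596, 169675723713060511762048562516, 4,
   1742221826217029, 903417480487301, 255094315056748565063242490133, 604737909510965,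
   2049567621796661, 841977488234362497031213435560, 53710543659228398435999903827353775081099545,
   515972292980772571006769643528, 156896823761447018535324441124715790903940166, 2836284859098184,
   4, 1198993059610901, 2993220841858117, 168485970661322027688880395061,
   86763426151064700931554029576, 117117749030204163228132266783942312968024070,
   589924864713315354455258046550, 8, 515972116545278291109161833636,
   733499224122688612260795326473, 2658763626906425, 591118962873103728862978266245,
   899544762320761, 555585540789183067993853805092, 902731026417945,
   719446668525449573211960386356, 252660973016726473954723836452, 4,
   84343327551031735460265407557, 589724461925692539026537089288, 273768534527220135242513412378,
   842788473191916063230217368645, 2840614096024648, 602814014793226, 4,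
   758267592185388138309631387433, 308564717507656, 10590674990992913537884740918956233195590729,
   1310708179542840, 485781847864534382224451518741, 1797937806017064, 4, 679856565716037,
   26773181007566723274496360456, 252935618067674305843581445189, 164729854077660275829074326949,
   10, 7, 2998875552057685, 2994551598977571, 2553441614987268, 2998864551487507,
   491823060090761276906150564387, 843660410849320743497210369864, 841976204287941053882428328341,
   2998647743979653, 5, 275230730110736201329557074307, 590988233304473291595303773523,
   416936865210500430304523735043, 507931563547816148416510175091, 100028121574529958994544568995,
   1974825680337507531183098534, 757632174670449784937878471273, 1277715582837288, 3,
   2096048080818180, 359567855923748, 85495853573691545429232587300, 1414184679678504,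
   2995557477929508, 3, 283592437935380835166935058981, 2043031521436468, 1303494932964149,
   119891918741093343834362034581, 2560188135646008, 3, 344949379455464000009556798021,
   844764052206628378364260032516, 844102458887888418735253827588, 589920860559282611029422477316,
   168458393000522438052492296805, 829520867274816780931103822213, 120185632195893862998466504725,
   170671582245888349413393631909, 225209255697706763380934922086281649334166100,
   567792903107805274617242134889, 570111384252937097516482525864, 3, 2096096605216773,
   275636985859831219330335445876, 908630522171944, 40961358655961584753496977685,
   273682096331117475786638177893, 658920381808267586010580408440, 655528665797186205633641673256,
   85248953149756301836868933492, 3, 843424514569623320657284211509,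
   842853487692241931435628970261, 275642360821236330638969544981, 2993042839593780,
   301611984984740, 813955356834718866001899462933, 30374948518655693196907270965,
   635554265459698974727518319413, 7, 1222221536236133, 2100661023955224,
   30835048360989441837817623637, 42906392997901350437828339557, 85179275261678983111969440339,
   2562567577236741, 2999498693693717, 3, 101791536978602257644948696213096314727330692,
   475877042489566814659939991829, 87476857893494762662183113524, 576906884044523493342644831301,
   842132306153100282919912624948, 347384048317368323009910216837,
   137382699808892043603231515079068357420667157, 14124918267097239619767967117881604234887173,
   94822874458977462850584000622822582869103141, 673386803667092,
   119031462167175272350725487184786770588021013, 2840066507686440, 2104474408870713, 4,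
   572317129837665474017428120373, 45654338171719915754295566613,
   229297685862632152452021683612935717597175957, 1479505239044105, 2837109402997561,
   24152966644457393076414792165140719085886117, 792617123078960167347120604228,
   47691601937014693496147869801903524765797029, 508213078900220973161627394870,
   237478987555502545306040003072215596930867477, 71179295563570553152058180548462962998928724,
   713723982414702289923575276886, 33522595067421284112376921315815341550907234459575707185700,
   118839663644785514550238300582326983358579014,
   14601052000474859630026511902706297349668236415017187157812,
   140973081560936004017894448457996448438631077]

def cert11_10 : List ℕ :=
  [477943026846632444204692239748, 21685019191415433151649929899881204644456786922394443489828,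
   2869207609450504, 237558023122664403647286862745536296044150788, 5,
   31940011577617494453687505508, 713526428036350726794507785556, 85924896282734778020675473508,
   37237527086574849942926923268, 202287472935096512298668506459700455110033956,
   16171404034747362013363095510317330366414226742934309597572,
   11293379707538388098801785213879417639568228, 719329035852099281744247874948, 4,
   85506796723209733890767079833, 308560439317576, 47429430285938855354464758234911927431557945,
   677399881883656, 171552935853638251961719665733, 1205498660655928, 3,
   188643983178778848659212753300, 270366892475568679124020003364, 507633501360674063359859038885,
   1259009711690596, 505449621531665056835334308933, 1484510216204296,
   634156721756405509901557729957, 237057373495145585459130077235004193465459237,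
   169909101018283656863936554326, 253004549422572479409682596389, 193245674146289396364146720772,
   208057538618068964832976034567139338427265028, 59014177014526327848316970547062513444462868, 4,
   1585637890786373, 369022576577478776018906346072, 579474584330719622585610543925,
   422257315601536059264762851973, 2, 3, 1742814522255764, 308179375686180, 2294751175480116,
   468433485678006357010780436, 358648984513189, 354083050270668548205742539300,
   805145007083003296049268941172, 223645338547846234089776155795265062940878711, 3,
   1286786722564772, 2544984081510772, 1977207844675860, 84845136531315490974013599748,
   635167366327878898522917610068, 71454375090770160014925139298507410693718388,
   558472906871548303823742058471638780166967, 556001409811458210473812579124,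
   288597347512211727691288773431, 842267318974364188105391682708,
   71292071699472391406148683392972164629284727, 487914348198581051703503651911,
   165956149244782417392710136483155653661103991, 3, 306783518729012,
   169686765104959296163810589348, 84960032290962173738459005204, 1167202248728853,
   86352681620290184175484474165, 85863522922809768038225895428, 3, 674692439509397,
   639809526091967836229620875380, 843162938150007699806623922852,
   47441707954550602453289485458673747349500180, 75725132671333129001867339820854573745533319,
   150994853962005, 146858140410405, 331892564896589741501295170085,
   581833132068968404791530164775, 53891059555724221628284235977291798121457749,
   166408988503067827897819426922957747175105332, 116320298704466675326005288309450356795453719,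
   69032522876180725996457169116634216377524772, 433589833460281773084522910245,
   45228425593662842186860433684, 32603594314526603934031076554117102428105108,
   160663098064485556386909899774610646582710820,
   39368625951118514978346004499164977691901240991955906725204,
   161071426293358488076815607863236810131065236, 3, 490894763215807033059366683172,
   51882342099632703961733682950661119062537015, 759170857659961781278272006820,
   673942716984381978641649770775, 169417222323949963776005121156,
   73965860223409481823446874614312189328756745, 364118134690217284677426775111,
   650329888633630263731371971385, 210151906873143129575944950309, 84886555050509341790719513396,
   52498597750312733294896319396045489583847431, 117792965634892882453486180178346974250078756,
   844688592852052042486050351781, 406512766373279701039933777236,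
   24064964980442920453868592716823874980348452,
   16649152599487397755341488199136252973282126666149989066116,
   32428710210993806215998889504599593983738404, 227240017348776605578968884182317412170929220,
   574524249738495522070513492247, 729843785046930471983920726292, 842893380220705110060113626743,
   798259029445132849797024425572, 2037412510662128607048268840978323460216997184528746807572,
   23746057683193361459902279656476273690018644, 227664047450704681308520448534994071544152612, 4,
   255658987890962877997518503943, 759226599443261939174848209993, 814065649403179738204647735847,
   138634558844221833047657603382360906405323575, 53057006533608492444233320393484853399728407,
   87106302945092458699152756745, 208311761898877832990887649559, 7,
   844092734634542461197947572773, 758010016309855427954566930819, 674102190901443548651216007716,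
   575964491060912611588462712691, 47863046158053405979828517541, 169347651270549180417550283619,
   843737320598584016135657760052, 52482282037987802678641780597,
   166153803248766798388701146597754664868250420, 2094024530999973, 301504298394709,
   204091612595090101171240212346, 3, 2991853558776356, 2069977760334645,
   169756733910754284647900153720, 2995211827623765, 354459648645669388897150980677,
   144492706537749, 5, 260458617190185310713406293779, 506456065728837147040699387908,
   254289187743813085274916923443, 713753984827469848928344027140,
   237486223456900596987342647475437563055611907]

def cert11_11 : List ℕ :=
  [95004823730538904303764162388357061914288404, 253210311095144650467850072611,
   843117416003797647608340160516, 118772676133881843986952782941846602671945044,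
   16563619047842249864849550634889386012449466483507542186660,
   78103099056942821459045384590465002887403012, 117182643725854904460234686467,
   580680926269926519356021553828, 641671984375574025255493393063, 655534255091467366282581911416,
   247770651972820733574821060886, 842133044114018821907617554707, 841924464244807952670526816535,
   346955918877093321558445295913, 561527929452094449740810917481, 347068712737426689793595187750,
   254541754286049367994599548515, 40419995993570295795684578647, 113902971960149020187876172328,
   414285924970404232775192977415, 80170892858290083630188795520098784621777171,
   237236070798880137621735689921468547327083864, 250239305058402905652927205928,
   137333060348858217611821353549302992789206360, 758285891179603467468319754055,
   324963073721807773835466900822, 3, 116448070668392667397836415524,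
   188303590571629218953624097588, 417952267300630030934899774263,
   223313813915125165663167482893512159103971879, 92454557428460702975875689281780389007013191,
   42466344057894232505045045252, 22859232576087694122361754814245449724584503448884999323652,
   336876196463106109506595533348, 111874829473674439709701857854399089184428036,
   94828366922388189980046217416010845331413129, 87471300935351584335319962934,
   758064954475914720634637293161, 237077256658915292609168394462375271968867939,
   842909205084289576902105012355, 268722605179595011034572693785, 590594767490098443417936094279,
   844592304668768631753847937702, 486387880733303090039344464147, 804207703282842310292729889047,
   10, 3, 1295942326387236, 2694492635337556, 2023523511609748, 2957077742457653,
   168461712573312352727720034308, 7, 587105948627864954706553636451, 2081558720229379,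
   28012332314560716644580137635, 189551866689823879570178250611, 2024292183806629,
   679115363848659632696314208264, 1686043446515627098796820038, 352574007293955320433646601107, 9,
   411395590273699, 301702669699476, 1823718630752535, 562843449099450433534870241557,
   642065813454847155076704414099, 2703308891881747, 2999477671118695,
   640196364901317504663390540327, 3, 2700636819888805, 906038673057639,
   337061365749491300860809972388, 476035212235955044247687309444, 87433606398549632324198822167,
   431134580125524269827636928517, 338337918584085182003479535703, 337381433256450561219022725397,
   3, 419239911564936017691539435796, 805145900841588848473317380916,
   757748240023156856557274600247, 340012051790565443817695625764, 367165973753532696390118580501,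
   844047111115311255838503805751, 179284704368158834539499731600706836155806788,
   748050231905519533620445862567, 171466044783330243492270256214, 577365443562326684283656347735,
   650272317832566707451498660391, 3, 2615335895392532, 179818545297131146977914266503,
   305815638157653, 44898770513515033604816936967, 598484151855783, 9, 2692792652554357,
   1250716598405799, 841919170566291065927068368899, 591300149705815184755461129287,
   289705094561087482773655470183, 2995557212770311, 2700479562009253, 3, 2991859572220724,
   476744933988257038098425206375, 253280388656023621553419786919, 3292596325170739561963655175,
   592357121045770535543495092119, 642069666298155676032418865751, 823103755987386759226752107047,
   1418658592481828, 2, 3, 2263496638546468, 2999678543675940, 416768940681505354370506949156,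
   265733267333823552412706316836, 6, 130723049332905624032647905555, 2997716065390595,
   86211485382198665281617265187, 86219418976337642239573500227, 844701966317228383940881588771,
   39950863217115039588370907140, 1005327665334947, 2605466835689476, 652506538020868,
   277301701007970963573556520548, 3, 696653377307444, 2009040017858644,
   844276856821634547250743253668, 85534498735436169021606687268, 2693160655913509,
   843076481457432430841495247526, 477016979948465129608160150565, 32267020295334447840728450388,
   3, 649494761804367366666072957748, 414285056425832224458924531716,
   843193209550953769430885143076, 571080352497198551541838332728, 87472057123611416420269254406,
   843138042995329934610660548613, 282587667153485904233632538900, 426956986377872160034182537590]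

def cert11_12 : List ℕ :=
  [12765569714789357765193685601575044998915846, 156475858523421504586233420610806920852317796,
   206315598257908021899824239188, 273070199659684224913953405334, 723992478194139388058887468104,
   483118437553138289253201581142, 9953664764019146701780578461290456784584982,
   71454369657918353531414884996460561508352278, 5, 635570013573701496433340934435,
   84358202966572770048327635043, 635461661825770945437991175491, 270212021982383716174713102884,
   288836753224890912859022758435, 844322284142680037319991396758, 168754637638422528529449230614,
   490388009025578786100332271207, 40277076231294422704043238742, 199950815036583030615510958899,
   842264163803794175863661462324, 30161878477992435943593037828, 422788141009631997569141904180,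
   6681999485065165116661880372776593166848949079480723519892, 199058780957634655406062215172,
   676237601428423135965634582664, 419238705473568325051352646179, 557561524542213858248214358150,
   481310243190884097305820099923, 45894002656210361792847159300, 3,
   807471957595116664955997348388, 329409427101129573946376921094, 2995624051540516,
   652664310821685, 190025052639431719966016651255985656376394822, 466753748750345,
   10133452882096440087588224365234939368899108, 265074445208548763558178627702,
   277304922349914785441176974132, 57436394220189271888393657222238542130909734,
   179936554172918620753298082470, 189694651006043113066514754010459423911527222,
   101001787147372721646368227791571023506318134, 4, 407445734856389509289414455846,
   310103185171529, 675421045137343660083012870150, 30720758740846466464050023754292745050673558,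
   1487778424623929, 52180625508753665114487950909236082479465350, 589960038597229592327292607143,
   23745991093693831625485853035365924965921430, 842272153510688130668123669300, 1803553727774997,
   44002957923001273848801418453027519697073651453323055866132,
   14033376678358345533227824526828838854875268, 4, 307008629264933, 126685740810517,
   1205074729703285, 844761279516826118258584470409, 12035600151680891160696033806398056387126073,
   162423921837420114646323801195777775160034102, 74797281526812449711788369372771962287973190,
   170913791846384908678390182484, 237661056258919012442713821308390186502230838,
   94870940854621972162030566818154378091051412, 142540013366734206086893341658142880125313159,
   665849750188450480464400310823, 14531226877117812313497972372189389465888820677100081267060,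
   57367871087647203679710450573838737422359085267140312469620, 6,
   226585594701648889824626273343105235191219812, 555914428605777195556365830820,
   843116381243707619321496097044, 142170366608810079131597441377080955734466836,
   157772951424561613587123323727434170622313268, 85847295876754942615749028516,
   6734674011818585719940307128479577868762724522788797415972, 1401395931088534754927588964, 2, 5,
   113422322981267, 2702947862586883, 11697386770803, 1981475932636004, 3, 708799280812036,
   170898936961257071805168974500, 842131039169686927580465479956, 842138950317520226643988255269,
   87468697681106439015992304164, 491869729339244075398113604677, 590374881688613243906857996295,
   3, 85498257949680803808136081956, 482840558022863039530553484084,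
   422820034818470792764852367909, 2991871098430260, 508183155915537599607644619845,
   1029312418701320, 842457511674138945197569161893, 48176714195261601445533653663321827549784741,
   506724438237878751440574387542, 493517780677945527100912509749, 426048690297437721080215249172,
   163169528859788999370612172669735973844844820, 94971215735767644045300065709021518027378964, 4,
   709887109906709, 85196668875486158746811589160, 252869083885274053927312171285,
   337203815065347168834214445733, 4, 5, 720558485528548319304747335686,
   640755554541687436168975055527, 2029148736603745, 151296217789558, 2994543832073283,
   944068198016113, 410816038200386, 1, 2351443175085122, 186504842382801704148725765462,
   645906403865170260974405713922, 442607420957812652715395777880, 440711799049608758780147373394,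
   9, 1231483767984474, 1453791004068246, 1196305260632474, 405193997118118, 369454858315911,
   759563911422858392757881877626, 475816477224929369760012439558, 2254373733472930,
   562182393184820507319378272264, 650930866907542, 1090570820498091491842173075, 10411828725347,
   2886782281931153, 729881717868363790977865970849, 1, 2597759515902226, 2573567355400470,
   1583312068420674, 2286990151492674, 1, 2895667308687362]

def cert11_13 : List ℕ :=
  [1742112376375702, 676635252360086292244096783784, 817045604416048934152221111718,
   86694992070635594490612708418, 10, 1260423408410630, 1284264330700119,
   487768269136233301991930337143, 1735579223541078, 2895647725670408, 1250774574172294,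
   1696757240388262, 124814594757473, 5, 369398580140830757875723167062, 10193323337779,
   2991235465287265, 2698232993424450, 1997166574129158, 2062997615454305, 1507018228728945,
   559552877113294193952048896678, 3222474214447196950877264545, 2554509212165233,
   2044370495102978, 2997683250893873, 1734568266174466, 2147964773868599, 2098167375343617,
   332257998983254543242066830408, 1505405364815385, 409744854822921, 2365142460895238,
   11370541369473, 2349725123257953, 1804367479253057, 1667363415409, 1, 2999837142884626,
   1255678151825811, 84366877142857039003174245446, 841809206890673410613650755863,
   236945914082438028916658444464162822314082578, 102619061181635448820648199607136805159203366,
   31928492184235145199482063522, 1, 422234788897906, 359822523000480115677013831686,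
   2692099633976662, 841810447414611291684729783366, 236990407291162421888293061433611793243506006,
   190046342647400121957231766721469993732187527, 85564549644713622839562413122, 1,
   2994255879819266, 843667410270199117589771531330, 565508412692850031914298811462,
   183549471542166628596387489110, 124419284210526417784897605678358930802115927,
   116309416936664198922264798857369457562907719, 76076250404857693903209461712260720954335238,
   577229915909312446205184461474, 126150933539239482320351860670255407901601798,
   252877391579818036071158264086, 33425501410705909628744210090828034761861355354440831964502,
   47912851602982778029715511198417767133942838, 75393011249273897539494842353211908334879539,
   413956077455463399252467810578, 171555265452645108147492094227, 6, 9185448760385,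
   2087578657951745, 1268381696828753, 183225107245536592468076880961, 2697206347227251,
   758335547327299801014988001843, 844108521944959563628532467031, 571019207924781066347405199224,
   1917891624459030991193925495, 2702900497766193, 1301827812817297,
   506519598380093251851693745281, 443922699027759075291637688083, 193126013991377054036535841416,
   6, 10205670042275, 361839509124772407492594786305, 2996822289368673, 1805678112961874,
   488456302217778344323952248417, 2269423853978961, 275306283279332908210634425955,
   841936030227751952908533014833, 842852226274756973366103508113,
   113300619614940001083101072106846117197940055, 1, 10176698738002, 1198030501478403,
   401101226525456165108563057319, 86172849175569022744250499353, 487469530363716575748921381954,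
   625942762775891, 616235084843683, 1803405348193559, 27070891542749362463299339607, 3,
   2043320249354369, 592462603287084647451241640759, 590586369895285184436132660089,
   1955454769332791464753128241, 2305925163250589286668903495, 44901113614681969114709718081,
   41515812264418506640929026051, 2293827535912968, 492440614600539701216828155224, 7,
   2100291777990657, 1188915793499745, 1752714145187697, 490230685439954533850278950225,
   2604069451560275, 762249668468328008048267267, 2637396637501580887325029448,
   675363332812793948586470906024, 6, 3673879485089, 427893096400737,
   191455712978762487295252918273, 8904912435873, 34253644932636932836627724171020745598075161,
   757627182026160837642562917191, 733308213705219984429354231400, 3294433291339394040094354089,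
   1432086246884161, 5125800535649, 844359898488849649164597146689, 724601170525442055511667320419,
   589272332337029954620142997511, 480481103070250804030182998647, 565939371726006138446105882632,
   597499541142015793390088778823, 506655015042768623142532506689,
   187054389894355372199416055055985082124017672, 104749055155819288168555873352,
   71118703109808934323701234904155246544037752, 7, 8184690672225, 457436972938785,
   254441793206500878528710915473, 2628038976566337]

def cert11_14 : List ℕ :=
  [258220092327839153146530104385, 194532500812929777544360273777, 338734332863700008699524704385,
   606767500269231190196501229576, 492860404922215960257292666744, 285430408350312626699376338809,
   6, 9254131222801, 10077174072658, 914816643787425, 27727064926692874851368600642,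
   2275594844768666, 2080551055208833, 84973597918440863213325402743, 922593982238728,
   1798011375521800, 444766681212513, 158893268924230739972363843237849910628345623,
   1802398613932442, 3000650019721217, 1499946618485409, 1465030694504033, 1667608749713,
   335062641064166398678263660945, 209521895132356156278587455148454931523313946, 1,
   179505230932370, 212897596300043628071748188127764351177799, 1015993875301523193962116711,
   95649705220470125857181902932200138566116967, 159595156698061474669601338340984287388902535,
   263198388263834326152361821026, 336728732342921719197521311063, 812096094967338783448190173185,
   115537315806452555190676522595, 8217970246728, 522569493833639200577023157864, 7,
   2153432535270449, 1754012480849, 403645873526030813569546063873, 1202004452511745,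
   636729401919561925771064063107, 177524829688899, 653641382416834243981884078762,
   591294733814807429528611624008, 1795067156264215, 1693348947290, 2556752262799489,
   843780832345165413455843926858, 1502359201026424, 9, 11345211058545,
   423887050355357255367758747239, 1197885706823082, 2694107458215, 691979638027879,
   726050972603089792457151831, 1796070236656977, 165149430732109581457276752961,
   447965389929855663664873677175, 445648008803943, 1794958489654327, 696103975796743, 1, 5,
   1267161936532818, 3000843840606482, 2580155567788034, 642068209760843005138316108050,
   2994255535886338, 605430074988138776668464058490, 655380933901881264314467315718,
   590546362915824918400030188615, 843482089571223911338889859350, 1462970837648994,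
   814009842535741193890633880951, 101843224161353402381185984200644164815459943, 6,
   2553454564630535, 11710567122210, 2892715418994, 421368876696233454926444298514,
   716274358906262519665366435159, 589265662178924546071247979863, 5, 1577421616988162,
   7808876820882, 2996385965147202, 841961691563403523198400767318, 334657313562462299501585660578,
   817786444134974195008257727064, 245927423111806114401174702758,
   927781977025895420214494734860652940100950, 190193901303504391959474364935673637832578935,
   719040073518445355084999500050, 329633723205910850251088466474, 366587965505019925523208340550,
   129713453893486079918778519560, 129539136805879760986316575811, 8, 2997351494977666,
   89724691956338, 683461910416349522114181173257, 841918084997463293886611423506,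
   1295933487198482, 100355256108749325037738824648411778424111381, 2,
   334728979061656188232644821273, 502430260873859427868530319365, 2663585182462505,
   436084263011776181274115518739, 134269811653671608166737159917846812419578261,
   591238886455072423389339091782, 32607231672794608984506952155613457540483749,
   421046200750303814620881777730, 1443184831398979, 236994832482930530280394206721068645478578310,
   643741693955221756639838705801, 9, 697095613073810, 1202359302621586,
   843198148416340975573592719362, 1166617859430258, 250204907420033922718303870979,
   2841565287694339, 758394605249530470504359547962, 121261166397194507318401249285698128264341637,
   115218341371996437605709755963623689126179909, 634818376715078347963295074438,
   237052011712041807399060736978155648770479413, 339350847821928468328401147218,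
   167814084537157318725192112538971531371782150, 1916924348605958180577825046,
   213706200518732377190952151409570153422823798, 166167238401392715519993628393559859784936102, 5,
   344174376813218, 398022621356183465305251551362, 1499970771902738,
   562179549644648908928998255270, 844763741583148164310413498505, 488141691996984165540077654294,
   714813796755977107287512286574079192506646, 118473901965543936702118609057855331204335750, 3,
   1697935748307618, 2014625836261378, 1462781188153346, 488744331909655471499874586]

def cert11_15 : List ℕ :=
  [1274510248579890, 118774234435148790285156763163470602125807893, 125445864714776692163234825014,
   359821221255177175037369820229, 2006201643144530, 126101995732329113056281064518,
   1442939471178076442134401032, 2, 1207607390008165, 430999664752790020812491473445,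
   606081383433285, 1743366417515592, 1289753213764408, 506384081012891968531165569029, 5,
   734784004891378999060277048390, 1865343776166982, 556324138352201630305255380006,
   236985428167318132514039579869894814221866054, 27119361706949802355406471387965594320050855,
   635120059942230, 444385779397974, 560941625649510137979197330774,
   673448383568362513279591261255, 844588319267310406558181037110,
   145853553818580713270433593199275006797246743, 491644769997646673905199976727,
   138187871110326494846424380137366809952584839, 5, 561290375351609511465167357458,
   423201437125806864311761574568, 237480113328393098882164370266127092825733222,
   726557451805760358190976522625010012346647, 646854598190459842616375288904,
   163256038030585320381339054468871280498746982, 115547479448927424747037353298,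
   35299579854593476946166476921060775653044504, 35384782263164313510901641493235080830226806,
   178411626813236107961413812504, 35032926556405662919303853513755564487954712,
   78055034812933834831035455942910518021984387, 125809681325242971484945720454,
   93571660789693413103280059942511141124219175, 2054300727476234457574872198,
   317911309695125952371241473639, 124509727642733866526387643542,
   66750174225571699014060104751695842931232272732007653663815, 676364086387882105662964520551,
   35492818835196631193604659924565887910220599, 74524568803283756203652223528345915962377559,
   843406589375955002066943219032, 190031440280500566592973313356271578527647801,
   793879226358733444496142975254, 841803540342586551832514091145, 8,
   421267835835007067411959021574, 422184777255498615051980375081, 833489085853281520277977592086,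
   50739270551218995566803741857138649626748246, 25646210811576747458857070423445097215655942,
   328778302154562229637161190201, 185199322677773138750512247878, 5,
   842545211670425915225119477762, 842268603474837766023875831122, 741103148411949648952605803858,
   591155371836553852793007519059, 843076463727037811134191637574, 841965177480730472522183164182,
   507382106237145377618646024199, 45959858713166279368172196210, 844594576423272030018097644611,
   45849090808905626052934713347, 274861423076116334827283887171,
   21357003636656343134283887624271248294338507321134288573507, 255047460098004973812183011475, 10,
   7, 1429534945577365, 760917420272262744594092564760, 2996208502259986,
   843664865203046793685808883573, 11640023236946, 842176823013183116658228594549,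
   2095989507752789, 5, 398720223938418, 422769186775202374639558945442, 2979699470119192,
   505738524623855483863990012482, 646714069200234952561668461912, 1014938776443982079112250712,
   2966814795876203256706263353, 641708379878744, 8, 2661945746592841, 640468064575826,
   134520543732809, 284552523497835566363089853097, 299499498514297, 5, 9101733664082,
   2694104460468230, 676559865831718257256939152728, 2703300873945446,
   844432344852148014711740913784, 1852885165581382, 492401914139283725521820583254,
   505219939677800045210986961254, 8, 477982768512678836993469517826,
   477691499048124006345836286533, 327242135108179619271666838183,
   112381749655980701493975579796323948567372439, 681570692035035562595648282629,
   165632906711854903144832735363, 25137914512154989044559986697, 166049968036017271973457502293,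
   178602365555664921415588020229, 328511311200927775721616081189, 337808983045682937955286163753,
   5, 1550935776524866, 85730098104919799556529102854, 339940284224381599388536299528,
   579994719789441000277378728211, 589269758884009626246087714648, 505414428156457982567708768614,
   31976395243108326401437074776, 507278140093515199146007537544, 8, 2694195845250,
   117169705586390661322145927173, 2999699668177993, 1196790524369573,
   255637343351774933886958130213, 7, 2995232901264693, 841919224581742251860586631170,
   339338248235708975711917315221, 590078596873550408217476150309, 1817510842900760, 3613848065913,
   2999683667791880, 2996178867402613, 8, 844613021432122312194137937685,
   95330475095854572015580434706, 693256191648018, 2537914822103587]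

def cert11_16 : List ℕ :=
  [265564926050896963867685323027, 2403632084574211, 47419467878803051503047643598283544013592706,
   126410450026790095405928520355, 843991030811783747125693145090, 655514834705105116470671073939,
   482008622518066223584304580741, 20120292278310229701590956377871812854612044843569807098947,
   101934822620199238956451013150188732017643523, 2, 673845894306688711314255145635,
   91747552616995, 361816433575871414220007833875, 202473283542655793266949332938195104844644899,
   253207505996810952048269295891, 842816323053870663012138526853, 339533012279899710689325523218,
   736155356848435087071704060997, 206492402218922703954259105213855678131085314, 299786725188950,
   758076731426116931413625667862, 2188577396709820072097691782, 5, 487586757375427976469095613778,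
   734762176982326701342151217154, 169357324330820029962853613842, 421659527572903153796727210530,
   715614447447260466414302352550, 590538087632187236584312107170, 2,
   337764252813993471249760927859, 339685460236361786173813334019, 506724313311758293302356476997,
   2993289736503299, 272426018411201090911950213125, 2604833294484072,
   340010998616666744268796825877, 927106377484587626301426005521259933344901,
   252877234604661140212737479990, 356859613887287644223610233189, 842854696657034519197683755411,
   55078552638567700440012359884364811165179907, 31470149810814650322974905170389928308254579, 3,
   164010359537941, 361621797309819543068678369832, 430921198795295255136007004165,
   252657144538767383918799160117, 9, 5, 432589284529217, 432726635344946, 2990704146519377,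
   506783249863018284812628685078, 208057841143212751424350494730, 1851790182741329, 1590388233553,
   2133327571755601, 1172766679329158, 838493128201286379941800278417, 178625597511271,
   2416869634421831, 6, 1804940435522609, 759805070926653679831848878081, 6015141628305,
   483454286473194522492410281994, 2617137116231, 10, 2341341452581477, 1502654706760081,
   1535083993014277, 985596875262355, 4564058740017, 1, 372091160365186, 113882471471781,
   481763396658060836533315906215, 87081760882879393913588959634, 8, 1993758321449525,
   1292017202800774, 428989859301327366434773881910, 741489937875861188547862533, 2023535592252487,
   2966015680996421, 177307095610709, 902263786852721, 5, 2996375480005697, 8974143722834,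
   1169980499077521, 79937805073815214027032650283307665673428998, 336732546582869693477670892886,
   2911590005969985, 265740149832482525110901770641, 142911226798344293080105823908887459549676598,
   1, 1496888218234882, 190112471986376902729570553962453673118304934,
   562515612445338560473664411782, 742225741637211615723580209562337462947846,
   236028192047442371988198605553387708447480214, 33010334317572507461382135810, 1837924218478598,
   3291194020026783235687752762, 464196212965515579203641368059067403704998,
   35708370886210454236949729281, 248851715312143496785203437571, 1752209238947159,
   105040713338237386622906664279, 6, 1539907105731601, 9378398119249,
   113903357846281320689417357681, 351867235763761, 836854078873328673590666995027,
   357685034976867, 337442855195888413010741429818, 678784454151551983589337356695,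
   3294508877233219270018599590, 556479606462250038896670150663, 6, 1743032358113281,
   843681719976696741038525516186, 843819613665950134082919811479, 843404708971666025803841673354,
   338615839249290305153603208534, 2911025809069674, 1008973985883745,
   678532832789373040641262705050, 2715051874525191, 6, 3297431384246513076105842689,
   680288499620087543600215830529, 1654501231200985006555552151, 336727733346508027080642397793,
   1326731774999539021955622225, 1875308121687111, 719880394671699651969257479,
   2313006050031265003980457303, 2006898003304455, 1007221460117095,
   758016258901416272626829387095, 5, 1311193777047962, 11138873115985,
   189491364446451184047702164278, 5856576542311, 2696098698266407]

def cert11_17 : List ℕ :=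
  [1548508158266, 10422410552657, 3001123248014385, 2679665707806721, 416326250137905, 1,
   409727937384450, 137067131140959774082621688556641945818043462, 41362419823210241192649991206,
   14678832776797497741432999877080405930944918, 50456525839218736704563452899838697216950278,
   285442353334985397922033014098, 1008632871743786, 10544500614209, 1024888718846353,
   2946775268721729, 1188091057579345, 6, 2928654515438929, 426779469254657,
   340015473475894840311376588801, 640359626484113, 324098883031843352848869975379,
   2695452846990947, 361487533075362948260252239463, 50240806196421066735046625687, 10,
   1514341849926305, 1858334975068017, 2668104035674241, 2945115983721811,
   105912199682744376584791800214, 8, 1311190056698225, 2942833992869419652470539606,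
   310578518511722, 2398129956588150, 1559323868762118, 201261977112483093850632119366,
   1166962060767233, 758401574771557168011598383489, 253325060082766247836106359878,
   1205173997613670, 2647915845942, 1147445610440022, 6, 2691626770523297, 672972576233601,
   727911510856585111815126517025, 1741663483943322, 99039521349605898676127238551,
   2392563396159898, 505083963045550945412033111114, 828560913156021647739441255498, 8, 1,
   1196711621593490, 11281056012421, 2395237226091794, 1697114092542258,
   22400277169700378381272508714, 675127279705365551649722218901, 2696312655421738,
   589347191242101588001145764133, 1207957021274193, 2593463950596900544123904002,
   2696106515368610, 283571760586417001401252201274, 114294860477341781089844516789223824111935770,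
   2948444117610501, 481870745667888360687182809490, 351883054720309,
   413317275970327500975761532250, 10, 1196313640331282, 2395378176122885, 2693011122855941,
   2692031144686661, 336847356054389483488795048338, 932873500271685,
   33000696026443349430040562069, 1611088018061875415783393414, 5, 23086110597605998901977172017,
   2005548694918210, 114574436281526335214504954176576180436247610, 670537970400273202329757047190,
   340010809864628024393156862058, 645055741163534206132035133562, 184341920393467225257371982234,
   1014236799042625, 338931587702722412180971082626, 1196283575502503, 5, 1, 1990413347557378,
   32614101128746356812305679850838360471311702, 420903575914114748533816366422,
   557266230851987992102681388059246665610662, 28672712549816887194403041676619152958642582,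
   842540527009085231021903287634, 481436120470016794523870580746, 2432202935785878, 9224000264598,
   1, 6132304925971869223823026264315209418237222, 1199112842793238,
   732866705652358134976722782887, 664971233821371678328003007558, 675434789069731071313135630742,
   3121992351904193594011172870, 1, 211913610223836595304938420161178262195766070, 179654800998678,
   586949897197110287357457017238, 1418938028749626, 800102423500354045564102656278, 6,
   8343532373329, 557896614484437983364030880145, 2399371937784129, 1432291937093762,
   199181808744609679339161220434, 2128659969746530, 36639645164408112024693416810,
   732869501240357854883822806631, 6, 677400457527297, 2294283836064834,
   113699956573491926607945226686969182134166874, 185375782175387389760734713839763667913173399,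
   2928628888132168097501577226, 6, 675431715649410509144334533697, 327854214557022627414745223169,
   842863709847174484562188727639, 337189998601627892270519363169, 508271799720652853819837191777,
   412285261471116728867985901970, 422882931807393272554282108839, 511463047634608000865873064978,
   514987980061867782631389865570, 486307984046794903008093828711,
   211857901301082862645517308477440290669880631, 189557548386118267021203674840398430117373543,
   759325551744906835854269755399, 658592658831590915208032638567,
   166218515517046377585247501101089729315632471, 6, 2392569804052017]

def cert11_18 : List ℕ :=
  [1467167271069985, 20804944648491919284354902417, 1411473708378, 2128659967649378,
   752809246244228034338889295186, 8320570516826, 189613888877513192929950816451022647644788647,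
   1151638090811802, 754316094355717815700191540570, 411306174851828977211845018, 6,
   323915289567557604041945294113, 75266600987765605135278311326327152324064599, 2032542355308551,
   670388808351040784453868266295, 725595109662169524748241364311, 6, 904301631547793,
   255140590422404742111618401578, 336725973231141305173757494439, 732842507109994, 6,
   1812018005059873, 25428050291672111790231811687, 179522789086545,
   843791553386302495395383126426, 823587331608292971543525328215, 753058793424815854785531643498,
   142134802457463, 1715858547483719, 6, 675091350469970839733587245457, 906618020865639,
   252876617164311790153935053889, 2678575198152026, 403967891952002093498171286871,
   1442886360540940589034845527, 233288118143986378370699476631055548126999623,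
   512665109120763524946983102874, 486260601767408562917867869799, 1798883522416759,
   178744834864474, 10, 5, 1779315025459873, 2343677857539094, 662387093476421,
   181116002332235433130681999718, 379995155363366, 1203048044038550, 1206828373713720,
   1205316537128738, 2999558880625733, 160819163125349, 116658094101302, 8, 10, 2105174730872965,
   933968864365222, 186464763601813687587675068822, 675319641809353401885175028389,
   2394011288086935, 4503597709989, 1414215227218325, 1205728873313569, 5, 2958048153856401,
   2267201549715516472151398534, 2617138381894, 759486425522965547107890898262, 10,
   822443533511895252285332396709, 2994546232345942, 1009534084927494, 2150862051217409,
   527539344561356277342410130069, 1206233150597173, 1205281003432341,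
   758631373745010506877483825562, 2697172663612487, 20144952317884784014338857541,
   289194406285748592339762816023, 1206277267470375, 5, 2297516638143281,
   35770492401789548538624164117001338667349034, 730171882385659596691765041286, 2867537147873690,
   2397047909617674, 2291465286492165, 907735575187825, 2700608631280711, 2033620929742981,
   352567463983514, 3, 4, 2343709769601029, 2698482639964241, 2275617945104389, 1206372203500881,
   1504200804754577, 116765421225298, 2694113537970453, 902082276202625, 11083034759985,
   2309251261376913, 2993214384059457, 1, 2997337536873266, 3293801100733788267872281637,
   844650045075884223906013929750, 338289075800752680992751919922, 421402989943942167697002926629,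
   490370842987682484142653218818, 5, 2697481110424081, 973446990893057, 1162664887016097,
   403108607825101653576640968022, 358525780768097804962796807510, 481428262507758880170827031623,
   843763741860897117204315783537, 116077802640450, 1571085405294465744539485254,
   2229950310178995376005541896, 283829970580922346127280517122, 5, 3000796214208529,
   1290174137895585, 2297154791412530, 340014197736628240717884071937, 2998593988677633,
   142958460980773368365780814187693856494137350, 1, 1014447676064834,
   277937596894036761738767186598, 2392563463263033, 2588561780338690, 2992322845694257,
   204668139083136186370405714489, 275645136185939260232708392486, 406514105344798962456931074865,
   689619637526535, 590004534853580235130158796807, 589271889503133587034522338647, 6,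
   2030335598174209, 2024572577292289, 1804536146658337, 589269519178500419776472627879]

def cert11_19 : List ℕ :=
  [843221481018314365266350776471, 287386258792673543677666620967, 1, 4, 1004284865421314,
   2611454572441602, 898890931118085, 430808170814420274110505713941,
   481447801590235335975898257714, 421638920066079360801103222101, 7, 395343208536738,
   3000779027933042, 1735735754359602, 401096380864699529824871866922,
   253825392451895687664047190404, 95341739910463037704112235243151912040890644,
   422895708675094828380384806773, 650685758804826900720069982068, 2695114287506,
   650964567893141612784433505077, 841903761776223789583506548328, 2, 1309871225122948,
   129815968441577389076825600388, 2558884105442100, 92462897395304, 986568322515496,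
   338955175774576601209939055684, 2, 408164879196164, 396477061377203681147128795956,
   650945667703604, 827331219135158016657862324775, 584473520683298028182511428404,
   1166665696374792, 590364797069836602479590082967, 272811736346501206999080375092,
   1197850577050276, 343644997027899940023732236378, 6, 5023609337988,
   85611859473319525534350254900, 843968347053355363418113512244, 525334257176204590049484234757,
   1794888732156708, 729198246678775780658029007668, 1287695798179428, 1569140559595109,
   2632656913633285, 171519327602686765472319734037, 4, 844609309563674926761794077765,
   587596360044895695182401999655, 758705496830280914262946096002, 1127405515477841983129128967,
   110350763672891304488902616133, 844073291854499985106126529333,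
   140082007412878304607447988127072495918031941, 52102058153894613023723021364539555361920374,
   844106010092399204665477460247, 728257698967091550351941506120, 2807462871620487806914134823,
   337791214726130386426234427269, 368781022666320990476755689752, 842231191078932600688524006197,
   183514753898837585446359270887323512048453493, 893371940750216759350392573017420892996645, 4,
   301955586222482, 1579641688420845244968546306, 841917886063161427917570931090,
   844356658095817425116445487205, 843699021855921752222843675714, 119828737969980340475840250677,
   829469642860688754216167178247, 7, 24622619827885511397657511278710021928722708,
   2812516410809452543531493237, 95706806246235115273492144915849701499473924,
   2595757744270076564937774968, 477291553843818810345033274319618720833812, 1734179305046018,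
   24621927367578926917078491056914633523860277, 87024111428207672420132194168,
   205365396385934931608024385276831456666060392, 7152372754296, 1795066372960530,
   143922119373002492076044816274329188715487508, 1855370742990921, 8, 1715925488576370,
   161789147242770, 1795809310442786, 255182001146770754756773709433,
   121404636986688706372451024978458832590313609, 660869280309276182096489505588,
   237305852612128206190561193923713987118180212, 664531383440906000281685893224,
   7250272117431228919294821877398827820926840, 506646344162511548498294764324,
   139818835934654478688710614063401688882377524, 165862351382415969260312199453979815322931765,
   194764346745130398663444026165, 78515945222453445588781569243206366122082597,
   205449441894623173515531451056063923653927733, 164838758744397010874679653031197758121590789,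
   166042666637865491253825591255146261860391588, 727910746053577142521915114008,
   227538021048768430875267023184981921614996549, 2837393747419144, 591929075378569158870579875848,
   4, 675435997944724746052026568709, 675664514512981242790276576344,
   237061241382513595543676636883171392473302088, 663548183324354654384740716552,
   506148930861499601190777784597, 79470376239220068926688946008134743065071973,
   587490915982677292331880218904, 480323420008684679488362192904, 8,
   348306083317882237267346761588, 178641455964441, 515066557884572481295244280628,
   77368773900578314164104062959165398398146420, 1550835441361177, 2,
   844277680859625450886823084580, 125167998341717634471603601959,
   139421391356381594290840722227273649535058740, 194443880598435238643020202533,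
   98494126312088313449875518630492886567903572, 406528678979991387655306773095,
   728053910456342381046380577316, 421713316956679115987053993989, 597325426607100709281338769415,
   167631478139474368583667553451678501280306327, 2996338359337239, 249562813939683644358168899924,
   302937035719208, 7, 2105166178881540, 719711243922786646287504791416,
   131594481792393720225745547812, 337692981770563011697341313028, 2, 2895643352969220,
   841962678487243842834784686628, 842889849119416120291395019348]

def cert11_20 : List ℕ :=
  [486918637761816913271553852517, 10, 803431814810946697021160949896,
   119906507468655921963644172966, 11417217500503, 422872892590713597422656463221, 4, 5,
   9999667840337, 1200118579952017, 650930658153265, 2865657868383478548695442230,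
   739798091795212486710566095526, 2210613041159281251300087335, 3296855344082001052715864065,
   2575363062735122, 401240827671895410093314896694, 367419538124465704807753343384,
   354363539878878708206022207890, 8, 1287740591200929, 1478264147708577,
   244048297397192703998818810530, 255714528024867017828403422001, 7804939552897,
   227842186975500776484326380119445082362434357, 1, 2051861945843986,
   2323950068332863646662340885, 2104549412176985, 1549663660876866, 2402721653526529,
   813082521601189197600885444617, 339342102550299291703459393541, 673568299931267664911554260993,
   2626663434374, 505090663301067453126065259318, 972767453828532630522516278, 5, 5877549110337,
   661012672367265, 11297950364465, 288846256992555935769163375414, 3296179712690558357978899798,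
   486403451780625603382253454950, 5, 2554338659181633, 2699589346551126, 2694052865131857,
   254416588946995326855110952001, 758053635881954609639260916118, 430572880775973563729646726,
   142609780714379272029681920254819070203072518, 189763230721806797435383252672342757880800039,
   2644439956926470, 354870670978509888203213050662, 237658659219600810091585380915183519449419782,
   654349495667543586654721672471, 422885439603242352881253501606, 1171601065784929,
   616764912626966612284036184349138969769303, 2032759922469075062167794487,
   19458808449398588447729670916742884030776104961436081456199, 5, 1991856850904161,
   438915146770159272949915321137, 2593037650170945, 5916101745313,
   12039983120294977486496646938100261709885720, 163077331313018548788126701733889904786686262,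
   272728800674594461725608115881283178636359, 758616111793349465497569678136,
   208569062756228589888916491797234871463576646, 280597732479770303881229804929,
   2251499955052122692330726738, 806982818518783770319144184909927978192902,
   1319734182356160541793493288, 13089666454341929539063903002660711134789912,
   37626165783789865700816917602, 237476688232149666907478858766219836519961670,
   104168770434825016406117471031, 567298919573000689667479805607788058510886,
   166418181525925769474457310190001261884101703, 237747931188171764065443429465187287076078662,
   398180367867249299324764525905, 51532279201000755026939156844511280486637887816186062278663,
   159695365524190242762181622311663627959501623,
   64374062392656605787539565432837019995424028942552872358983,
   19406198415799609004280991949472310404877103074582420559191, 380402014530005445109700920,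
   1522313628971009, 213446889762930693467585409571672701248443737,
   142804272822432197024600326067372703978188902, 431935993422321735705319081033, 8,
   1249058800305505, 2593826690842625, 2996725184750385, 27284555607158090137468967041,
   2393160947160945, 480323552488894849500386183846, 361877795251297553790218494690729732868230,
   119213357651905489709027204719273896422413654, 193134895339381162204120190464099981428138137,
   52223823527821336022931090992641442779268214, 10, 1, 2147699470734130, 905012516520997,
   109615767448962680200685107879, 646712829048688099702767377064, 105856224491842539097155437362,
   1, 2099244759620258, 507323911897304835410365516453,
   22224252334547941209761734430834884398237983951310136381541, 99588338098456,
   183251951126164164579329371348311645833167669, 277743464304032324644909555714, 1,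
   1797250979202114, 525239910452589638736365048901, 2907282475647256, 2095897064940610, 1,
   760795378994618174070284356264, 2271842971971589, 2994208570970120,
   30688026048757279410742793336, 1, 3182352952297934336730356392, 720309662267609501570293990471,
   604581730746359283445817385317, 764880198481698151815419545479, 2558990907778088,
   252976947034141516618996592648, 725266381691000958328169107465, 837534770529364821061769837224,
   95333509838862925444818262423832447826404258, 1, 95334011197206590523393795817404211296041638,
   1697037203099925, 485683880656301796261767622934, 2309138073782136,
   94970896485253900322243772347596881513155190, 5, 117271166022721, 622960310770342,
   2709210191451201, 2993173714522934]

def cert11_21 : List ℕ :=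
  [676615501354838672374621290504, 2702681795724630, 685878357952868902110340438,
   511350385400863711372580819750, 8, 11511877805121, 248967845742603817345109661829,
   1718079296898113, 389433401189441, 839095017126211449118320629893,
   339642434881005153361937447591, 166695186899729633221446203953236219930309703,
   839478557616312057039321828005, 2501825981739524257152772629, 2022925814896133836325821093,
   757738131238954606835119794313, 5, 897219297960337, 339881603211798285985279845713,
   3940165384872, 828653442985757987976822138198, 370072777599656, 336882265919253580283342580390,
   1693939026580399048060536152, 1199747968832856, 8, 890210916794369,
   802196712362737381131896394821, 1858391547122761, 844759212304559974334494410565,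
   389479030952017, 2986363920463247653937875077, 2139718452193417, 171484315111982185106943194389,
   594719284197928589821890663829, 7, 427175799308724823664535032613, 2095980038295560,
   2992403109081089, 249541639734363316051408864661, 1709923664098369,
   121149344412364787734935652209, 23899211265215655863535458127282121428608881, 1750873818456,
   1993979809760873, 2945134273773577, 348220899174099127679222973509,
   842267091157109297449861084225, 170662337362921302531748398961, 5,
   842903450685503345945377083398, 1847192727079590, 78092614335470554382017965711482209372764774,
   507391331046953273653385578087, 674083045157270, 2304594804298342,
   431178404273814567359574461094, 592165809086221265038918439735, 358069011112487,
   2612910798351384222735954743, 5, 432857722462760818878571696134, 366438881851658181522765398023,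
   368132447871327432985381872662, 51102252822110416978092706207934388250903350,
   109869787401828799510726857527, 237759165879738228070671004315405921574803862,
   159298837299213922803034155732804276929777799, 161726142283077922219962195752146039639900982,
   974792986097202301871867761, 52178803819350432191425149621849089525649635214813279966007,
   78674865788710783379104467888561079802491703,
   59021983832965562478093177055649408976413705192955742265479,
   66750909592462443176017177615866037775803674704728576770967, 1430029265481734, 868783040514726,
   1554852303511558, 168061380844375916672792344754222710572466727, 842485029435151478816433153094,
   590678890223388300557635585095, 178682453849804970995248440870,
   188997633097480896587492790507991199897957447, 1980677086069559, 244983427354158059882208645943,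
   1673399625663528547139137543, 104125133423175083784682512390,
   51430005610740365692726068836586474023184878128056252409175, 363805874972109050874208191831,
   711683060872808, 237680430644580143278931400674319763591403383, 6, 414105629140194725984687719,
   821993812686258506684734577319, 52966823756664831336321767418687368509170759,
   254688460471169217792943021521255987461039050559031162743, 84921373320310583849408701511,
   841806571018064012462066320999, 648347422406717616435230119468340617901671,
   170337748633132603291193398311, 5, 842133421564548448971421614657, 2103523136638978,
   817776908633345378976551948854, 674146829766525405410867807576, 243952277482747443951096108386,
   842171908245736804481602108070, 478530625753614260741513152097,
   71698863350450490810899222257550239723657079, 171266897905379208486392907095,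
   25894023945071479614451355558888083260181736663335187778215, 406049259395900678351194690360,
   1769471102461809, 8811794749899646951864638304334968517927705,
   49528787166273644193586104037368709061282198, 574408459811492006101690353801, 10, 2450100668817,
   620399526615713, 2957892511143249, 99762447777420445969567799969, 637266152129873,
   739092792817627109535187118486, 124691539285491451998409720079058910444520214,
   13018594710304186384232437332517440585180502, 132160122023531344765886078192998558991768,
   70063487313687738292623351504843229156746262, 2844915999393965305805961894,
   439046137999337142606233808903, 1712284316699031, 1752452310140629056099480919,
   515125186783571436652299105622, 14199293058775608163990732594423468274768738091322497906279,
   30087152452436457448456463159, 1497687684842664, 166348444134124039330858206508940189073757255,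
   6, 589669466374484055247110616679, 555259730840049447457747309639,
   41614967088801995316904801067520357731344441993739858421351,
   67258672579948206857001556383527244201738247, 599535654717746490989521425207,
   560210833053712569298590471783, 247999380107435029057497559863,
   30165508875952374102601980432923731750434407, 841803090815258233073983583000,
   169346737486086201849377080665, 2326773221378511284228920118, 1004197751850873, 8,
   354212097492947846926132652441]

def cert11_22 : List ℕ :=
  [91245534178746837298102178705852599752661126, 575063315046761648650799224969,
   213606985456757565955982331590549827029005657, 253826714800247404411590688777,
   592510638136008285058607235894, 352259978925215446260139426614, 589723697009762461786546845801,
   5, 6, 590574809563713406985786007831, 462069901178465, 461964152492033,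
   443917596421978242656605917191, 591235096800935651020168066119, 8, 8205704119633,
   906152625479681, 7775024732289, 832593710114740204444855129766, 506732758915566052134235964214,
   505258799166919670832997543942, 6, 1147501605320289, 662423006820759, 1496750647115777,
   1488133529706503, 445668634104041347215954371927, 485281612621499764503216530775,
   591236148534012805755123688247, 6, 1831997990936577, 898598067795585, 355760822978152,
   844585891381939944110580983121, 208242412912905379136583579408018437278008391,
   824878120832093019084390900760, 46811659021974070431804910330958052312003268525944975487799,
   742865658992381019383388612728, 11359077476272144510654119368484324402353223,
   94864887400765111141537289288, 166233064821244463024540574913956995327485271, 10,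
   507439379356409353201571215718, 1442603953559416, 1, 1325088551638243335187566710,
   1498790578725238, 2376673035238056, 336788723851960719984325505090,
   254088740268459578319704589656, 345677346709633, 424019201039414717970044303894,
   253268227438157543964465431848, 2379425393582088, 348271135837258608588107653448,
   421406173385310299872407411368, 8, 487885259469359820181770078886, 1256342627637382,
   32682868014303667384644608825, 1150785627044182, 106315827845948456059390796566,
   506027369367326941852133906566, 6, 3216055340342590558860100407, 556342912227758482281457886007,
   170047583894427732358558909464, 166326023147548408673881367650043799850391079, 145434682266152,
   421295509225032989679090218535, 1590324426178872, 866700886364312, 6, 866552777303383,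
   287898470647845824461915099944, 174694723283985670945309275480, 174960913862711760490017938024,
   2257659334169128, 2257668401144903, 2, 1, 5, 2597206838771987, 2595191217283619,
   3000739953987859, 2621262434234916, 3, 842286652084164423740419277078, 2033317647097860,
   28055660555847770685075722788, 507594107832429678831988285814, 426296906261592449501947330566,
   843125593419682608218543175268, 591766243313347048764947719511, 3, 433894931522084,
   2304582624055844, 844005593728478863305868315300, 349787079960162618548985029157, 6,
   198155727543016430493518794755, 97371746748178418414450127127,
   181331510825664723435019045094250078347464707, 645684333558594677670784946996,
   47389622437915548452923273082590448450535971, 1900698296064290809987113239,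
   322863781611889379047540593523, 199650053232708158239255037540, 797900071112262114377344430359,
   143696480700476074245545166441990379840311, 2996664870895895, 576052199727973992415079535139,
   2551564982515032, 7, 599810173794979, 2676871512131605743402455320,
   284224063007524646806821184035, 254746390069555636752409567235, 6, 1009794360713219,
   20569091879217862828185711139, 84366877473870752379584277155, 339534246492365546390232064884,
   10, 824952025948885842417222298280, 424188426442117416135165415973, 601879805797495,
   422222681734170678649732898900, 3, 2702880422253092, 37955904068836055896893858692,
   265581964230209500550784906036, 309170897314885, 282252332850088237113616175925, 3, 6,
   1804930747340577, 714998507004724, 1776821821717153, 710698247355044,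
   844031291306573030705071600164, 2997368442200148, 3544557692497, 738889369670517,
   842438178050194338199265031845, 4, 96909110453313, 2698270391026481, 703701743704737,
   841804608184245631564211827781]

def cert11_23 : List ℕ :=
  [282263199546861464161969471605, 710922081450080532720119896844124098613797,
   55753933233947302787842125317632276136361990, 597175590747496314738531852823,
   265086180937894838516026704424, 841906977359708107684027827313, 636676449048586278828143352213,
   729166076167082336701557142327, 182636741808749148808171825797350068398391575,
   510217811696906359983150673927, 1, 758610973260254337090153166916,
   338364619091951161156782531653, 237158972916582465853661755855887310642094356,
   332547763381344031372823565927, 206315606572702875380622111348, 254498756796153705901389251109,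
   655946457928421408578038014295, 759499536107004862305959182345, 253340172535489747769937398436,
   287633021584206342293534278453, 1822098304180503, 1022704849682712, 2998791531991863,
   3665973959788298841876173108511504523141396, 1835334572705656, 282637573240299942167370486584,
   1009850159082151, 438005918789115651417003327768, 7, 168458087526897302543572927016,
   591778436866188090242328899592, 190484436513918541416328678139220262443773960,
   25090874039726544269781244834072998857285636, 207981733045517734977769971988, 2357371085084536,
   844101669436246215379559870743, 190352383086061300974825631005715286110905144,
   71742970706918899063367202742838063270564692, 94781598445915313382854344732105841676255508,
   2836012003305336, 592549442635074706058941509639, 802522909238980419731356872708,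
   902767906559816, 4, 2894260241306421, 842209279285790224976046010917, 113411103079077,
   355623470977573, 807781686023179897565469634565, 507624652242761827902468731430, 4,
   2297269022241861, 844666045561867131605727840933, 841806750645592821160194808213,
   118523839548934392616124651229058614308186517, 139842856906245227114741411957563638129534294,
   2692945204756485, 6129262961189, 354870018724193832818806917, 844668466344081127281423557429,
   27122771320672885202622304225849138859385925, 2638346625224005584404694358,
   141699853221727185418474042573489494543329957, 227281448382079624673625617455534629072220710,
   843444075107504430063046262901, 142167644560485949743440428940659461885998694,
   46772378192230954490957239094, 801814369554965953012072466057332129823126,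
   6869091496169969751758558472747887148228378143200727036726, 4, 424189266681140838855424180853,
   579367160537486656029873222998, 171328287157655905261024586407, 517246171274081295394994270760,
   27603529104154836516444738673, 809387094973267610387303727653, 675008753914065335095431472199,
   255828680260005526269751497801, 198074832940768842164296954137, 424034675291977755298692674949,
   203223417267715396390615339014, 121570641252389250941381054644769928035841093,
   46888195246689983691057448028749103301161782, 401105434470018416765938380805,
   95007032352605286179000850387464308852810278, 758437852544318742914429165734,
   15800946920167898034815555585335640188349180005719758619414,
   24584177124117474466307381108062932140464262, 589650671981613805325296817783,
   206195849071364781884514510440, 842901806927645806072728596615,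
   164471464171488972138416433175307348116650120, 454033060285748950472792612644577623409189,
   844739363548062811313420002376, 46824618935702342038739413851469355608785720, 5,
   663676184170149474831842876070, 242647608074545382432310644742, 446923555181521398741417854566,
   40121722150515467953609131015030960998640533577760797570662, 242839523519788083026259623942,
   423733671061618270630647718423, 45998506737708380748986763081545784234779495,
   94998478913544011869654804799182314165838647, 882421906536457306258091085636377398940742,
   79911384686429571817848255628061983718453254, 10, 4, 2629207214733989, 387382588879937,
   1180980871170725, 586291025121285, 758938999855758746373419394117, 7, 590748917080068,
   379951672075169, 759614641716502564808294537889, 342543661269540, 2611728810644276,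
   430815912842578811457297087140, 747717183397749739041363498872, 336886985595120268029902981796,
   4, 760133885189296278142644726433, 3406554309703, 1797907714413889,
   171514355834994810331742098501, 758742732932062084529665479479, 46544263619403698604559379109,
   603178547579559, 1815502360025767, 7, 1796684687702689, 2996406590119944,
   585627024141866030749347037732, 1583584912045672, 342121614711464, 7, 2428973006980980,
   2656434354940584, 871540168548356, 758939007566415472974095611012, 8,
   129548964247679660114395493716, 2626183701340953, 579361107045882102891657963652,
   347419918949775023873076779140, 6, 421891240209278220193592936857]

def cert11_24 : List ℕ :=
  [270407709080617631370732210323517194895913, 237214711566781660421770147960723643104071689,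
   1981747322196922674987819673, 525534878191073838895320023860, 844391169455675663805875388425,
   121554742633612152607175858058581191779899801, 2322525880751716, 1814758337822725,
   142276154567984736202825582682516101494090137, 252876227949559182877889008436,
   111569618302008422714503021095, 904211052458279, 1800464158363656, 4, 868919666189717,
   254523924407826133113605456695, 5, 1187915566256134, 1307007756606602695054618775,
   1753310630061398, 422875680429161814314452134566, 245780996093831403001060864551,
   1215111486940791, 1, 2, 3, 2997437024714756, 2615327211006004, 480331890692765578601676407060,
   5, 1008632303390723, 1495621314898595, 1029252762968163, 3290192623384144231576862995,
   515748685257371050914826854806, 842792135131241910546576335235, 262954060805230916667690713363,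
   10147503108643, 6971406762260, 2286990212547924, 283688195149965264732655976724, 3,
   125169912823238082181336809748, 842224811757881520060485865572, 30374508158115968477088399716,
   495969104462716972023247688773, 347100285478767901408754144054, 843772576609044513001356620838,
   408351424370688840042069693239, 406053135786784541595240761620, 122000294783060385698003042581,
   643875800655610916487643242773, 358792938387868371285529870885,
   20138775497932619522265507410025562821059219331064842698757, 2272961359398789955163140645, 9, 6,
   2315160263223162, 500217503242999738244509206915, 465721963316835, 10, 2348076784566552,
   2104569178460165, 889067211743239, 10, 2639137450141555, 758074477072209729545511635619,
   967918437829011, 169754517542449659514747240728, 3, 391987170087732,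
   1400321700164920564451027348, 9025379965606, 10, 1730747965526620551026645128, 11442723035477,
   95872940919464, 2990682724917526, 6902861863045, 117082169075537545229192883578612831859905877,
   35499014509586789597101266974168660819085896, 268827744388143678130071411092,
   590353624521051247378025849379, 590616630035064822225712095239, 125448077171058553432914791075,
   546951535990603722057992155922340413739893, 2416955265002149, 387059569801624,
   800583165153173687317925891, 6, 9009336822163, 308097063233939, 600817290696802593588378741139,
   2139728148170339, 86493279086327225027643120023, 748224011046561465509591142949,
   506212375177438985831383633923, 759927527715060537928192240023, 3, 10, 1788374774972968,
   2347938532974869, 142631226276567581518380399974937583534384742, 746810143477764,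
   1233789574984090, 7928854783318, 3, 204463817333354695343653622036,
   178751217400914821637771726854, 129782495678450091272117035860, 171324472446369956064766753172,
   745847670804486, 921777720001062, 2858959493925270, 735492444314542980972038587192, 10, 3,
   3715459729748, 2325031811112964, 1717574660610454, 1495373010183782,
   495342948299245587166241887845, 798284364823178963112560691606, 4718645032470]

/-- Guidance for `search` on eleven vertices. -/
def cert11 : List ℕ :=
  cert11_0 ++ cert11_1 ++ cert11_2 ++ cert11_3 ++ cert11_4 ++ cert11_5 ++ cert11_6 ++
  cert11_7 ++ cert11_8 ++ cert11_9 ++ cert11_10 ++ cert11_11 ++ cert11_12 ++ cert11_13 ++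
  cert11_14 ++ cert11_15 ++ cert11_16 ++ cert11_17 ++ cert11_18 ++ cert11_19 ++ cert11_20 ++
  cert11_21 ++ cert11_22 ++ cert11_23 ++ cert11_24

theorem search_eleven : (search 11 4 true 1 2047 diag cert11 [emptySt]).isEmpty = true := by
  decide +kernel

end SixSearch

namespace SixSearch

theorem deg_sup_edge (R : SimpleGraph ℕ) (i j k : ℕ) :
    deg (R ⊔ edge i j) k ≤ deg R k + 1 := by
  classical
  unfold deg
  refine (Finset.card_le_card (t := (Finset.range 11).filter (R.Adj k) ∪
    {if k = i then j else i}) fun x hx => ?_).trans ((Finset.card_union_le _ _).trans (by simp))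
  simp only [Finset.mem_filter, sup_adj, edge_adj, Finset.mem_union, Finset.mem_singleton] at hx ⊢
  rcases hx with ⟨hx, h | ⟨⟨rfl, rfl⟩ | ⟨rfl, rfl⟩, h⟩⟩
  · exact Or.inl ⟨hx, h⟩
  · simp
  · simp [h]

theorem deg_sup_edge_of_ne (R : SimpleGraph ℕ) {i j k : ℕ} (hi : k ≠ i) (hj : k ≠ j) :
    deg (R ⊔ edge i j) k = deg R k := by
  unfold deg
  congr 1
  ext x
  simp [edge_adj, hi, hj]

theorem deg_lt_deg_sup_edge {R : SimpleGraph ℕ} {i j : ℕ} (hj : j < 11) (hij : i ≠ j)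
    (h : ¬ R.Adj i j) : deg R i < deg (R ⊔ edge i j) i := by
  unfold deg
  refine Finset.card_lt_card (Finset.ssubset_iff_of_subset ?_ |>.2 ⟨j, ?_, ?_⟩)
  · intro x hx
    simp only [Finset.mem_filter] at hx ⊢
    exact ⟨hx.1, Or.inl hx.2⟩
  · simp [edge_adj, hij, hj]
  · simp [h]

theorem deg_mono {R R' : SimpleGraph ℕ} (h : R ≤ R') (i : ℕ) : deg R i ≤ deg R' i := by
  unfold deg
  refine Finset.card_le_card fun x hx => ?_
  simp only [Finset.mem_filter] at hx ⊢
  exact ⟨hx.1, h hx.2⟩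

/-- Every graph of bounded degree extends to one that is edge-maximal with this property. -/
theorem exists_admissible {n D : ℕ} (hn : n ≤ 11) : ∀ (m : ℕ) (R : SimpleGraph ℕ),
    (∀ i j, R.Adj i j → i < n) → (∀ i, deg R i ≤ D) →
    ∑ i ∈ Finset.range n, (D - deg R i) ≤ m → ∃ R', R ≤ R' ∧ Admissible n D true R' := by
  intro m
  induction m with
  | zero =>
    intro R hlt hdeg hm
    refine ⟨R, le_rfl, hlt, hdeg, fun _ i hi j _ _ _ => Or.inl ?_⟩
    have := Finset.single_le_sum (f := fun i => D - deg R i) (fun _ _ => Nat.zero_le _)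
      (Finset.mem_range.2 hi)
    omega
  | succ m ih =>
    intro R hlt hdeg hm
    by_cases hmax : ∀ i < n, ∀ j < n, i ≠ j → ¬R.Adj i j → D ≤ deg R i ∨ D ≤ deg R j
    · exact ⟨R, le_rfl, hlt, hdeg, fun _ => hmax⟩
    · push Not at hmax
      obtain ⟨i, hi, j, hj, hij, hadj, hdi, hdj⟩ := hmax
      obtain ⟨R', hR', h⟩ := ih (R ⊔ edge i j) (by
        intro a b hab
        simp only [sup_adj, edge_adj] at hab
        rcases hab with h | ⟨⟨rfl, rfl⟩ | ⟨rfl, rfl⟩, -⟩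
        · exact hlt a b h
        · exact hi
        · exact hj) (by
        intro k
        by_cases hki : k = i
        · have := deg_sup_edge R i j k
          subst hki; omega
        by_cases hkj : k = j
        · have := deg_sup_edge R i j k
          subst hkj; omega
        rw [deg_sup_edge_of_ne R hki hkj]
        exact hdeg k) (by
        have : ∑ k ∈ Finset.range n, (D - deg (R ⊔ edge i j) k) <
            ∑ k ∈ Finset.range n, (D - deg R k) := by
          refine Finset.sum_lt_sum (fun k _ => ?_) ⟨i, Finset.mem_range.2 hi, ?_⟩
          · have := deg_mono (le_sup_left : R ≤ R ⊔ edge i j) k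
            omega
          · have := deg_lt_deg_sup_edge (hj.trans_le hn) hij hadj
            omega
        omega)
      exact ⟨R', le_sup_left.trans hR', h⟩

/-- `φ` identifies the graph induced on `F` with the graph on `n` vertices whose complement has
adjacency matrix `E`. -/
structure Realizes {V : Type*} (G : SimpleGraph V) (F : Finset V) (n E : ℕ) (φ : ℕ → V) :
    Prop where
  inj : ∀ i < n, ∀ j < n, φ i = φ j → i = j
  mem : ∀ v, v ∈ F ↔ ∃ i < n, φ i = v
  adj : ∀ i < n, ∀ j < n, G.Adj (φ i) (φ j) ↔ i ≠ j ∧ bit E i j = false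

section transfer

variable {V : Type*} [DecidableEq V] {G : SimpleGraph V} {F : Finset V} {n E : ℕ} {φ : ℕ → V}

/-- The complement of the graph that `G` induces on `φ 0, …, φ (n - 1)`. -/
def coGraph (G : SimpleGraph V) (n : ℕ) (φ : ℕ → V) : SimpleGraph ℕ where
  Adj i j := i < n ∧ j < n ∧ i ≠ j ∧ ¬ G.Adj (φ i) (φ j)
  symm := ⟨fun _ _ h => ⟨h.2.1, h.1, h.2.2.1.symm, fun h' => h.2.2.2 h'.symm⟩⟩
  loopless := ⟨fun _ h => h.2.2.1 rfl⟩

theorem deg_coGraph_le (hn : F.card = n) (hinj : ∀ i < n, ∀ j < n, φ i = φ j → i = j)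
    (hmem : ∀ v, v ∈ F ↔ ∃ i < n, φ i = v) {D : ℕ} (hD : n ≤ D + 7)
    (hdeg : ∀ x ∈ F, ∃ N ⊆ F, 6 ≤ N.card ∧ ∀ y ∈ N, G.Adj x y) (i : ℕ) :
    deg (coGraph G n φ) i ≤ D := by
  classical
  unfold deg
  by_cases hi : i < n
  · have hiF : φ i ∈ F := (hmem _).2 ⟨i, hi, rfl⟩
    obtain ⟨N, hNF, hN, hadj⟩ := hdeg (φ i) hiF
    have hiN : φ i ∉ N := fun h => (hadj _ h).ne rfl
    have hsub : ((Finset.range 11).filter ((coGraph G n φ).Adj i)).image φ ⊆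
        F \ insert (φ i) N := by
      intro v hv
      obtain ⟨j, hj, rfl⟩ := Finset.mem_image.1 hv
      obtain ⟨-, -, hjn, hij, hnadj⟩ := Finset.mem_filter.1 hj
      simp only [Finset.mem_sdiff, Finset.mem_insert, not_or]
      exact ⟨(hmem _).2 ⟨j, hjn, rfl⟩, fun h => hij (hinj _ hi _ hjn h.symm),
        fun h => hnadj (hadj _ h)⟩
    have hcard := Finset.card_le_card hsub
    rw [Finset.card_sdiff_of_subset (Finset.insert_subset hiF hNF),
      Finset.card_insert_of_notMem hiN, Finset.card_image_of_injOn] at hcard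
    · omega
    · intro a ha b hb
      exact hinj a (Finset.mem_filter.1 ha).2.2.1 b (Finset.mem_filter.1 hb).2.2.1
  · rw [Finset.filter_false_of_mem fun x _ h => hi h.1]
    simp

theorem kModel_of_resolved {R : SimpleGraph ℕ} (hR : coGraph G n φ ≤ R)
    (hinj : ∀ i < n, ∀ j < n, φ i = φ j → i = j) (hmem : ∀ v, v ∈ F ↔ ∃ i < n, φ i = v)
    (h : Resolved R n E) : (∃ x ∈ F, G.KModel 6 (F.erase x)) ∨
      ∃ σ, Preserves n σ ∧ HasMatrix (R.comap σ) n E := by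
  obtain ⟨σ, hσ, ⟨l, hl, hbags, x, hx, hxl⟩ | h⟩ := h
  · have hinj' : ∀ i < n, ∀ j < n, φ (σ i) = φ (σ j) → i = j := fun i hi j hj h =>
      σ.injective (hinj _ ((hσ i).2 hi) _ ((hσ j).2 hj) h)
    refine Or.inl ⟨φ (σ x), (hmem _).2 ⟨_, (hσ x).2 hx, rfl⟩, ?_⟩
    rw [← hl]
    refine kModel_of_bags (φ := φ ∘ σ) hbags hinj' (fun i hi j hj hij h => ?_) fun p hp => ?_
    · by_contra hadj
      exact h (hR ⟨(hσ i).2 hi, (hσ j).2 hj, fun h => hij (σ.injective h), hadj⟩)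
    · obtain ⟨h1, h2, -⟩ := hbags.1 p hp
      obtain ⟨h3, h4⟩ := hxl p hp
      simp only [Function.comp_apply, Finset.mem_erase]
      exact ⟨⟨fun h => h3 (hinj' _ h1 _ hx h), (hmem _).2 ⟨_, (hσ _).2 h1, rfl⟩⟩,
        fun h => h4 (hinj' _ h2 _ hx h), (hmem _).2 ⟨_, (hσ _).2 h2, rfl⟩⟩
  · exact Or.inr ⟨σ, hσ, h⟩

/-- The complement of the perfect matching on eight vertices. -/
abbrev fourPairs : ℕ := 9680851866906509338216450

/-- The disjoint union of three triangles. -/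
abbrev threeTriangles : ℕ := 59469507253547130808243857414

/-- The Petersen graph. -/
abbrev petersen : ℕ := 65964917098430996810070086486030

/-- A graph on `8` to `11` vertices with minimum degree at least `6` has, up to three exceptions,
a complete minor on `6` vertices that avoids some vertex. -/
theorem kModel_six_or_realizes (h8 : 8 ≤ F.card) (h11 : F.card ≤ 11)
    (hdeg : ∀ x ∈ F, ∃ N ⊆ F, 6 ≤ N.card ∧ ∀ y ∈ N, G.Adj x y) :
    (∃ x ∈ F, G.KModel 6 (F.erase x)) ∨ ∃ φ : ℕ → V, Realizes G F 8 fourPairs φ ∨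
      Realizes G F 9 threeTriangles φ ∨ Realizes G F 10 petersen φ := by
  obtain ⟨n, hn⟩ : ∃ n, F.card = n := ⟨_, rfl⟩
  obtain ⟨v₀, hv₀⟩ : F.Nonempty := Finset.card_pos.1 (by omega)
  obtain ⟨φ, hinj, hmem⟩ : ∃ φ : ℕ → V, (∀ i < n, ∀ j < n, φ i = φ j → i = j) ∧
      ∀ v, v ∈ F ↔ ∃ i < n, φ i = v := by
    refine ⟨fun i => if h : i < n then (F.equivFinOfCardEq hn).symm ⟨i, h⟩ else v₀,
      fun i hi j hj h => ?_, fun v => ⟨fun hv => ?_, ?_⟩⟩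
    · simp only [hi, hj, dif_pos] at h
      simpa using (F.equivFinOfCardEq hn).symm.injective (Subtype.ext h)
    · exact ⟨F.equivFinOfCardEq hn ⟨v, hv⟩, Fin.is_lt _, by simp⟩
    · rintro ⟨i, hi, rfl⟩
      simp only [hi, dif_pos, Finset.coe_mem]
  have hlt : ∀ i j, (coGraph G n φ).Adj i j → i < n := fun i j h => h.1
  have hreal : ∀ {E σ}, Preserves n σ → HasMatrix ((coGraph G n φ).comap σ) n E →
      Realizes G F n E (φ ∘ σ) := by
    intro E σ hσ hE
    refine ⟨fun i hi j hj h => σ.injective (hinj _ ((hσ i).2 hi) _ ((hσ j).2 hj) h),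
      fun v => (hmem v).trans ⟨?_, ?_⟩, fun i hi j hj => ?_⟩
    · rintro ⟨i, hi, rfl⟩
      exact ⟨σ.symm i, (hσ _).1 (by simpa using hi), by simp⟩
    · rintro ⟨i, hi, rfl⟩
      exact ⟨σ i, (hσ i).2 hi, rfl⟩
    · have := hE i hi j hj
      have h1 := (hσ i).2 hi
      have h2 := (hσ j).2 hj
      simp only [comap_adj, coGraph, h1, h2, true_and, ne_eq, EmbeddingLike.apply_eq_iff_eq] at this
      rw [Bool.eq_false_iff, Function.comp_apply, Function.comp_apply]
      have : G.Adj (φ (σ i)) (φ (σ j)) → i ≠ j := by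
        rintro h rfl
        exact h.ne rfl
      tauto
  have hsmall : ∀ {D E cs}, n ≤ D + 7 →
      (search n D false E (2 ^ n - 1) diag cs [emptySt]).isEmpty = true →
      (∃ x ∈ F, G.KModel 6 (F.erase x)) ∨ ∃ φ : ℕ → V, Realizes G F n E φ := by
    intro D E cs hD hs
    rcases kModel_of_resolved le_rfl hinj hmem (resolved_of_search (by omega) hs
      ⟨hlt, deg_coGraph_le hn hinj hmem hD hdeg, by simp⟩) with h | ⟨σ, hσ, h⟩
    · exact Or.inl h
    · exact Or.inr ⟨_, hreal hσ h⟩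
  obtain rfl | rfl | rfl | rfl : n = 8 ∨ n = 9 ∨ n = 10 ∨ n = 11 := by omega
  · exact (hsmall (by norm_num) search_eight).imp_right fun ⟨φ, h⟩ => ⟨φ, Or.inl h⟩
  · exact (hsmall (by norm_num) search_nine).imp_right fun ⟨φ, h⟩ => ⟨φ, Or.inr (Or.inl h)⟩
  · exact (hsmall (by norm_num) search_ten).imp_right fun ⟨φ, h⟩ => ⟨φ, Or.inr (Or.inr h)⟩
  · obtain ⟨R, hR, hadm⟩ := exists_admissible le_rfl _ (coGraph G 11 φ) hlt
      (deg_coGraph_le hn hinj hmem (le_refl (4 + 7)) hdeg) le_rfl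
    refine (kModel_of_resolved hR hinj hmem (resolved_of_search le_rfl search_eleven hadm)).imp_right
      fun ⟨σ, _, h⟩ => ?_
    have := (h 0 (by norm_num) 0 (by norm_num)).2 (by decide)
    exact absurd this (SimpleGraph.irrefl _)

end transfer

end SixSearch

namespace SixSearch

/-- Adjacency in the complement of `E` with the pairs in `e` added. -/
def Plus (E : ℕ) (e : List (ℕ × ℕ)) (i j : ℕ) : Prop :=
  bit E i j = false ∨ (i, j) ∈ e ∨ (j, i) ∈ e

instance (E : ℕ) (e : List (ℕ × ℕ)) (i j : ℕ) : Decidable (Plus E e i j) :=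
  inferInstanceAs (Decidable (_ ∨ _ ∨ _))

instance (E : ℕ) (e : List (ℕ × ℕ)) (n : ℕ) (l : List (ℕ × ℕ)) :
    Decidable (Bags (Plus E e) n l) :=
  inferInstanceAs (Decidable (_ ∧ _))

/-- The vertex `b` is distinct from and nonadjacent to all members of `l`. -/
def Apart (E : ℕ) (l : List ℕ) (b : ℕ) : Prop := ∀ a ∈ l, a ≠ b ∧ bit E a b = false

instance (E : ℕ) (l : List ℕ) (b : ℕ) : Decidable (Apart E l b) :=
  inferInstanceAs (Decidable (∀ a ∈ l, a ≠ b ∧ bit E a b = false))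

/-- No `k` pairwise nonadjacent vertices are apart from `l`. -/
def NoIndep (n E : ℕ) : ℕ → List ℕ → Prop
  | 0, _ => False
  | k + 1, l => ∀ b < n, Apart E l b → NoIndep n E k (b :: l)

instance NoIndep.decide (n E : ℕ) : ∀ k l, Decidable (NoIndep n E k l)
  | 0, _ => inferInstanceAs (Decidable False)
  | k + 1, l =>
    have := NoIndep.decide n E k
    inferInstanceAs (Decidable (∀ b < n, Apart E l b → NoIndep n E k (b :: l)))

theorem NoIndep.card_lt {n E : ℕ} : ∀ {k : ℕ} {l : List ℕ}, NoIndep n E k l → ∀ T : Finset ℕ,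
    (∀ b ∈ T, b < n ∧ Apart E l b) → (∀ a ∈ T, ∀ b ∈ T, a ≠ b → bit E a b = false) → T.card < k := by
  intro k
  induction k with
  | zero => exact fun h => h.elim
  | succ k ih =>
    intro l h T hT hT'
    rcases T.eq_empty_or_nonempty with rfl | ⟨b, hb⟩
    · simp
    have := ih (h b (hT b hb).1 (hT b hb).2) (T.erase b) (fun a ha => ⟨(hT a (Finset.mem_of_mem_erase ha)).1, fun c hc => ?_⟩) fun a ha c hc =>
        hT' a (Finset.mem_of_mem_erase ha) c (Finset.mem_of_mem_erase hc)
    · rw [Finset.card_erase_of_mem hb] at this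
      omega
    · rcases List.mem_cons.1 hc with rfl | hc
      · exact ⟨(Finset.ne_of_mem_erase ha).symm,
          hT' _ hb _ (Finset.mem_of_mem_erase ha) (Finset.ne_of_mem_erase ha).symm⟩
      · exact (hT a (Finset.mem_of_mem_erase ha)).2 c hc

/-- Two nonadjacent vertices of `E` have at most `c` common nonneighbours. -/
def CommonLE (n E c : ℕ) : Prop :=
  ∀ i < n, ∀ j < n, i ≠ j → bit E i j = false →
    ((Finset.range n).filter fun k => (i ≠ k ∧ bit E i k = false) ∧ j ≠ k ∧ bit E j k = false).card ≤ c

/-- A model with six bags that avoids `x` in the complement of `E` with the edge `e` added. -/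
def SixEntry (n E : ℕ) (e : ℕ × ℕ) (x : ℕ) (l : List (ℕ × ℕ)) : Prop :=
  l.length = 6 ∧ Bags (Plus E [e]) n l ∧ x < n ∧ ∀ p ∈ l, p.1 ≠ x ∧ p.2 ≠ x

instance (n E : ℕ) (e : ℕ × ℕ) (x : ℕ) (l : List (ℕ × ℕ)) : Decidable (SixEntry n E e x l) :=
  inferInstanceAs (Decidable (_ ∧ _))

/-- The pair `e` consists of `i` and `j`. -/
def Joins (e : ℕ × ℕ) (i j : ℕ) : Prop := e = (i, j) ∨ e = (j, i)

instance (e : ℕ × ℕ) (i j : ℕ) : Decidable (Joins e i j) :=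
  inferInstanceAs (Decidable (_ ∨ _))

/-- Every edge of `E` occurs in a table of models with six bags. -/
structure SixTable (n E : ℕ) (tab : List ((ℕ × ℕ) × ℕ × List (ℕ × ℕ))) : Prop where
  bags : ∀ t ∈ tab, SixEntry n E t.1 t.2.1 t.2.2
  edge : ∀ i < n, ∀ j < n, bit E i j = true → ∃ t ∈ tab, Joins t.1 i j

/-- The pair `e` consists of two distinct vertices adjacent in `E`. -/
def IsPair (n E : ℕ) (e : ℕ × ℕ) : Prop :=
  e.1 < n ∧ e.2 < n ∧ e.1 ≠ e.2 ∧ bit E e.1 e.2 = true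

instance (n E : ℕ) (e : ℕ × ℕ) : Decidable (IsPair n E e) :=
  inferInstanceAs (Decidable (_ ∧ _))

/-- Neither end of `e` is adjacent to `i`. -/
def Off (E : ℕ) (e : ℕ × ℕ) (i : ℕ) : Prop := bit E i e.1 = false ∧ bit E i e.2 = false

instance (E : ℕ) (e : ℕ × ℕ) (i : ℕ) : Decidable (Off E e i) :=
  inferInstanceAs (Decidable (_ ∧ _))

/-- A model with seven bags in the complement of `E` with the edges `e` and `f` added. -/
def SevenEntry (n E : ℕ) (e f : ℕ × ℕ) (l : List (ℕ × ℕ)) : Prop :=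
  IsPair n E e ∧ IsPair n E f ∧ l.length = 7 ∧ Bags (Plus E [e, f]) n l

instance (n E : ℕ) (e f : ℕ × ℕ) (l : List (ℕ × ℕ)) : Decidable (SevenEntry n E e f l) :=
  inferInstanceAs (Decidable (_ ∧ _))

/-- A table of models with seven bags, each using two edges of `E`. -/
structure SevenTable (n E : ℕ) (tab : List ((ℕ × ℕ) × (ℕ × ℕ) × List (ℕ × ℕ))) : Prop where
  bags : ∀ t ∈ tab, SevenEntry n E t.1 t.2.1 t.2.2
  edge : ∀ i < n, ∀ j < n, bit E i j = true → ∃ t ∈ tab,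
    Joins t.1 i j ∨ Joins t.2.1 i j
  pair : ∀ i < n, ∀ j < n, ∃ t ∈ tab, (Off E t.1 j ∧ Off E t.2.1 i) ∨ (Off E t.1 i ∧ Off E t.2.1 j)

def fourPairsSix : List ((ℕ × ℕ) × ℕ × List (ℕ × ℕ)) :=
  [((0, 1), 2, [(0, 0), (1, 1), (3, 3), (4, 4), (6, 6), (7, 5)]),
   ((2, 3), 0, [(1, 1), (2, 2), (3, 3), (4, 4), (6, 6), (7, 5)]),
   ((4, 5), 0, [(1, 1), (2, 2), (4, 4), (5, 5), (6, 6), (7, 3)]),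
   ((6, 7), 0, [(1, 1), (2, 2), (4, 4), (6, 6), (7, 7), (5, 3)])]

def fourPairsSeven : List ((ℕ × ℕ) × (ℕ × ℕ) × List (ℕ × ℕ)) :=
  [((0, 1), (2, 3), [(0, 0), (1, 1), (2, 2), (3, 3), (4, 4), (6, 6), (7, 5)]),
   ((4, 5), (6, 7), [(0, 0), (2, 2), (4, 4), (5, 5), (6, 6), (7, 7), (3, 1)])]

def threeTrianglesSix : List ((ℕ × ℕ) × ℕ × List (ℕ × ℕ)) :=
  [((0, 1), 2, [(0, 0), (1, 1), (3, 3), (6, 6), (7, 4), (8, 5)]),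
   ((0, 2), 1, [(0, 0), (2, 2), (3, 3), (6, 6), (7, 4), (8, 5)]),
   ((1, 2), 0, [(1, 1), (2, 2), (3, 3), (6, 6), (7, 4), (8, 5)]),
   ((3, 4), 0, [(1, 1), (3, 3), (4, 4), (6, 6), (7, 2), (8, 5)]),
   ((3, 5), 0, [(1, 1), (3, 3), (5, 5), (6, 6), (7, 2), (8, 4)]),
   ((4, 5), 0, [(1, 1), (4, 4), (5, 5), (6, 6), (7, 2), (8, 3)]),
   ((6, 7), 0, [(1, 1), (3, 3), (6, 6), (7, 7), (4, 2), (8, 5)]),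
   ((6, 8), 0, [(1, 1), (3, 3), (6, 6), (8, 8), (4, 2), (7, 5)]),
   ((7, 8), 0, [(1, 1), (3, 3), (7, 7), (8, 8), (4, 2), (6, 5)])]

def threeTrianglesSeven : List ((ℕ × ℕ) × (ℕ × ℕ) × List (ℕ × ℕ)) :=
  [((0, 1), (3, 4), [(0, 0), (1, 1), (3, 3), (4, 4), (6, 6), (7, 2), (8, 5)]),
   ((0, 2), (6, 7), [(0, 0), (2, 2), (3, 3), (6, 6), (7, 7), (4, 1), (8, 5)]),
   ((3, 5), (6, 8), [(0, 0), (3, 3), (5, 5), (6, 6), (8, 8), (4, 1), (7, 2)]),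
   ((1, 2), (4, 5), [(1, 1), (2, 2), (4, 4), (5, 5), (6, 6), (7, 0), (8, 3)]),
   ((0, 1), (7, 8), [(0, 0), (1, 1), (3, 3), (7, 7), (8, 8), (4, 2), (6, 5)])]

def petersenSix : List ((ℕ × ℕ) × ℕ × List (ℕ × ℕ)) :=
  [((0, 1), 2, [(0, 0), (1, 1), (6, 6), (7, 7), (4, 3), (9, 8)]),
   ((0, 2), 1, [(0, 0), (2, 2), (4, 4), (5, 5), (6, 3), (9, 8)]),
   ((0, 3), 1, [(0, 0), (3, 3), (4, 4), (5, 5), (7, 6), (8, 2)]),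
   ((1, 4), 0, [(1, 1), (2, 2), (3, 3), (4, 4), (6, 5), (9, 7)]),
   ((1, 5), 0, [(1, 1), (2, 2), (3, 3), (5, 5), (7, 4), (8, 6)]),
   ((2, 6), 0, [(1, 1), (2, 2), (3, 3), (6, 6), (7, 4), (8, 5)]),
   ((2, 7), 0, [(1, 1), (2, 2), (3, 3), (7, 7), (6, 5), (9, 4)]),
   ((3, 8), 0, [(1, 1), (2, 2), (3, 3), (8, 8), (6, 5), (9, 4)]),
   ((3, 9), 0, [(1, 1), (2, 2), (3, 3), (9, 9), (7, 4), (8, 5)]),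
   ((4, 6), 0, [(1, 1), (2, 2), (3, 3), (6, 4), (8, 5), (9, 7)]),
   ((4, 8), 0, [(1, 1), (2, 2), (3, 3), (6, 5), (8, 4), (9, 7)]),
   ((5, 7), 0, [(1, 1), (2, 2), (3, 3), (7, 5), (8, 6), (9, 4)]),
   ((5, 9), 0, [(1, 1), (2, 2), (3, 3), (7, 4), (8, 6), (9, 5)]),
   ((6, 9), 0, [(1, 1), (2, 2), (3, 3), (7, 4), (8, 5), (9, 6)]),
   ((7, 8), 0, [(1, 1), (2, 2), (3, 3), (6, 5), (8, 7), (9, 4)])]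

def petersenSeven : List ((ℕ × ℕ) × (ℕ × ℕ) × List (ℕ × ℕ)) :=
  [((0, 1), (2, 6), [(0, 0), (1, 1), (6, 6), (7, 7), (4, 2), (5, 3), (9, 8)]),
   ((3, 9), (4, 8), [(0, 0), (4, 4), (8, 8), (9, 9), (5, 2), (6, 3), (7, 1)]),
   ((0, 2), (5, 7), [(0, 0), (2, 2), (4, 4), (5, 5), (6, 3), (7, 1), (9, 8)]),
   ((5, 7), (6, 9), [(0, 0), (5, 5), (6, 6), (7, 7), (4, 3), (8, 1), (9, 2)]),
   ((0, 1), (3, 8), [(0, 0), (1, 1), (6, 6), (8, 8), (4, 3), (5, 2), (9, 7)]),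
   ((1, 5), (2, 7), [(1, 1), (2, 2), (3, 3), (5, 5), (7, 0), (8, 6), (9, 4)]),
   ((0, 3), (1, 4), [(0, 0), (3, 3), (4, 4), (5, 5), (7, 6), (8, 1), (9, 2)]),
   ((0, 2), (4, 6), [(0, 0), (2, 2), (4, 4), (5, 5), (6, 1), (7, 3), (9, 8)]),
   ((0, 2), (7, 8), [(0, 0), (2, 2), (5, 5), (8, 8), (6, 1), (7, 3), (9, 4)]),
   ((0, 1), (5, 9), [(0, 0), (1, 1), (7, 7), (9, 9), (4, 2), (5, 3), (8, 6)]),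
   ((2, 6), (3, 9), [(1, 1), (2, 2), (3, 3), (6, 6), (7, 4), (8, 5), (9, 0)])]

theorem fourPairs_noIndep : NoIndep 8 fourPairs 5 [] := by
  decide +kernel

theorem fourPairs_commonLE : CommonLE 8 fourPairs 4 := by
  unfold CommonLE
  decide +kernel

theorem fourPairs_sixTable : SixTable 8 fourPairs fourPairsSix := by
  constructor <;> decide +kernel

theorem fourPairs_sevenTable : SevenTable 8 fourPairs fourPairsSeven := by
  constructor <;> decide +kernel

theorem threeTriangles_noIndep : NoIndep 9 threeTriangles 5 [] := by
  decide +kernel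

theorem threeTriangles_commonLE : CommonLE 9 threeTriangles 3 := by
  unfold CommonLE
  decide +kernel

theorem threeTriangles_sixTable : SixTable 9 threeTriangles threeTrianglesSix := by
  constructor <;> decide +kernel

theorem threeTriangles_sevenTable : SevenTable 9 threeTriangles threeTrianglesSeven := by
  constructor <;> decide +kernel

theorem petersen_noIndep : NoIndep 10 petersen 5 [] := by
  decide +kernel

theorem petersen_commonLE : CommonLE 10 petersen 3 := by
  unfold CommonLE
  decide +kernel

theorem petersen_sixTable : SixTable 10 petersen petersenSix := by
  constructor <;> decide +kernel

theorem petersen_sevenTable : SevenTable 10 petersen petersenSeven := by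
  constructor <;> decide +kernel

end SixSearch

open SixSearch

namespace SimpleGraph

variable {V : Type*} {G : SimpleGraph V} {F : Finset V} {n E : ℕ} {φ : ℕ → V}

theorem adj_sup_edge {H : SimpleGraph V} {v w : V} (h : v ≠ w) : (H ⊔ edge v w).Adj v w :=
  Or.inr ((edge_adj ..).2 ⟨Or.inl ⟨rfl, rfl⟩, h⟩)

theorem _root_.SixSearch.Realizes.exists_eq (h : Realizes G F n E φ) {v : V} (hv : v ∈ F) : ∃ i < n, φ i = v := (h.mem v).1 hv

theorem _root_.SixSearch.Realizes.bit_eq_true (h : Realizes G F n E φ) {i j : ℕ} (hi : i < n) (hj : j < n) (hne : φ i ≠ φ j)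
    (hadj : ¬ G.Adj (φ i) (φ j)) : bit E i j = true := by
  rw [h.adj i hi j hj, not_and, Bool.not_eq_false] at hadj
  exact hadj fun h => hne (by rw [h])

theorem _root_.SixSearch.Realizes.of_isPair (h : Realizes G F n E φ) {e : ℕ × ℕ} (he : IsPair n E e) : φ e.1 ∈ F ∧ φ e.2 ∈ F ∧
    φ e.1 ≠ φ e.2 ∧ ¬ G.Adj (φ e.1) (φ e.2) := by
  obtain ⟨h1, h2, hne, hb⟩ := he
  refine ⟨(h.mem _).2 ⟨_, h1, rfl⟩, (h.mem _).2 ⟨_, h2, rfl⟩, fun h' => hne (h.inj _ h1 _ h2 h'), ?_⟩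
  rw [h.adj _ h1 _ h2, hb]
  simp

theorem _root_.SixSearch.Realizes.adj_of_bit (h : Realizes G F n E φ) {i j : ℕ} (hi : i < n) (hj : j < n) (hb : bit E i j = false) :
    φ i = φ j ∨ G.Adj (φ i) (φ j) := by
  rw [h.adj _ hi _ hj]
  by_cases hij : i = j
  · exact Or.inl (by rw [hij])
  · exact Or.inr ⟨hij, hb⟩

section

variable [Fintype V]

open Classical in
/-- The set of neighbours of `x`. -/
noncomputable def nb (G : SimpleGraph V) (x : V) : Finset V := Finset.univ.filter (G.Adj x)

@[simp] theorem mem_nb {x y : V} : y ∈ G.nb x ↔ G.Adj x y := by simp [nb]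

end

variable [DecidableEq V]

theorem _root_.SixSearch.Realizes.card_le_four (h : Realizes G F n E φ) (hE : NoIndep n E 5 []) {T : Finset V} (hT : T ⊆ F)
    (hc : G.IsClique T) : T.card ≤ 4 := by
  have := hE.card_lt ((Finset.range n).filter fun i => φ i ∈ T) (fun b hb => ⟨?_, ?_⟩) ?_
  · have himg : T ⊆ ((Finset.range n).filter fun i => φ i ∈ T).image φ := by
      intro v hv
      obtain ⟨i, hi, rfl⟩ := h.exists_eq (hT hv)
      exact Finset.mem_image.2 ⟨i, by simp [hi, hv], rfl⟩
    have := (Finset.card_le_card himg).trans Finset.card_image_le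
    omega
  · simpa using (Finset.mem_filter.1 hb).1
  · simp [Apart]
  · intro a ha b hb hab
    simp only [Finset.mem_filter, Finset.mem_range] at ha hb
    exact ((h.adj a ha.1 b hb.1).1 (hc ha.2 hb.2 fun h' => hab (h.inj a ha.1 b hb.1 h'))).2

theorem _root_.SixSearch.Realizes.kModel (h : Realizes G F n E φ) {e : List (ℕ × ℕ)} {l : List (ℕ × ℕ)} {A : Finset V} {H : SimpleGraph V}
    (hl : Bags (Plus E e) n l) (hGH : G ≤ H)
    (he : ∀ p ∈ e, p.1 < n → p.2 < n → p.1 ≠ p.2 → H.Adj (φ p.1) (φ p.2))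
    (hA : ∀ p ∈ l, φ p.1 ∈ A ∧ φ p.2 ∈ A) : H.KModel l.length A := by
  refine kModel_of_bags hl h.inj (fun i hi j hj hij hr => ?_) hA
  rcases hr with hr | hr | hr
  · exact hGH ((h.adj i hi j hj).2 ⟨hij, hr⟩)
  · exact he _ hr hi hj hij
  · exact (he _ hr hj hi hij.symm).symm

variable [Fintype V]

/-- The properties that the three exceptional graphs of minimum degree at least six on at most
eleven vertices have in common. -/
structure Exceptional (G : SimpleGraph V) (F : Finset V) : Prop where
  card_le_four : ∀ T ⊆ F, G.IsClique T → T.card ≤ 4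
  six : ∀ a ∈ F, ∀ b ∈ F, a ≠ b → ¬ G.Adj a b →
    ∃ x ∈ F, (G ⊔ edge a b).KModel 6 (F.erase x)
  seven : ∀ a ∈ F, ∀ b ∈ F, a ≠ b → ¬ G.Adj a b → ∃ c ∈ F, ∃ d ∈ F, c ≠ d ∧ ¬ G.Adj c d ∧
    (G ⊔ edge a b ⊔ edge c d).KModel 7 F
  seven_nb : ∀ a ∈ F, ∀ b ∈ F, ∃ c ∈ F, ∃ d ∈ F, ∃ p ∈ F, ∃ q ∈ F, c ≠ d ∧ ¬ G.Adj c d ∧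
    p ≠ q ∧ ¬ G.Adj p q ∧ (a = c ∨ G.Adj a c) ∧ (a = d ∨ G.Adj a d) ∧ (b = p ∨ G.Adj b p) ∧
    (b = q ∨ G.Adj b q) ∧ (G ⊔ edge c d ⊔ edge p q).KModel 7 F
  common_le_four : ∀ a ∈ F, ∀ b ∈ F, G.Adj a b → (G.nb a ∩ G.nb b ∩ F).card ≤ 4
  common_le_three : (∀ a ∈ F, ∀ b ∈ F, G.Adj a b → (G.nb a ∩ G.nb b ∩ F).card ≤ 3) ∨
    ∃ φ, Realizes G F 8 fourPairs φ

theorem _root_.SixSearch.Realizes.common_le (h : Realizes G F n E φ) {c : ℕ} (hE : CommonLE n E c) {a b : V} (ha : a ∈ F) (hb : b ∈ F)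
    (hab : G.Adj a b) : (G.nb a ∩ G.nb b ∩ F).card ≤ c := by
  obtain ⟨i, hi, rfl⟩ := h.exists_eq ha
  obtain ⟨j, hj, rfl⟩ := h.exists_eq hb
  rw [h.adj i hi j hj] at hab
  refine le_trans ?_ (hE i hi j hj hab.1 hab.2)
  refine le_trans (Finset.card_le_card fun v hv => ?_) (Finset.card_image_le (f := φ))
  simp only [Finset.mem_inter, mem_nb] at hv
  obtain ⟨k, hk, rfl⟩ := h.exists_eq hv.2
  rw [h.adj i hi k hk, h.adj j hj k hk] at hv
  exact Finset.mem_image.2 ⟨k, by simp [hk, hv.1], rfl⟩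

theorem _root_.SixSearch.Realizes.exceptional (h : Realizes G F n E φ) {c : ℕ} (h1 : NoIndep n E 5 []) (h2 : CommonLE n E c)
    {tab₁ : List ((ℕ × ℕ) × ℕ × List (ℕ × ℕ))} (h3 : SixTable n E tab₁)
    {tab₂ : List ((ℕ × ℕ) × (ℕ × ℕ) × List (ℕ × ℕ))} (h4 : SevenTable n E tab₂)
    (hc : c ≤ 3 ∨ c = 4 ∧ n = 8 ∧ E = fourPairs) : G.Exceptional F := by
  have hmem : ∀ {e l}, Bags (Plus E e) n l → ∀ p ∈ l, φ p.1 ∈ F ∧ φ p.2 ∈ F := fun hl p hp =>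
    ⟨(h.mem _).2 ⟨_, (hl.1 p hp).1, rfl⟩, (h.mem _).2 ⟨_, (hl.1 p hp).2.1, rfl⟩⟩
  have hseven : ∀ {e f l}, SevenEntry n E e f l →
      (G ⊔ edge (φ e.1) (φ e.2) ⊔ edge (φ f.1) (φ f.2)).KModel 7 F := by
    rintro e f l ⟨he, hf, hl, hb⟩
    rw [← hl]
    refine h.kModel hb (le_sup_left.trans le_sup_left) (fun p hp _ _ _ => ?_) (hmem hb)
    simp only [List.mem_cons, List.not_mem_nil, or_false] at hp
    rcases hp with rfl | rfl
    · exact Or.inl (adj_sup_edge (h.of_isPair he).2.2.1)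
    · exact adj_sup_edge (h.of_isPair hf).2.2.1
  refine ⟨fun T hT => h.card_le_four h1 hT, ?_, ?_, ?_, ?_, ?_⟩
  · intro a ha b hb hne hadj
    obtain ⟨i, hi, rfl⟩ := h.exists_eq ha
    obtain ⟨j, hj, rfl⟩ := h.exists_eq hb
    obtain ⟨⟨e, x, l⟩, ht, he⟩ := h3.edge i hi j hj (h.bit_eq_true hi hj hne hadj)
    obtain ⟨hl, hb, hx, hxl⟩ := h3.bags _ ht
    simp only at hl hb hx hxl he
    refine ⟨φ x, (h.mem _).2 ⟨x, hx, rfl⟩, ?_⟩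
    rw [← hl]
    refine h.kModel hb le_sup_left (fun p hp _ _ _ => ?_) fun p hp => ?_
    · obtain rfl := List.mem_singleton.1 hp
      rcases he with rfl | rfl
      · exact adj_sup_edge hne
      · exact (adj_sup_edge hne).symm
    · have h1 := hb.1 p hp
      have h2 := hmem hb p hp
      simp only [Finset.mem_erase]
      exact ⟨⟨fun h' => (hxl p hp).1 (h.inj _ h1.1 _ hx h'), h2.1⟩,
        fun h' => (hxl p hp).2 (h.inj _ h1.2.1 _ hx h'), h2.2⟩
  · intro a ha b hb hne hadj
    obtain ⟨i, hi, rfl⟩ := h.exists_eq ha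
    obtain ⟨j, hj, rfl⟩ := h.exists_eq hb
    obtain ⟨⟨e, f, l⟩, ht, he⟩ := h4.edge i hi j hj (h.bit_eq_true hi hj hne hadj)
    have hs := h4.bags _ ht
    have hm := hseven hs
    simp only at he hs hm
    obtain ⟨f1, f2, f3, f4⟩ := h.of_isPair hs.2.1
    obtain ⟨e1, e2, e3, e4⟩ := h.of_isPair hs.1
    rcases he with (rfl | rfl) | (rfl | rfl)
    · exact ⟨_, f1, _, f2, f3, f4, hm⟩
    · exact ⟨_, f1, _, f2, f3, f4, by rwa [edge_comm (φ i)]⟩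
    · exact ⟨_, e1, _, e2, e3, e4, by rwa [sup_right_comm]⟩
    · exact ⟨_, e1, _, e2, e3, e4, by rwa [sup_right_comm, edge_comm (φ i)]⟩
  · intro a ha b hb
    obtain ⟨i, hi, rfl⟩ := h.exists_eq ha
    obtain ⟨j, hj, rfl⟩ := h.exists_eq hb
    obtain ⟨⟨e, f, l⟩, ht, he⟩ := h4.pair i hi j hj
    have hs := h4.bags _ ht
    have hm := hseven hs
    simp only at he hs hm
    obtain ⟨f1, f2, f3, f4⟩ := h.of_isPair hs.2.1
    obtain ⟨e1, e2, e3, e4⟩ := h.of_isPair hs.1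
    have key : ∀ {k e}, k < n → IsPair n E e → Off E e k →
        (φ k = φ e.1 ∨ G.Adj (φ k) (φ e.1)) ∧ (φ k = φ e.2 ∨ G.Adj (φ k) (φ e.2)) :=
      fun hk he ho => ⟨h.adj_of_bit hk he.1 ho.1, h.adj_of_bit hk he.2.1 ho.2⟩
    rcases he with ⟨h1, h2⟩ | ⟨h1, h2⟩
    · obtain ⟨a1, a2⟩ := key hj hs.1 h1
      obtain ⟨b1, b2⟩ := key hi hs.2.1 h2
      exact ⟨_, f1, _, f2, _, e1, _, e2, f3, f4, e3, e4, b1, b2, a1, a2, by rwa [sup_right_comm]⟩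
    · obtain ⟨a1, a2⟩ := key hi hs.1 h1
      obtain ⟨b1, b2⟩ := key hj hs.2.1 h2
      exact ⟨_, e1, _, e2, _, f1, _, f2, e3, e4, f3, f4, a1, a2, b1, b2, hm⟩
  · intro a ha b hb hab
    have := h.common_le h2 ha hb hab
    omega
  · rcases hc with hc | ⟨rfl, rfl, rfl⟩
    · exact Or.inl fun a ha b hb hab => (h.common_le h2 ha hb hab).trans hc
    · exact Or.inr ⟨φ, h⟩

/-- A graph on `8` to `11` vertices with minimum degree at least `6` has a complete minor on `6`
vertices that avoids some vertex, or is exceptional. -/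
theorem kModel_six_or_exceptional (h8 : 8 ≤ F.card) (h11 : F.card ≤ 11)
    (hdeg : ∀ x ∈ F, 6 ≤ (G.nb x ∩ F).card) :
    (∃ x ∈ F, G.KModel 6 (F.erase x)) ∨ G.Exceptional F := by
  refine (kModel_six_or_realizes h8 h11 fun x hx => ⟨G.nb x ∩ F, Finset.inter_subset_right,
    hdeg x hx, fun y hy => ?_⟩).imp_right ?_
  · simpa using (Finset.mem_inter.1 hy).1
  · rintro ⟨φ, h | h | h⟩
    · exact h.exceptional fourPairs_noIndep fourPairs_commonLE fourPairs_sixTable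
        fourPairs_sevenTable (Or.inr ⟨rfl, rfl, rfl⟩)
    · exact h.exceptional threeTriangles_noIndep threeTriangles_commonLE threeTriangles_sixTable
        threeTriangles_sevenTable (Or.inl le_rfl)
    · exact h.exceptional petersen_noIndep petersen_commonLE petersen_sixTable
        petersen_sevenTable (Or.inl le_rfl)

end SimpleGraph

namespace SimpleGraph

variable {V : Type*} [Fintype V] [DecidableEq V] {G H : SimpleGraph V} {S T B : Finset V}

/-- The number of ordered pairs `(x, y)` of adjacent vertices with `x ∈ S` and `y ∈ T`. -/
noncomputable def ed (G : SimpleGraph V) (S T : Finset V) : ℕ := ∑ x ∈ S, (G.nb x ∩ T).card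

theorem ed_union_left (h : Disjoint S T) : G.ed (S ∪ T) B = G.ed S B + G.ed T B :=
  Finset.sum_union h

theorem ed_union_right (h : Disjoint S T) : G.ed B (S ∪ T) = G.ed B S + G.ed B T := by
  unfold ed
  rw [← Finset.sum_add_distrib]
  refine Finset.sum_congr rfl fun x _ => ?_
  rw [Finset.inter_union_distrib_left, Finset.card_union_of_disjoint]
  exact Finset.disjoint_of_subset_left Finset.inter_subset_right
    (Finset.disjoint_of_subset_right Finset.inter_subset_right h)

theorem ed_comm (S T : Finset V) : G.ed S T = G.ed T S := by
  have := Finset.sum_card_bipartiteAbove_eq_sum_card_bipartiteBelow (s := S) (t := T)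
    (r := fun x y => y ∈ G.nb x)
  unfold ed
  convert this using 2 with x hx x hx
  · congr 1
    ext y
    simp [Finset.bipartiteAbove, and_comm]
  · congr 1
    ext y
    simp [Finset.bipartiteBelow, and_comm, adj_comm]

theorem le_ed {c : ℕ} (h : ∀ x ∈ S, c ≤ (G.nb x ∩ T).card) : c * S.card ≤ G.ed S T := by
  rw [mul_comm, ← smul_eq_mul]
  exact Finset.card_nsmul_le_sum S _ c h

/-- The vertices outside `K` with a neighbour in `K`. -/
noncomputable def bdry (G : SimpleGraph V) (K : Finset V) : Finset V := K.biUnion G.nb \ K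

@[simp] theorem mem_bdry {K : Finset V} {v : V} : v ∈ G.bdry K ↔ (∃ x ∈ K, G.Adj x v) ∧ v ∉ K := by
  simp [bdry]

theorem nb_subset {K : Finset V} {x : V} (hx : x ∈ K) : G.nb x ⊆ K ∪ G.bdry K := by
  intro y hy
  by_cases hyK : y ∈ K
  · exact Finset.mem_union_left _ hyK
  · exact Finset.mem_union_right _ (mem_bdry.2 ⟨⟨x, hx, mem_nb.1 hy⟩, hyK⟩)

theorem bdry_subset {K L : Finset V} (h : L ⊆ K) : G.bdry L ⊆ K ∪ G.bdry K := by
  intro y hy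
  obtain ⟨⟨x, hx, hxy⟩, -⟩ := mem_bdry.1 hy
  exact nb_subset (h hx) (mem_nb.2 hxy)

/-- A graph without `K₈`-minor in which every edge that meets `K` lies in at least six triangles,
while `r` represents the part of the graph that is separated from `K` by its boundary. -/
structure Rooted (G : SimpleGraph V) (K : Finset V) (r : V) : Prop where
  nonempty : K.Nonempty
  root_notMem : r ∉ K
  root_adj : ∀ s ∈ G.bdry K, G.Adj r s
  root_notMem_bdry : r ∉ G.bdry K
  card_bdry : (G.bdry K).card ≤ 7
  exists_adj : ∀ x ∈ K, ∃ y, G.Adj x y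
  common : ∀ x ∈ K, ∀ y, G.Adj x y → 6 ≤ (G.nb x ∩ G.nb y).card
  no_model : ¬ G.KModel 8 (insert r (K ∪ G.bdry K))
  sparse : ∀ B ⊆ K ∪ G.bdry K, 5 ≤ B.card → G.ed B B + 38 ≤ 12 * B.card

namespace Rooted

variable {K L : Finset V} {r ρ w : V} (h : G.Rooted K r)
include h

theorem seven_le_degree {x : V} (hx : x ∈ K) : 7 ≤ (G.nb x).card := by
  obtain ⟨y, hy⟩ := h.exists_adj x hx
  have h6 := h.common x hx y hy
  have : insert y (G.nb x ∩ G.nb y) ⊆ G.nb x :=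
    Finset.insert_subset (mem_nb.2 hy) Finset.inter_subset_left
  have := Finset.card_le_card this
  rw [Finset.card_insert_of_notMem (by simp)] at this
  omega

theorem bdry_subset_of_root (hL : L ⊆ K) (hLr : G.bdry L ⊆ G.nb r) : G.bdry L ⊆ G.bdry K := by
  intro s hs
  refine (Finset.mem_union.1 (bdry_subset hL hs)).resolve_left fun hsK => ?_
  exact h.root_notMem_bdry (mem_bdry.2 ⟨⟨s, hsK, (mem_nb.1 (hLr hs)).symm⟩, h.root_notMem⟩)

theorem exists_degree_le_of_root (hL : L ⊆ K) (hne : L.Nonempty) (hLr : G.bdry L ⊆ G.nb r) :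
    ∃ w ∈ L, (G.nb w).card ≤ 11 := by
  by_contra! hdeg
  have hs : (G.bdry L).card ≤ 7 :=
    (Finset.card_le_card (h.bdry_subset_of_root hL hLr)).trans h.card_bdry
  have hdis : Disjoint L (G.bdry L) := by
    rw [Finset.disjoint_left]
    exact fun x hx hx' => (mem_bdry.1 hx').2 hx
  have h1 : 12 * L.card ≤ G.ed L (L ∪ G.bdry L) := le_ed fun x hx => by
    rw [Finset.inter_eq_left.2 (nb_subset hx)]
    exact hdeg x hx
  have h2 : 7 * (G.bdry L).card ≤ G.ed (G.bdry L) (L ∪ G.bdry L) := le_ed fun y hy => by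
    obtain ⟨⟨x, hx, hxy⟩, -⟩ := mem_bdry.1 hy
    have h6 := h.common x (hL hx) y hxy
    have : insert x (G.nb x ∩ G.nb y) ⊆ G.nb y ∩ (L ∪ G.bdry L) := by
      refine Finset.insert_subset (by simp [hx, hxy.symm]) fun z hz => ?_
      rw [Finset.mem_inter] at hz ⊢
      exact ⟨hz.2, nb_subset hx hz.1⟩
    have := Finset.card_le_card this
    rw [Finset.card_insert_of_notMem (by simp)] at this
    omega
  obtain ⟨x, hx⟩ := hne
  have h3 := (hdeg x hx).le.trans (Finset.card_le_card (nb_subset hx))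
  have h4 := h.sparse (L ∪ G.bdry L) (Finset.union_subset (hL.trans Finset.subset_union_left)
    (bdry_subset hL)) (by omega)
  rw [ed_union_left hdis, Finset.card_union_of_disjoint hdis] at h4
  omega

theorem exists_degree_le_of_mem (hL : L ⊆ K) (hne : L.Nonempty) (hρ : ρ ∈ K)
    (hρd : (G.nb ρ).card ≤ 11) (hρL : ρ ∉ L) (hLρ : G.bdry L ⊆ G.nb ρ) :
    ∃ w ∈ L, (G.nb w).card ≤ 11 := by
  by_contra! hdeg
  have hs : (G.bdry L).card ≤ 11 := (Finset.card_le_card hLρ).trans hρd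
  have hdis : Disjoint L (G.bdry L) := by
    rw [Finset.disjoint_left]
    exact fun x hx hx' => (mem_bdry.1 hx').2 hx
  have hρS : ρ ∉ G.bdry L := fun h' => (mem_nb.1 (hLρ h')).ne rfl
  have hdis' : Disjoint (L ∪ G.bdry L) {ρ} := by simp [hρL, hρS]
  have h1 : 12 * L.card ≤ G.ed L (L ∪ G.bdry L) := le_ed fun x hx => by
    rw [Finset.inter_eq_left.2 (nb_subset hx)]
    exact hdeg x hx
  have h2 : ((G.bdry L).card - 5) * (G.bdry L).card ≤ G.ed (G.bdry L) (G.bdry L) :=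
    le_ed fun y hy => by
      have h6 := h.common ρ hρ y (mem_nb.1 (hLρ hy))
      have : (G.nb ρ ∩ G.nb y) ⊆ (G.nb y ∩ G.bdry L) ∪ (G.nb ρ \ G.bdry L) := by
        intro z hz
        simp only [Finset.mem_inter, Finset.mem_union, Finset.mem_sdiff] at hz ⊢
        tauto
      have := (Finset.card_le_card this).trans (Finset.card_union_le _ _)
      rw [Finset.card_sdiff_of_subset hLρ] at this
      omega
  have h3 : 1 * (G.bdry L).card ≤ G.ed (G.bdry L) {ρ} := le_ed fun y hy => by
    rw [Nat.one_le_iff_ne_zero, Finset.card_ne_zero]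
    exact ⟨ρ, by simpa using (mem_nb.1 (hLρ hy)).symm⟩
  have h3' := ed_comm (G := G) (G.bdry L) {ρ}
  have hLS := ed_comm (G := G) (G.bdry L) L
  obtain ⟨x, hx⟩ := hne
  have h4 := (hdeg x hx).le.trans (Finset.card_le_card (nb_subset hx))
  have hcard : ((L ∪ G.bdry L) ∪ {ρ}).card = L.card + (G.bdry L).card + 1 := by
    rw [Finset.card_union_of_disjoint hdis', Finset.card_union_of_disjoint hdis,
      Finset.card_singleton]
  rw [Finset.card_union_of_disjoint hdis] at h4
  have h5 := h.sparse ((L ∪ G.bdry L) ∪ {ρ}) (Finset.union_subset (Finset.union_subset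
    (hL.trans Finset.subset_union_left) (bdry_subset hL)) (by simp [hρ])) (by omega)
  rw [hcard, ed_union_left hdis', ed_union_left hdis, ed_union_right hdis', ed_union_right hdis',
    ed_union_right hdis', ed_union_right hdis, ed_union_right hdis, ed_union_right hdis] at h5
  rw [ed_union_right hdis] at h1
  by_cases hk : 5 ≤ L.card
  · have h6 := h.sparse L (hL.trans Finset.subset_union_left) hk
    generalize (G.bdry L).card = s at *
    interval_cases s <;> omega
  · have h6 : ∀ x ∈ L, 13 - L.card ≤ (G.nb x ∩ G.bdry L).card := fun x hx => by
      have h7 := hdeg x hx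
      have : G.nb x ⊆ (G.nb x ∩ G.bdry L) ∪ L.erase x := by
        intro z hz
        rcases Finset.mem_union.1 (nb_subset hx hz) with hzL | hzS
        · exact Finset.mem_union_right _ (Finset.mem_erase.2 ⟨(mem_nb.1 hz).ne', hzL⟩)
        · exact Finset.mem_union_left _ (Finset.mem_inter.2 ⟨hz, hzS⟩)
      have := (Finset.card_le_card this).trans (Finset.card_union_le _ _)
      rw [Finset.card_erase_of_mem hx] at this
      have := Finset.card_pos.2 ⟨x, hx⟩
      omega
    have h7 := le_ed h6
    have h8 := (h6 x hx).trans (Finset.card_le_card Finset.inter_subset_right)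
    have h9 : 1 ≤ L.card := Finset.card_pos.2 ⟨x, hx⟩
    generalize (G.bdry L).card = s at *
    generalize L.card = k at *
    have hk' : k ≤ 4 := by omega
    interval_cases k <;> interval_cases s <;> omega

end Rooted

end SimpleGraph

namespace SimpleGraph

variable {V : Type*} [DecidableEq V] {G : SimpleGraph V} {A F : Finset V}

theorem Conn.insert {S : Finset V} {a : V} (hS : G.Conn S) (h : G.Touch S {a}) :
    G.Conn (insert a S) := by
  rw [Finset.insert_eq, Finset.union_comm]
  exact hS.union (conn_singleton G a) h

/-- An additional edge `ab` can be replaced by a connected set with neighbours `a` and `b`. -/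
theorem KModel.absorb {t : ℕ} {a b : V} {O : Finset V} (h : (G ⊔ edge a b).KModel t A)
    (hO : G.Conn O) (hdis : Disjoint O A) (ha : G.Touch O {a}) (hb : G.Touch O {b}) :
    G.KModel t (A ∪ O) := by
  rw [Finset.disjoint_left] at hdis
  refine h.lift (g := fun x => if x = a then insert a O else {x}) (fun x hx => ?_)
    (fun x hx y hy hxy => ?_) (fun x hx y hy hxy => ?_)
  · split_ifs with hxa
    · subst hxa
      exact ⟨hO.insert ha, Finset.insert_subset (Finset.mem_union_left _ hx)
        Finset.subset_union_right⟩
    · exact ⟨conn_singleton G x, by simp [hx]⟩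
  · rw [Finset.disjoint_left]
    intro z hzx hzy
    split_ifs at hzx hzy with h1 h2 h2
    · exact hxy (h1.trans h2.symm)
    · rw [Finset.mem_singleton.1 hzy] at hzx
      rcases Finset.mem_insert.1 hzx with h3 | h3
      · exact h2 h3
      · exact hdis h3 hy
    · rw [Finset.mem_singleton.1 hzx] at hzy
      rcases Finset.mem_insert.1 hzy with h3 | h3
      · exact h1 h3
      · exact hdis h3 hx
    · exact hxy ((Finset.mem_singleton.1 hzx).symm.trans (Finset.mem_singleton.1 hzy))
  · have hmem : ∀ z, z ∈ (if z = a then insert a O else {z} : Finset V) := by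
      intro z
      split_ifs with h
      · simp [h]
      · simp
    rcases hxy with hxy | hxy
    · exact ⟨x, hmem x, y, hmem y, hxy⟩
    · rw [edge_adj] at hxy
      have key : G.Touch (if a = a then Insert.insert a O else {a}) (if b = a then Insert.insert a O else {b}) := by
        rw [if_pos rfl]
        exact hb.mono (Finset.subset_insert _ _) (by simpa using hmem b)
      rcases hxy.1 with ⟨rfl, rfl⟩ | ⟨rfl, rfl⟩
      · exact key
      · exact key.symm

variable [Fintype V]

/-- A vertex `w` of `K` of small degree together with a component `U` of the graph that is left
after deleting the closed neighbourhood of `w`, such that `U` is adjacent to many neighbours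
of `w`. -/
structure Center (G : SimpleGraph V) (K : Finset V) (r w : V) (U : Finset V) : Prop where
  mem : w ∈ K
  card_le : (G.nb w).card ≤ 11
  isComp : G.IsComp (insert r (K ∪ G.bdry K) \ insert w (G.nb w)) U
  touch : ∀ y ∈ G.nb w, (∃ z ∈ G.nb w, z ≠ y ∧ ¬ G.Adj y z) → ∃ u ∈ U, G.Adj y u
  common : ∀ a ∈ G.nb w, ∀ b ∈ G.nb w, G.Adj a b → (G.nb a ∩ G.nb b ∩ G.nb w).card ≤ 4 →
    ∃ u ∈ U, G.Adj a u ∧ G.Adj b u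

variable {K U : Finset V} {r w : V}

theorem Rooted.exists_center (h : G.Rooted K r) : ∃ w U, G.Center K r w U := by
  classical
  obtain ⟨⟨ρ, L⟩, hρL, hmin⟩ := Finset.exists_min_image
    ((Finset.univ : Finset (V × Finset V)).filter fun p => p.2.Nonempty ∧ p.2 ⊆ K ∧ p.1 ∉ p.2 ∧
      G.bdry p.2 ⊆ G.nb p.1 ∧ (p.1 = r ∨ p.1 ∈ K ∧ (G.nb p.1).card ≤ 11)) (fun p => p.2.card)
    ⟨(r, K), by simpa using ⟨h.nonempty, h.root_notMem, fun s hs => mem_nb.2 (h.root_adj s hs)⟩⟩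
  simp only [Finset.mem_filter, Finset.mem_univ, true_and, Prod.forall] at hρL hmin
  obtain ⟨hne, hLK, hρ, hb, hρK⟩ := hρL
  obtain ⟨w, hw, hwmin⟩ := Finset.exists_min_image L (fun x => (G.nb x).card) hne
  have hw11 : (G.nb w).card ≤ 11 := by
    have : ∃ v ∈ L, (G.nb v).card ≤ 11 := by
      rcases hρK with rfl | hρK
      · exact h.exists_degree_le_of_root hLK hne hb
      · exact h.exists_degree_le_of_mem hLK hne hρK.1 hρK.2 hρ hb
    obtain ⟨v, hv, hv11⟩ := this
    exact (hwmin v hv).trans hv11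
  have hρw : ρ ∉ insert w (G.nb w) := by
    simp only [Finset.mem_insert, mem_nb, not_or]
    refine ⟨fun h' => hρ (h' ▸ hw), fun hwρ => ?_⟩
    exact (mem_nb.1 (hb (mem_bdry.2 ⟨⟨w, hw, hwρ⟩, hρ⟩))).ne rfl
  have hρA : ρ ∈ insert r (K ∪ G.bdry K) := by
    rcases hρK with rfl | hρK
    · simp
    · simp [hρK.1]
  obtain ⟨U, hU, hρU⟩ := exists_isComp_of_mem (G := G) (Finset.mem_sdiff.2 ⟨hρA, hρw⟩)
  have hLA : L ∪ G.bdry L ⊆ insert r (K ∪ G.bdry K) :=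
    (Finset.union_subset (hLK.trans Finset.subset_union_left) (bdry_subset hLK)).trans
      (Finset.subset_insert _ _)
  have hmemU : ∀ u ∈ U, ∀ x ∈ L ∪ G.bdry L, x ∉ insert w (G.nb w) → G.Adj u x → x ∈ U := by
    intro u hu x hx hxw hux
    by_contra hxU
    exact hU.not_adj u hu x (Finset.mem_sdiff.2 ⟨hLA hx, hxw⟩) hxU hux
  have hbU : ∀ x ∈ G.bdry L, x ∉ insert w (G.nb w) → x ∈ U := fun x hx hxw =>
    hmemU ρ hρU x (Finset.mem_union_right _ hx) hxw (mem_nb.1 (hb hx))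
  have hLU : ∀ x ∈ L, x ∉ insert w (G.nb w) → x ∈ U := by
    by_contra! hex
    obtain ⟨x, hx, hxw, hxU⟩ := hex
    have := hmin w (L.filter fun x => x ∉ insert w (G.nb w) ∧ x ∉ U)
      ⟨⟨x, Finset.mem_filter.2 ⟨hx, hxw, hxU⟩⟩, (Finset.filter_subset _ _).trans hLK, by simp,
        fun s hs => ?_, Or.inr ⟨hLK hw, hw11⟩⟩
    · have hlt : (L.filter fun x => x ∉ insert w (G.nb w) ∧ x ∉ U) ⊂ L :=
        Finset.filter_ssubset.2 ⟨w, hw, by simp⟩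
      exact absurd (Finset.card_lt_card hlt) (not_lt.2 this)
    · obtain ⟨⟨y, hy, hys⟩, hsM⟩ := mem_bdry.1 hs
      obtain ⟨hyL, hyw, hyU⟩ := Finset.mem_filter.1 hy
      by_contra hsw
      have hsw' : s ∉ insert w (G.nb w) := by
        rw [Finset.mem_insert, not_or]
        refine ⟨?_, hsw⟩
        rintro rfl
        exact hyw (Finset.mem_insert_of_mem (mem_nb.2 hys.symm))
      have hsU : s ∈ U := by
        rcases Finset.mem_union.1 (nb_subset hyL (mem_nb.2 hys)) with hsL | hsb
        · by_contra hsU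
          exact hsM (Finset.mem_filter.2 ⟨hsL, hsw', hsU⟩)
        · exact hbU s hsb hsw'
      exact hyU (hmemU s hsU y (Finset.mem_union_left _ hyL) hyw hys.symm)
  have hallU : ∀ x ∈ L ∪ G.bdry L, x ∉ insert w (G.nb w) → x ∈ U := fun x hx hxw =>
    (Finset.mem_union.1 hx).elim (fun hx => hLU x hx hxw) fun hx => hbU x hx hxw
  refine ⟨w, U, hLK hw, hw11, hU, ?_, ?_⟩
  · rintro y hy ⟨z, hz, hzy, hyz⟩
    rcases Finset.mem_union.1 (nb_subset hw hy) with hyL | hyb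
    · by_contra! hno
      have hsub : G.nb y ⊆ ((insert w (G.nb w)).erase y).erase z := by
        intro u hu
        rw [Finset.mem_erase, Finset.mem_erase]
        refine ⟨?_, ((mem_nb.1 hu).ne'), ?_⟩
        · rintro rfl
          exact hyz (mem_nb.1 hu)
        · by_contra huw
          exact hno u (hallU u (nb_subset hyL hu) huw) (mem_nb.1 hu)
      have hcard := Finset.card_le_card hsub
      rw [Finset.card_erase_of_mem (by simp [hzy, mem_nb.1 hz]),
        Finset.card_erase_of_mem (by simp [mem_nb.1 hy]),
        Finset.card_insert_of_notMem (by simp)] at hcard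
      have h1 := hwmin y hyL
      have h2 := Finset.card_pos.2 ⟨z, hz⟩
      omega
    · exact ⟨ρ, hρU, (mem_nb.1 (hb hyb)).symm⟩
  · have key : ∀ a ∈ G.nb w, ∀ b ∈ G.nb w, a ∈ L → G.Adj a b →
        (G.nb a ∩ G.nb b ∩ G.nb w).card ≤ 4 → ∃ u ∈ U, G.Adj a u ∧ G.Adj b u := by
      intro a ha b hb haL hab hc
      by_contra! hno
      have hsub : G.nb a ∩ G.nb b ⊆ insert w (G.nb a ∩ G.nb b ∩ G.nb w) := by
        intro u hu
        by_contra hu'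
        have huw : u ∉ insert w (G.nb w) := by
          simp only [Finset.mem_insert, Finset.mem_inter, not_or, not_and] at hu hu' ⊢
          exact ⟨hu'.1, hu'.2 hu⟩
        simp only [Finset.mem_inter] at hu
        exact hno u (hallU u (nb_subset haL hu.1) huw) (mem_nb.1 hu.1) (mem_nb.1 hu.2)
      have h6 := h.common a (hLK haL) b hab
      have := (Finset.card_le_card hsub).trans (Finset.card_insert_le _ _)
      omega
    intro a ha b hb' hab hc
    rcases Finset.mem_union.1 (nb_subset hw ha) with haL | hab'
    · exact key a ha b hb' haL hab hc
    rcases Finset.mem_union.1 (nb_subset hw hb') with hbL | hbb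
    · rw [Finset.inter_comm (G.nb a)] at hc
      obtain ⟨u, hu, h1, h2⟩ := key b hb' a ha hbL hab.symm hc
      exact ⟨u, hu, h2, h1⟩
    · exact ⟨ρ, hρU, (mem_nb.1 (hb hab')).symm, (mem_nb.1 (hb hbb)).symm⟩

namespace Center

variable (h : G.Rooted K r) (hc : G.Center K r w U)
include h hc

omit h in
theorem subset : insert w (G.nb w) ⊆ insert r (K ∪ G.bdry K) :=
  (Finset.insert_subset (Finset.mem_union_left _ hc.mem) (nb_subset hc.mem)).trans
    (Finset.subset_insert _ _)

omit h in
theorem subset' : U ⊆ insert r (K ∪ G.bdry K) := hc.isComp.subset.trans Finset.sdiff_subset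

omit h in
theorem disjoint : Disjoint U (insert w (G.nb w)) :=
  Finset.disjoint_of_subset_left hc.isComp.subset Finset.sdiff_disjoint

theorem six_le {x : V} (hx : x ∈ G.nb w) : 6 ≤ (G.nb x ∩ G.nb w).card := by
  rw [Finset.inter_comm]
  exact h.common w hc.mem x (mem_nb.1 hx)

theorem eight_le : 8 ≤ (G.nb w).card := by
  have h7 := h.seven_le_degree hc.mem
  by_contra! hlt
  refine h.no_model ((kModel_of_isClique (A := insert w (G.nb w)) ?_ ?_).mono hc.subset)
  · have key : ∀ x ∈ G.nb w, ∀ y ∈ G.nb w, x ≠ y → G.Adj x y := by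
      intro x hx y hy hxy
      by_contra hno
      have hsub : G.nb x ∩ G.nb w ⊆ ((G.nb w).erase x).erase y := by
        intro u hu
        simp only [Finset.mem_inter, mem_nb, Finset.mem_erase] at hu ⊢
        refine ⟨?_, hu.1.ne', hu.2⟩
        rintro rfl
        exact hno hu.1
      have := (hc.six_le h hx).trans (Finset.card_le_card hsub)
      rw [Finset.card_erase_of_mem (by simp [hxy.symm, mem_nb.1 hy]),
        Finset.card_erase_of_mem hx] at this
      omega
    intro x hx y hy hxy
    rcases Finset.mem_insert.1 hx with rfl | hx <;> rcases Finset.mem_insert.1 hy with rfl | hy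
    · exact absurd rfl hxy
    · exact mem_nb.1 hy
    · exact (mem_nb.1 hx).symm
    · exact key x hx y hy hxy
  · rw [Finset.card_insert_of_notMem (by simp)]
    omega

theorem exceptional : G.Exceptional (G.nb w) := by
  rcases kModel_six_or_exceptional (hc.eight_le h) hc.card_le (fun x hx => hc.six_le h hx) with
    ⟨x, hx, hm⟩ | he
  · exfalso
    have hxw : G.Adj w x := mem_nb.1 hx
    have hm7 := hm.cone (conn_singleton G w) (by simp) (fun y hy => ⟨w, by simp, y, by simp,
      mem_nb.1 (Finset.mem_of_mem_erase hy)⟩)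
    have hsub : {w} ∪ (G.nb w).erase x ⊆ insert r (K ∪ G.bdry K) :=
      (Finset.union_subset (by simp) ((Finset.erase_subset _ _).trans
        (Finset.subset_insert _ _))).trans hc.subset
    have hxA : {x} ⊆ insert r (K ∪ G.bdry K) :=
      Finset.singleton_subset_iff.2 (hc.subset (Finset.mem_insert_of_mem hx))
    have hdis : Disjoint {x} ({w} ∪ (G.nb w).erase x) := by simp [hxw.ne']
    by_cases hdom : ∀ y ∈ (G.nb w).erase x, G.Adj x y
    · refine h.no_model ((hm7.cone (conn_singleton G x) hdis fun y hy => ?_).mono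
        (Finset.union_subset hxA hsub))
      rcases Finset.mem_union.1 hy with hy | hy
      · exact ⟨x, by simp, y, by simp, by rw [Finset.mem_singleton.1 hy]; exact hxw.symm⟩
      · exact ⟨x, by simp, y, by simp, hdom y hy⟩
    · push Not at hdom
      obtain ⟨z, hz, hxz⟩ := hdom
      rw [Finset.mem_erase] at hz
      obtain ⟨u, hu, hxu⟩ := hc.touch x hx ⟨z, hz.2, hz.1, hxz⟩
      have hdisU : Disjoint U ({w} ∪ (G.nb w).erase x) :=
        Finset.disjoint_of_subset_right (Finset.union_subset (by simp)
          ((Finset.erase_subset _ _).trans (Finset.subset_insert _ _))) hc.disjoint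
      refine h.no_model ((hm7.cone ((conn_singleton G x).union hc.isComp.conn
        ⟨x, by simp, u, hu, hxu⟩) (Finset.disjoint_union_left.2 ⟨hdis, hdisU⟩) fun y hy => ?_).mono
        (Finset.union_subset (Finset.union_subset hxA hc.subset') hsub))
      by_cases hxy : G.Adj x y
      · exact ⟨x, by simp, y, by simp, hxy⟩
      rcases Finset.mem_union.1 hy with hy | hy
      · rw [Finset.mem_singleton.1 hy] at hxy
        exact absurd hxw.symm hxy
      · rw [Finset.mem_erase] at hy
        obtain ⟨v, hv, hyv⟩ := hc.touch y hy.2 ⟨x, hx, hy.1.symm, fun h' => hxy h'.symm⟩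
        exact ⟨v, by simp [hv], y, by simp, hyv.symm⟩
  · exact he

/-- Two disjoint connected subsets of `U` cannot play the role of two additional edges which
create a `K₇`-minor in the neighbourhood of `w`. -/
theorem not_kModel_seven {a b c d : V} {X Y : Finset V}
    (hm : (G ⊔ edge a b ⊔ edge c d).KModel 7 (G.nb w)) (hX : G.Conn X) (hY : G.Conn Y)
    (hXU : X ⊆ U) (hYU : Y ⊆ U) (hXY : Disjoint X Y) (ha : G.Touch X {a}) (hb : G.Touch X {b})
    (hc' : G.Touch Y {c}) (hd : G.Touch Y {d}) : False := by
  have hle : G ≤ G ⊔ edge a b := le_sup_left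
  have touch_mono : ∀ {S T : Finset V}, G.Touch S T → (G ⊔ edge a b).Touch S T :=
    fun ⟨x, hx, y, hy, hxy⟩ => ⟨x, hx, y, hy, hle hxy⟩
  have hdis : ∀ S ⊆ U, Disjoint S ({w} ∪ G.nb w) := fun S hS =>
    Finset.disjoint_of_subset_left hS hc.disjoint
  have h8 := hm.cone (conn_singleton _ w) (by simp) (fun y hy => ⟨w, by simp, y, by simp,
    Or.inl (Or.inl (mem_nb.1 hy))⟩)
  have h8' := h8.absorb (hY.mono fun x _ y _ hxy => hle hxy) (hdis Y hYU) (touch_mono hc')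
    (touch_mono hd)
  refine h.no_model ((h8'.absorb hX (Finset.disjoint_union_right.2 ⟨hdis X hXU, hXY⟩)
    ha hb).mono ?_)
  exact Finset.union_subset (Finset.union_subset hc.subset (hYU.trans hc.subset'))
    (hXU.trans hc.subset')

end Center

theorem Rooted.fragment {L R : Finset V} {s : V} (h : G.Rooted K r) (hLK : L ⊆ K)
    (hL : L.Nonempty) (hb : (G.bdry L).card ≤ 7) (hR : G.Conn R)
    (hRA : R ⊆ insert r (K ∪ G.bdry K)) (hs : s ∈ R) (hdis : Disjoint R (L ∪ G.bdry L))
    (ht : ∀ y ∈ G.bdry L, G.Touch R {y}) :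
    ∃ H : SimpleGraph V, H.Rooted L s ∧ H.bdry L = G.bdry L ∧
      ∀ x ∈ L ∪ G.bdry L, ∀ y ∈ L ∪ G.bdry L, H.Adj x y ↔ G.Adj x y := by
  have hsL : s ∉ L ∪ G.bdry L := Finset.disjoint_left.1 hdis hs
  obtain ⟨hsL', hsb⟩ := not_or.1 (mt Finset.mem_union.2 hsL)
  have hadj : ∀ x y, (G ⊔ fromRel fun x y => x = s ∧ y ∈ G.bdry L).Adj x y ↔
      G.Adj x y ∨ (x = s ∧ y ∈ G.bdry L) ∨ (y = s ∧ x ∈ G.bdry L) := by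
    intro x y
    simp only [sup_adj, fromRel_adj]
    constructor
    · rintro (h | ⟨-, h | h⟩)
      exacts [Or.inl h, Or.inr (Or.inl h), Or.inr (Or.inr h)]
    · rintro (h | h | h)
      · exact Or.inl h
      · exact Or.inr ⟨fun h' => hsb (by rw [← h.1, h']; exact h.2), Or.inl h⟩
      · exact Or.inr ⟨fun h' => hsb (by rw [← h.1, ← h']; exact h.2), Or.inr h⟩
  generalize hH : (G ⊔ fromRel fun x y => x = s ∧ y ∈ G.bdry L) = H at hadj
  have hle : ∀ {x y}, G.Adj x y → H.Adj x y := fun h' => (hadj _ _).2 (Or.inl h')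
  have hiff : ∀ x ∈ L ∪ G.bdry L, ∀ y ∈ L ∪ G.bdry L, H.Adj x y ↔ G.Adj x y := by
    intro x hx y hy
    rw [hadj, or_iff_left]
    rintro (⟨rfl, -⟩ | ⟨rfl, -⟩)
    exacts [hsL hx, hsL hy]
  have hiffL : ∀ x ∈ L, ∀ y, H.Adj x y ↔ G.Adj x y := by
    intro x hx y
    rw [hadj, or_iff_left]
    rintro (⟨rfl, -⟩ | ⟨rfl, hx'⟩)
    exacts [hsL' hx, (mem_bdry.1 hx').2 hx]
  have hbd : H.bdry L = G.bdry L := by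
    ext y
    simp only [mem_bdry]
    constructor
    · rintro ⟨⟨x, hx, hxy⟩, hy⟩
      exact ⟨⟨x, hx, (hiffL x hx y).1 hxy⟩, hy⟩
    · rintro ⟨⟨x, hx, hxy⟩, hy⟩
      exact ⟨⟨x, hx, hle hxy⟩, hy⟩
  have hsub : L ∪ G.bdry L ⊆ K ∪ G.bdry K :=
    Finset.union_subset (hLK.trans Finset.subset_union_left) (bdry_subset hLK)
  have hnb : ∀ x, G.nb x ⊆ H.nb x := fun x y hy => mem_nb.2 (hle (mem_nb.1 hy))
  refine ⟨H, ⟨hL, hsL', ?_, ?_, ?_, ?_, ?_, ?_, ?_⟩, hbd, hiff⟩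
  · intro y hy
    exact (hadj _ _).2 (Or.inr (Or.inl ⟨rfl, hbd ▸ hy⟩))
  · rwa [hbd]
  · rwa [hbd]
  · intro x hx
    obtain ⟨y, hy⟩ := h.exists_adj x (hLK hx)
    exact ⟨y, hle hy⟩
  · intro x hx y hxy
    exact (h.common x (hLK hx) y ((hiffL x hx y).1 hxy)).trans (Finset.card_le_card
      (Finset.inter_subset_inter (hnb x) (hnb y)))
  · intro hm
    rw [hbd] at hm
    rw [Finset.disjoint_left] at hdis
    have hmem : ∀ z, z ∈ (if z = s then R else {z} : Finset V) := by
      intro z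
      split_ifs with h
      · rwa [h]
      · simp
    refine h.no_model (hm.lift (g := fun x => if x = s then R else {x}) (fun x hx => ?_)
      (fun x hx y hy hxy => ?_) (fun x hx y hy hxy => ?_))
    · split_ifs with hxs
      · exact ⟨hR, hRA⟩
      · exact ⟨conn_singleton G x, Finset.singleton_subset_iff.2 (Finset.mem_insert_of_mem
          (hsub ((Finset.mem_insert.1 hx).resolve_left hxs)))⟩
    · rw [Finset.disjoint_left]
      intro z hzx hzy
      split_ifs at hzx hzy with h1 h2 h2
      · exact hxy (h1.trans h2.symm)
      · rw [Finset.mem_singleton.1 hzy] at hzx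
        exact hdis hzx ((Finset.mem_insert.1 hy).resolve_left h2)
      · rw [Finset.mem_singleton.1 hzx] at hzy
        exact hdis hzy ((Finset.mem_insert.1 hx).resolve_left h1)
      · exact hxy ((Finset.mem_singleton.1 hzx).symm.trans (Finset.mem_singleton.1 hzy))
    · rcases (hadj x y).1 hxy with hxy | ⟨rfl, hy'⟩ | ⟨rfl, hx'⟩
      · exact ⟨x, hmem x, y, hmem y, hxy⟩
      · exact (ht y hy').mono (by simp) (by simpa using hmem y)
      · exact ((ht x hx').mono (by simp) (by simpa using hmem x)).symm
  · intro B hB h5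
    rw [hbd] at hB
    have : H.ed B B = G.ed B B := by
      refine Finset.sum_congr rfl fun x hx => ?_
      congr 1
      ext y
      simp only [Finset.mem_inter, mem_nb]
      exact and_congr_left fun hy => hiff x (hB hx) y (hB hy)
    rw [this]
    exact h.sparse B (hB.trans hsub) h5

end SimpleGraph

namespace SimpleGraph

variable {V : Type*} [DecidableEq V] [Fintype V] {G : SimpleGraph V} {K U S T : Finset V} {r w : V}

/-- The neighbours of `w` that have a neighbour in `S`. -/
noncomputable def lab (G : SimpleGraph V) (w : V) (S : Finset V) : Finset V :=
  G.nb w ∩ S.biUnion G.nb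

@[simp] theorem mem_lab {y : V} : y ∈ G.lab w S ↔ G.Adj w y ∧ ∃ s ∈ S, G.Adj s y := by
  simp [lab]

theorem lab_subset_nb : G.lab w S ⊆ G.nb w := Finset.inter_subset_left

theorem lab_mono (h : S ⊆ T) : G.lab w S ⊆ G.lab w T :=
  Finset.inter_subset_inter_left (Finset.biUnion_subset_biUnion_of_subset_left _ h)

theorem lab_union : G.lab w (S ∪ T) = G.lab w S ∪ G.lab w T := by
  ext y
  simp only [mem_lab, Finset.mem_union]
  constructor
  · rintro ⟨h, s, hs | hs, hsy⟩
    exacts [Or.inl ⟨h, s, hs, hsy⟩, Or.inr ⟨h, s, hs, hsy⟩]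
  · rintro (⟨h, s, hs, hsy⟩ | ⟨h, s, hs, hsy⟩)
    exacts [⟨h, s, Or.inl hs, hsy⟩, ⟨h, s, Or.inr hs, hsy⟩]

theorem touch_of_mem_lab {y : V} (h : y ∈ G.lab w S) : G.Touch S {y} := by
  obtain ⟨-, s, hs, hsy⟩ := mem_lab.1 h
  exact ⟨s, hs, y, by simp, hsy⟩

omit [DecidableEq V] [Fintype V] in
theorem exists_of_not_isClique {T : Finset V} (h : ¬ G.IsClique T) :
    ∃ a ∈ T, ∃ b ∈ T, a ≠ b ∧ ¬ G.Adj a b := by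
  by_contra! hno
  exact h fun a ha b hb hab => hno a ha b hb hab

namespace Center

variable (h : G.Rooted K r) (hc : G.Center K r w U)
include h hc

theorem exists_adj_both {a b : V} (ha : a ∈ G.nb w) (hb : b ∈ G.nb w) (hab : G.Adj a b) :
    ∃ u ∈ U, G.Adj a u ∧ G.Adj b u :=
  hc.common a ha b hb hab ((hc.exceptional h).common_le_four a ha b hb hab)

theorem mem_lab_of_notMem {a b : V} (hU : U ⊆ S ∪ T) (ha : a ∈ G.nb w) (haS : a ∉ G.lab w S)
    (hb : b ∈ G.nb w) (hab : a = b ∨ G.Adj a b) : b ∈ G.lab w T := by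
  have key : ∀ c ∈ G.nb w, G.Adj a c → c ∈ G.lab w T ∧ a ∈ G.lab w T := by
    intro c hc' hac
    obtain ⟨u, hu, hau, hcu⟩ := hc.exists_adj_both h ha hc' hac
    have huT : u ∈ T := (Finset.mem_union.1 (hU hu)).resolve_left fun huS =>
      haS (mem_lab.2 ⟨mem_nb.1 ha, u, huS, hau.symm⟩)
    exact ⟨mem_lab.2 ⟨mem_nb.1 hc', u, huT, hcu.symm⟩, mem_lab.2 ⟨mem_nb.1 ha, u, huT, hau.symm⟩⟩
  rcases hab with rfl | hab
  · obtain ⟨c, hc'⟩ := Finset.card_pos.1 ((by omega : 0 < 6).trans_le (hc.six_le h ha))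
    rw [Finset.mem_inter] at hc'
    exact (key c hc'.2 (mem_nb.1 hc'.1)).2
  · exact (key b hb hab).1

theorem card_le_of_isClique (hS : G.IsClique (G.lab w S)) : (G.lab w S).card ≤ 4 :=
  (hc.exceptional h).card_le_four _ lab_subset_nb hS

/-- The label of the rest of `U` contains all neighbours of `w` if the label of a part is
a clique. -/
theorem subset_lab (hU : U ⊆ S ∪ T) (hT : G.IsClique (G.lab w T)) : G.nb w ⊆ G.lab w S := by
  intro a ha
  by_contra haS
  have hsub : insert a (G.nb a ∩ G.nb w) ⊆ G.lab w T := by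
    intro b hb
    rcases Finset.mem_insert.1 hb with rfl | hb
    · exact hc.mem_lab_of_notMem h hU ha haS ha (Or.inl rfl)
    · rw [Finset.mem_inter] at hb
      exact hc.mem_lab_of_notMem h hU ha haS hb.2 (Or.inr (mem_nb.1 hb.1))
  have h1 := (Finset.card_le_card hsub).trans (hc.card_le_of_isClique h hT)
  have h2 := hc.six_le h ha
  rw [Finset.card_insert_of_notMem (by simp)] at h1
  omega

theorem not_isClique (hS : G.nb w ⊆ G.lab w S) : ¬ G.IsClique (G.lab w S) := fun hS' => by
  have h1 := (Finset.card_le_card hS).trans (hc.card_le_of_isClique h hS')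
  have h2 := hc.eight_le h
  omega

theorem not_isClique_three {S₁ S₂ S₃ : Finset V} (hU : U ⊆ S₁ ∪ S₂ ∪ S₃)
    (h1 : G.IsClique (G.lab w S₁)) (h2 : G.IsClique (G.lab w S₂)) :
    ¬ G.IsClique (G.lab w S₃) := fun h3 => by
  have h12 := hc.subset_lab h hU h3
  have h13 := hc.subset_lab h (hU.trans (Finset.union_right_comm S₁ S₂ S₃).subset) h2
  have h23 := hc.subset_lab h (hU.trans (by rw [Finset.union_assoc, Finset.union_comm])) h1
  rw [lab_union] at h12 h13 h23
  have hsub : (G.nb w \ G.lab w S₁) ∪ (G.nb w \ G.lab w S₃) ⊆ G.lab w S₂ := by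
    intro x hx
    simp only [Finset.mem_union, Finset.mem_sdiff] at hx
    rcases hx with ⟨hx, hx'⟩ | ⟨hx, hx'⟩
    · exact (Finset.mem_union.1 (h12 hx)).resolve_left hx'
    · exact (Finset.mem_union.1 (h23 hx)).resolve_right hx'
  have hdis : Disjoint (G.nb w \ G.lab w S₁) (G.nb w \ G.lab w S₃) := by
    rw [Finset.disjoint_left]
    intro x hx hx'
    rw [Finset.mem_sdiff] at hx hx'
    rcases Finset.mem_union.1 (h13 hx.1) with h | h
    exacts [hx.2 h, hx'.2 h]
  have := Finset.card_le_card hsub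
  rw [Finset.card_union_of_disjoint hdis, Finset.card_sdiff_of_subset lab_subset_nb,
    Finset.card_sdiff_of_subset lab_subset_nb] at this
  have := hc.card_le_of_isClique h h1
  have := hc.card_le_of_isClique h h2
  have := hc.card_le_of_isClique h h3
  have := hc.eight_le h
  omega

theorem isClique_or {X Y : Finset V} (hX : G.Conn X) (hY : G.Conn Y) (hXY : Disjoint X Y)
    (hU : X ∪ Y = U) : G.IsClique (G.lab w X) ∨ G.IsClique (G.lab w Y) := by
  have he := hc.exceptional h
  have hXU : X ⊆ U := hU ▸ Finset.subset_union_left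
  have hYU : Y ⊆ U := hU ▸ Finset.subset_union_right
  by_contra! hno
  obtain ⟨⟨a, ha, b, hb, hab, hab'⟩, c, hc', d, hd, hcd, hcd'⟩ :=
    hno.imp exists_of_not_isClique exists_of_not_isClique
  by_cases hfX : G.nb w ⊆ G.lab w X
  · obtain ⟨p, hp, q, hq, -, -, hm⟩ := he.seven c (lab_subset_nb hc') d (lab_subset_nb hd) hcd hcd'
    exact hc.not_kModel_seven h hm hY hX hYU hXU hXY.symm (touch_of_mem_lab hc')
      (touch_of_mem_lab hd) (touch_of_mem_lab (hfX hp)) (touch_of_mem_lab (hfX hq))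
  by_cases hfY : G.nb w ⊆ G.lab w Y
  · obtain ⟨p, hp, q, hq, -, -, hm⟩ := he.seven a (lab_subset_nb ha) b (lab_subset_nb hb) hab hab'
    exact hc.not_kModel_seven h hm hX hY hXU hYU hXY (touch_of_mem_lab ha)
      (touch_of_mem_lab hb) (touch_of_mem_lab (hfY hp)) (touch_of_mem_lab (hfY hq))
  obtain ⟨x, hx, hxX⟩ := Finset.not_subset.1 hfX
  obtain ⟨y, hy, hyY⟩ := Finset.not_subset.1 hfY
  obtain ⟨c, hc', d, hd, p, hp, q, hq, -, -, -, -, hxc, hxd, hyp, hyq, hm⟩ := he.seven_nb x hx y hy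
  exact hc.not_kModel_seven h hm hY hX hYU hXU hXY.symm
    (touch_of_mem_lab (hc.mem_lab_of_notMem h hU.symm.subset hx hxX hc' hxc))
    (touch_of_mem_lab (hc.mem_lab_of_notMem h hU.symm.subset hx hxX hd hxd))
    (touch_of_mem_lab (hc.mem_lab_of_notMem h (by rw [Finset.union_comm, hU]) hy hyY hp hyp))
    (touch_of_mem_lab (hc.mem_lab_of_notMem h (by rw [Finset.union_comm, hU]) hy hyY hq hyq))

/-- A connected part of `U` with connected complement and without full label has a clique
as its label. -/
theorem isClique_of_not_subset {X : Finset V} (hX : G.Conn X) (hXU : X ⊆ U)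
    (hY : G.Conn (U \ X)) (hF : ¬ G.nb w ⊆ G.lab w X) : G.IsClique (G.lab w X) := by
  have hU : X ∪ U \ X = U := Finset.union_sdiff_of_subset hXU
  refine (hc.isClique_or h hX hY Finset.disjoint_sdiff hU).resolve_right fun hY' => hF ?_
  exact hc.subset_lab h hU.symm.subset hY'

theorem exists_isClique_lab :
    ∃ p ∈ U, ∀ D ⊆ U, p ∉ D → G.Conn D → G.IsClique (G.lab w D) := by
  classical
  have hUc := hc.isComp.conn
  obtain ⟨P, hP, hmin⟩ := Finset.exists_min_image
    (U.powerset.filter fun P => G.Conn P ∧ (U \ P = ∅ ∨ G.Conn (U \ P)) ∧ G.nb w ⊆ G.lab w P)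
    Finset.card ⟨U, by
      simp only [Finset.mem_filter, Finset.mem_powerset, Finset.sdiff_self, true_or, true_and]
      refine ⟨le_rfl, hUc, hc.subset_lab h (T := ∅) Finset.subset_union_left ?_⟩
      intro a ha
      simp at ha⟩
  simp only [Finset.mem_filter, Finset.mem_powerset] at hP hmin
  obtain ⟨hPU, hPc, hQ, hPF⟩ := hP
  have hPQ : P ∪ U \ P = U := Finset.union_sdiff_of_subset hPU
  have hmin' : ∀ X ⊆ P, X ≠ P → G.Conn X → G.Conn (U \ X) → G.IsClique (G.lab w X) := by
    intro X hX hne hXc hY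
    refine hc.isClique_of_not_subset h hXc (hX.trans hPU) hY fun hF => ?_
    have := hmin X ⟨hX.trans hPU, hXc, Or.inr hY, hF⟩
    exact absurd (Finset.card_lt_card (Finset.ssubset_iff_subset_ne.2 ⟨hX, hne⟩)) (not_lt.2 this)
  have hQcl : G.IsClique (G.lab w (U \ P)) := by
    rcases hQ with hQ | hQ
    · rw [hQ]
      intro a ha
      simp at ha
    · exact (hc.isClique_or h hPc hQ Finset.disjoint_sdiff hPQ).resolve_left
        (hc.not_isClique h hPF)
  obtain ⟨p, hp, hpQ⟩ : ∃ p ∈ P, (U \ P).Nonempty → G.Touch {p} (U \ P) := by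
    by_cases hne : (U \ P).Nonempty
    · obtain ⟨v, hv⟩ := hne
      obtain ⟨u, hu⟩ := hPc.1
      rw [Finset.mem_sdiff] at hv
      obtain ⟨a, ha, b, hb, hab⟩ := hUc.touch_inter (hPU hu) hu hv.1 hv.2
      exact ⟨a, (Finset.mem_inter.1 ha).2, fun _ => ⟨a, by simp, b, hb, hab⟩⟩
    · obtain ⟨u, hu⟩ := hPc.1
      exact ⟨u, hu, fun h' => absurd h' hne⟩
  have hcomp : ∀ C, G.IsComp (P \ {p}) C →
      G.IsClique (G.lab w C) ∧ ¬ G.Touch C (U \ P) := by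
    intro C hC
    have hCP : C ⊆ P := hC.subset.trans Finset.sdiff_subset
    have hpC : p ∉ C := fun h' => (Finset.mem_sdiff.1 (hC.subset h')).2 (by simp)
    have hPC : G.Conn (P \ C) :=
      hPc.sdiff_isComp (conn_singleton G p) (by simpa using hp) hC
    have hUC : U \ C = P \ C ∪ U \ P := by
      ext x
      have h1 := @hCP x
      have h2 := @hPU x
      simp only [Finset.mem_sdiff, Finset.mem_union]
      tauto
    have hUCc : G.Conn (U \ C) := by
      rw [hUC]
      rcases hQ with hQ | hQ
      · rwa [hQ, Finset.union_empty]
      · exact hPC.union hQ ((hpQ hQ.1).mono (by simp [hp, hpC]) le_rfl)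
    have hCcl := hmin' C hCP (fun h' => hpC (h' ▸ hp)) hC.conn hUCc
    refine ⟨hCcl, fun ht => ?_⟩
    have hQc : G.Conn (U \ P) := by
      obtain ⟨a, ha, b, hb, hab⟩ := ht
      exact hQ.resolve_left (Finset.Nonempty.ne_empty ⟨b, hb⟩)
    obtain ⟨v, hv⟩ := hC.conn.1
    have hPCcl := hmin' (P \ C) Finset.sdiff_subset (fun h' => by
      rw [← h'] at hCP
      exact (Finset.mem_sdiff.1 (hCP hv)).2 hv) hPC (by
      have : U \ (P \ C) = C ∪ U \ P := by
        ext x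
        have h1 := @hCP x
        have h2 := @hPU x
        simp only [Finset.mem_sdiff, Finset.mem_union]
        tauto
      rw [this]
      exact hC.conn.union hQc ht)
    refine hc.not_isClique_three h (S₁ := P \ C) (S₂ := C) ?_ hPCcl hCcl hQcl
    rw [Finset.sdiff_union_of_subset hCP, hPQ]
  refine ⟨p, hPU hp, fun D hDU hpD hD => ?_⟩
  by_cases hDP : ∃ d ∈ D, d ∈ P
  · obtain ⟨d, hd, hdP⟩ := hDP
    have hdp : d ∈ P \ {p} := by
      simp only [Finset.mem_sdiff, Finset.mem_singleton]
      exact ⟨hdP, fun h' => hpD (h' ▸ hd)⟩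
    obtain ⟨C, hC, hdC⟩ := exists_isComp_of_mem (G := G) hdp
    obtain ⟨hCcl, hCQ⟩ := hcomp C hC
    refine hCcl.subset (Finset.coe_subset.2 (lab_mono fun y hy => ?_))
    by_contra hyC
    obtain ⟨a, ha, b, hb, hab⟩ := hD.touch_inter hd hdC hy hyC
    rw [Finset.mem_inter] at ha
    rw [Finset.mem_sdiff] at hb
    by_cases hbP : b ∈ P
    · refine hC.not_adj a ha.2 b ?_ hb.2 hab
      simp only [Finset.mem_sdiff, Finset.mem_singleton]
      exact ⟨hbP, fun h' => hpD (h' ▸ hb.1)⟩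
    · exact hCQ ⟨a, ha.2, b, Finset.mem_sdiff.2 ⟨hDU hb.1, hbP⟩, hab⟩
  · push Not at hDP
    exact hQcl.subset (Finset.coe_subset.2 (lab_mono fun y hy =>
      Finset.mem_sdiff.2 ⟨hDU hy, hDP y hy⟩))

end Center

end SimpleGraph

namespace SimpleGraph

variable {V : Type*} [DecidableEq V] [Fintype V] {G : SimpleGraph V} {K U S T L R D : Finset V}
  {r w p : V}

/-- A part `L` of `K` with small boundary, together with a connected set `R` that contains `w`
and that is adjacent to the whole boundary of `L`. -/
structure Fragment (G : SimpleGraph V) (K : Finset V) (r w : V) (L R : Finset V) : Prop where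
  subset : L ⊆ K
  nonempty : L.Nonempty
  card_le : (G.bdry L).card ≤ 7
  conn : G.Conn R
  subset_insert : R ⊆ insert r (K ∪ G.bdry K)
  mem : w ∈ R
  disjoint : Disjoint R (L ∪ G.bdry L)
  touch : ∀ y ∈ G.bdry L, G.Touch R {y}

theorem Rooted.root_notMem_insert (h : G.Rooted K r) (hw : w ∈ K) : r ∉ insert w (G.nb w) := by
  rw [Finset.mem_insert, not_or]
  refine ⟨fun h' => h.root_notMem (h' ▸ hw), fun h' => ?_⟩
  rcases Finset.mem_union.1 (nb_subset hw h') with h' | h'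
  exacts [h.root_notMem h', h.root_notMem_bdry h']

theorem conn_insert_of_subset_nb (hT : T ⊆ G.nb w) : G.Conn (insert w T) := by
  rw [Finset.insert_eq]
  exact (conn_singleton G w).union_of_forall fun y hy =>
    ⟨w, by simp, y, by simp, mem_nb.1 (hT hy)⟩

namespace Center

variable (h : G.Rooted K r) (hc : G.Center K r w U)
include h hc

theorem exists_notMem_lab (hT : G.IsClique (G.lab w S)) : ∃ f ∈ G.nb w, f ∉ G.lab w S := by
  by_contra! hno
  exact hc.not_isClique h (fun f hf => hno f hf) hT

/-- A component of a set `W` that avoids the closed neighbourhood of `w` and a vertex `p` yields a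
fragment when it has a clique as its label, lies in `K` and is only adjacent to vertices of `W`,
to `p` and to neighbours of `w`. -/
theorem fragment_of_bdry_subset {X : Finset V} (hDK : D ⊆ K) (hD : D.Nonempty)
    (hDw : Disjoint D (insert w (G.nb w))) (hcl : G.IsClique (G.lab w D))
    (hb : G.bdry D ⊆ insert p (G.lab w D)) (hp : p ∉ insert w (G.nb w))
    (hX : G.Conn (insert w (G.nb w \ G.lab w D) ∪ X)) (hXA : X ⊆ insert r (K ∪ G.bdry K))
    (hXD : Disjoint X (insert p (D ∪ G.nb w)))
    (hpX : G.Touch (insert w (G.nb w \ G.lab w D) ∪ X) {p}) :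
    G.Fragment K r w D (insert w (G.nb w \ G.lab w D) ∪ X) := by
  refine ⟨hDK, hD, ?_, hX, ?_, by simp, ?_, ?_⟩
  · have h1 := (Finset.card_le_card hb).trans (Finset.card_insert_le _ _)
    have h2 := hc.card_le_of_isClique h hcl
    omega
  · exact Finset.union_subset ((Finset.insert_subset_insert _ Finset.sdiff_subset).trans hc.subset)
      hXA
  · rw [Finset.disjoint_left] at hDw hXD ⊢
    intro x hx hx'
    have hxb : x ∈ G.bdry D → x = p ∨ x ∈ G.lab w D := fun h' => Finset.mem_insert.1 (hb h')
    have hxl := @lab_subset_nb V _ _ G D w x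
    have h1 := @hDw x
    have h2 := @hXD x
    have hww : w ∉ G.nb w := by simp
    simp only [Finset.mem_union, Finset.mem_insert, Finset.mem_sdiff] at hx hx' h1 h2 hp
    rcases hx with (rfl | hx) | hx
    · rcases hx' with hx' | hx'
      · exact h1 hx' (Or.inl rfl)
      · rcases hxb hx' with rfl | hx'
        · exact hp (Or.inl rfl)
        · exact hww (hxl hx')
    · rcases hx' with hx' | hx'
      · exact h1 hx' (Or.inr hx.1)
      · rcases hxb hx' with rfl | hx'
        · exact hp (Or.inr hx.1)
        · exact hx.2 hx'
    · rcases hx' with hx' | hx'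
      · exact h2 hx (Or.inr (Or.inl hx'))
      · rcases hxb hx' with rfl | hx'
        · exact h2 hx (Or.inl rfl)
        · exact h2 hx (Or.inr (Or.inr (hxl hx')))
  · intro y hy
    rcases Finset.mem_insert.1 (hb hy) with rfl | hy
    · exact hpX
    · exact ⟨w, by simp, y, by simp, mem_nb.1 (lab_subset_nb hy)⟩

omit h in
/-- The neighbours of a component of `U \ {p}`. -/
theorem adj_cases (hD : G.IsComp (U \ {p}) D) {x y : V} (hx : x ∈ D) (hxy : G.Adj x y)
    (hy : y ∈ insert r (K ∪ G.bdry K)) : y = p ∨ y ∈ G.lab w D ∨ y ∈ D := by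
  have hxU := (Finset.mem_sdiff.1 (hD.subset hx)).1
  have hxw := Finset.disjoint_left.1 hc.disjoint hxU
  rw [Finset.mem_insert, mem_nb, not_or] at hxw
  by_cases hyw : G.Adj w y
  · exact Or.inr (Or.inl (mem_lab.2 ⟨hyw, x, hx, hxy⟩))
  have hyU : y ∈ U := by
    by_contra hyU
    refine hc.isComp.not_adj x hxU y (Finset.mem_sdiff.2 ⟨hy, ?_⟩) hyU hxy
    rw [Finset.mem_insert, mem_nb, not_or]
    refine ⟨?_, hyw⟩
    rintro rfl
    exact hxw.2 hxy.symm
  by_cases hyp : y = p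
  · exact Or.inl hyp
  refine Or.inr (Or.inr ?_)
  by_contra hyD
  exact hD.not_adj x hx y (by simp [hyU, hyp]) hyD hxy

omit [Fintype V] h hc in
/-- Two disjoint components of a disconnected set. -/
theorem _root_.SimpleGraph.exists_isComp_pair (hne : S.Nonempty) (hS : ¬ G.Conn S) :
    ∃ C D, G.IsComp S C ∧ G.IsComp S D ∧ Disjoint C D := by
  obtain ⟨v, hv⟩ := hne
  obtain ⟨C, hC, hvC⟩ := exists_isComp_of_mem (G := G) hv
  obtain ⟨x, hx, hxC⟩ : ∃ x ∈ S, x ∉ C := by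
    by_contra! hno
    exact hS (Finset.Subset.antisymm hC.subset hno ▸ hC.conn)
  obtain ⟨D, hD, hxD⟩ := exists_isComp_of_mem (G := G) hx
  refine ⟨C, D, hC, hD, Finset.disjoint_left.2 fun z hz hz' => ?_⟩
  exact hxC (hC.subset_of_mem hD.conn hD.subset hz hz' hxD)

theorem exists_fragment_of_ne (hp : p ∈ U) (hpr : p ≠ r)
    (hcl : ∀ D ⊆ U, p ∉ D → G.Conn D → G.IsClique (G.lab w D))
    (hD : G.IsComp (U \ {p}) D) (hrD : r ∉ D) : ∃ L R, G.Fragment K r w L R := by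
  have hDU : D ⊆ U := hD.subset.trans Finset.sdiff_subset
  have hpD : p ∉ D := fun h' => (Finset.mem_sdiff.1 (hD.subset h')).2 (by simp)
  have hDcl := hcl D hDU hpD hD.conn
  have hpw := Finset.disjoint_left.1 hc.disjoint hp
  have hrU : ∀ s ∈ U, G.Adj s r → r ∈ U := by
    intro s hs hsr
    by_contra hrU
    exact hc.isComp.not_adj s hs r
      (Finset.mem_sdiff.2 ⟨by simp, h.root_notMem_insert hc.mem⟩) hrU hsr
  have hDK : D ⊆ K := by
    intro s hs
    by_contra hsK
    have hsA := hc.subset' (hDU hs)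
    rw [Finset.mem_insert, Finset.mem_union] at hsA
    rcases hsA with rfl | hsA | hsb
    · exact hrD hs
    · exact hsK hsA
    · have hsr := (h.root_adj s hsb).symm
      exact hD.not_adj s hs r (by simp [hrU s (hDU hs) hsr, hpr.symm]) hrD hsr
  have hb : G.bdry D ⊆ insert p (G.lab w D) := by
    intro s hs
    obtain ⟨⟨x, hx, hxs⟩, hsD⟩ := mem_bdry.1 hs
    rcases hc.adj_cases hD hx hxs (Finset.mem_insert_of_mem (nb_subset (hDK hx) (mem_nb.2 hxs)))
      with h' | h' | h'
    · simp [h']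
    · exact Finset.mem_insert_of_mem h'
    · exact absurd h' hsD
  have hDw := Finset.disjoint_of_subset_left hDU hc.disjoint
  have hstar : G.Conn (insert w (G.nb w \ G.lab w D)) :=
    conn_insert_of_subset_nb Finset.sdiff_subset
  by_cases hpF : ∃ f ∈ G.nb w \ G.lab w D, G.Adj f p
  · obtain ⟨f, hf, hfp⟩ := hpF
    exact ⟨_, _, hc.fragment_of_bdry_subset h (X := ∅) hDK hD.conn.1 hDw hDcl hb hpw
      (by rwa [Finset.union_empty]) (by simp) (by simp)
      ⟨f, Finset.mem_union_left _ (Finset.mem_insert_of_mem hf), p, by simp, hfp⟩⟩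
  obtain ⟨f, hf, hfD⟩ := hc.exists_notMem_lab h hDcl
  have hfl := hc.subset_lab h (S := U \ D) (by rw [Finset.sdiff_union_of_subset hDU]) hDcl hf
  obtain ⟨-, u, hu, huf⟩ := mem_lab.1 hfl
  rw [Finset.mem_sdiff] at hu
  have hup : u ∈ U \ {p} := by
    simp only [Finset.mem_sdiff, Finset.mem_singleton]
    refine ⟨hu.1, ?_⟩
    rintro rfl
    exact hpF ⟨f, Finset.mem_sdiff.2 ⟨hf, hfD⟩, huf.symm⟩
  obtain ⟨D', hD', huD'⟩ := exists_isComp_of_mem (G := G) hup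
  have hD'U : D' ⊆ U := hD'.subset.trans Finset.sdiff_subset
  have ht : G.Touch D' {p} := hD'.touch hc.isComp.conn (by simpa using hp) (by simp)
  refine ⟨_, _, hc.fragment_of_bdry_subset h (X := D') hDK hD.conn.1 hDw hDcl hb hpw
    (hstar.union hD'.conn ⟨f, by simp [hfD, mem_nb.1 hf], u, huD', huf.symm⟩)
    (hD'U.trans hc.subset') ?_ (ht.mono Finset.subset_union_right le_rfl)⟩
  rw [Finset.disjoint_left]
  intro z hz hz'
  rw [Finset.mem_insert, Finset.mem_union] at hz'
  rcases hz' with rfl | hz' | hz'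
  · exact (Finset.mem_sdiff.1 (hD'.subset hz)).2 (by simp)
  · exact hu.2 (hD.subset_of_mem hD'.conn hD'.subset hz' hz huD')
  · exact Finset.disjoint_left.1 hc.disjoint (hD'U hz) (Finset.mem_insert_of_mem hz')

theorem exists_fragment_of_root (hp : r ∈ U)
    (hcl : ∀ D ⊆ U, r ∉ D → G.Conn D → G.IsClique (G.lab w D))
    (hD : G.IsComp (U \ {r}) D) (h3 : (D ∩ G.bdry K).card ≤ 3) : ∃ L R, G.Fragment K r w L R := by
  have hDU : D ⊆ U := hD.subset.trans Finset.sdiff_subset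
  have hrD : r ∉ D := fun h' => (Finset.mem_sdiff.1 (hD.subset h')).2 (by simp)
  have hDcl := hcl D hDU hrD hD.conn
  have hT4 := hc.card_le_of_isClique h hDcl
  have hDA : D ⊆ K ∪ G.bdry K := fun x hx =>
    (Finset.mem_insert.1 (hc.subset' (hDU hx))).resolve_left fun h' => hrD (h' ▸ hx)
  have hrA : r ∉ K ∪ G.bdry K := by simpa using ⟨h.root_notMem, by simpa using h.root_notMem_bdry⟩
  have hcases : ∀ x ∈ D, ∀ y ∈ K ∪ G.bdry K, G.Adj x y → y ∈ G.lab w D ∨ y ∈ D :=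
    fun x hx y hy hxy => (hc.adj_cases hD hx hxy (Finset.mem_insert_of_mem hy)).resolve_left
      fun h' => hrA (h' ▸ hy)
  have hDw := Finset.disjoint_left.1 (Finset.disjoint_of_subset_left hDU hc.disjoint)
  have hb : G.bdry (D ∩ K) ⊆ (D ∩ G.bdry K) ∪ G.lab w D := by
    intro s hs
    obtain ⟨⟨x, hx, hxs⟩, hsD⟩ := mem_bdry.1 hs
    rw [Finset.mem_inter] at hx
    have hsK := nb_subset hx.2 (mem_nb.2 hxs)
    rcases hcases x hx.1 s hsK hxs with h' | h'
    · exact Finset.mem_union_right _ h'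
    · refine Finset.mem_union_left _ (Finset.mem_inter.2 ⟨h', ?_⟩)
      exact (Finset.mem_union.1 hsK).resolve_left fun h'' => hsD (Finset.mem_inter.2 ⟨h', h''⟩)
  obtain ⟨f, hf, hfD⟩ := hc.exists_notMem_lab h hDcl
  obtain ⟨-, u, hu, huf⟩ := mem_lab.1
    (hc.subset_lab h (S := U \ D) (by rw [Finset.sdiff_union_of_subset hDU]) hDcl hf)
  have hrUD : r ∈ U \ D := Finset.mem_sdiff.2 ⟨hp, hrD⟩
  refine ⟨D ∩ K, insert w (G.nb w \ G.lab w D) ∪ U \ D, Finset.inter_subset_right, ?_, ?_, ?_, ?_,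
    by simp, ?_, ?_⟩
  · by_contra hno
    have hDb : ∀ x ∈ D, x ∈ G.bdry K := fun x hx => (Finset.mem_union.1 (hDA hx)).resolve_left
      fun h' => hno ⟨x, Finset.mem_inter.2 ⟨hx, h'⟩⟩
    rw [Finset.inter_eq_left.2 hDb] at h3
    obtain ⟨s, hs⟩ := hD.conn.1
    obtain ⟨⟨k, hk, hks⟩, -⟩ := mem_bdry.1 (hDb s hs)
    have hkT : k ∈ G.lab w D := (hcases s hs k (Finset.mem_union_left _ hk) hks.symm).resolve_right
      fun h' => hno ⟨k, Finset.mem_inter.2 ⟨h', hk⟩⟩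
    have hsub : G.nb k ∩ G.nb s ⊆ (G.lab w D).erase k ∪ D.erase s := by
      intro z hz
      simp only [Finset.mem_inter, mem_nb] at hz
      simp only [Finset.mem_union, Finset.mem_erase]
      exact (hcases s hs z (nb_subset hk (mem_nb.2 hz.1)) hz.2).imp (fun h' => ⟨hz.1.ne', h'⟩)
        fun h' => ⟨hz.2.ne', h'⟩
    have h6 := (h.common k hk s hks).trans ((Finset.card_le_card hsub).trans
      (Finset.card_union_le _ _))
    rw [Finset.card_erase_of_mem hkT, Finset.card_erase_of_mem hs] at h6
    omega
  · have := (Finset.card_le_card hb).trans (Finset.card_union_le _ _)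
    omega
  · exact (conn_insert_of_subset_nb Finset.sdiff_subset).union
      (hc.isComp.conn.sdiff_isComp (conn_singleton G r) (by simpa using hp) hD)
      ⟨f, by simp [hfD, mem_nb.1 hf], u, hu, huf.symm⟩
  · exact Finset.union_subset ((Finset.insert_subset_insert _ Finset.sdiff_subset).trans hc.subset)
      (Finset.sdiff_subset.trans hc.subset')
  · rw [Finset.disjoint_left]
    intro x hx hx'
    have hx2 : x ∈ D ∨ x ∈ G.lab w D := by
      rcases Finset.mem_union.1 hx' with h' | h'
      · exact Or.inl (Finset.mem_inter.1 h').1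
      · exact (Finset.mem_union.1 (hb h')).imp_left fun h' => (Finset.mem_inter.1 h').1
    have hxl := @lab_subset_nb V _ _ G D w x
    have h1 := @hDw x
    have h2 : x ∈ U → x ∉ insert w (G.nb w) := fun h' => Finset.disjoint_left.1 hc.disjoint h'
    have hww : w ∉ G.nb w := by simp
    simp only [Finset.mem_union, Finset.mem_insert, Finset.mem_sdiff] at hx h1 h2
    rcases hx with (rfl | hx) | hx
    · exact hx2.elim (fun h' => h1 h' (Or.inl rfl)) fun h' => hww (hxl h')
    · exact hx2.elim (fun h' => h1 h' (Or.inr hx.1)) hx.2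
    · exact hx2.elim hx.2 fun h' => h2 hx.1 (Or.inr (hxl h'))
  · intro y hy
    rcases Finset.mem_union.1 (hb hy) with hy | hy
    · exact ⟨r, Finset.mem_union_right _ hrUD, y, by simp, h.root_adj y (Finset.mem_inter.1 hy).2⟩
    · exact ⟨w, by simp, y, by simp, mem_nb.1 (lab_subset_nb hy)⟩

theorem exists_fragment_of_not_conn (hp : p ∈ U)
    (hcl : ∀ D ⊆ U, p ∉ D → G.Conn D → G.IsClique (G.lab w D))
    (hne : (U \ {p}).Nonempty) (hU : ¬ G.Conn (U \ {p})) : ∃ L R, G.Fragment K r w L R := by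
  obtain ⟨C, D, hC, hD, hCD⟩ := exists_isComp_pair hne hU
  by_cases hpr : p = r
  · subst hpr
    have h7 : (C ∩ G.bdry K).card + (D ∩ G.bdry K).card ≤ 7 := by
      rw [← Finset.card_union_of_disjoint (Finset.disjoint_of_subset_left Finset.inter_subset_left
        (Finset.disjoint_of_subset_right Finset.inter_subset_left hCD))]
      exact (Finset.card_le_card (Finset.union_subset Finset.inter_subset_right
        Finset.inter_subset_right)).trans h.card_bdry
    by_cases h3 : (C ∩ G.bdry K).card ≤ 3
    · exact hc.exists_fragment_of_root h hp hcl hC h3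
    · exact hc.exists_fragment_of_root h hp hcl hD (by omega)
  · by_cases hr : r ∈ C
    · exact hc.exists_fragment_of_ne h hp hpr hcl hD (Finset.disjoint_left.1 hCD hr)
    · exact hc.exists_fragment_of_ne h hp hpr hcl hC hr

/-- If `p` is adjacent to all neighbours of `w`, then connected sets outside have cliques as
labels. -/
theorem isClique_of_dominating (hp : p ∈ U) (hpF : ∀ f ∈ G.nb w, G.Adj p f) {O : Finset V}
    (hO : G.Conn O) (hOA : O ⊆ insert r (K ∪ G.bdry K)) (hOw : Disjoint O (insert w (G.nb w)))
    (hpO : p ∉ O) : G.IsClique (G.lab w O) := by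
  by_contra hno
  obtain ⟨a, ha, b, hb, hab, hab'⟩ := exists_of_not_isClique hno
  obtain ⟨x, hx, hm⟩ := (hc.exceptional h).six a (lab_subset_nb ha) b (lab_subset_nb hb) hab hab'
  have hpw := Finset.disjoint_left.1 hc.disjoint hp
  rw [Finset.mem_insert, not_or] at hpw
  have hwx := mem_nb.1 hx
  have h7 := hm.cone (conn_singleton _ w) (by simp) (fun y hy => ⟨w, by simp, y, by simp,
    Or.inl (mem_nb.1 (Finset.mem_of_mem_erase hy))⟩)
  have hdis : Disjoint {p, x} ({w} ∪ (G.nb w).erase x) := by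
    rw [Finset.disjoint_left]
    intro z hz hz'
    simp only [Finset.mem_insert, Finset.mem_singleton, Finset.mem_union, Finset.mem_erase]
      at hz hz'
    rcases hz with rfl | rfl
    · exact hz'.elim hpw.1 fun h' => hpw.2 h'.2
    · exact hz'.elim (fun h' => hwx.ne' h') fun h' => h'.1 rfl
  have h8 := h7.cone (Z := {p, x}) (conn_pair (Or.inr (Or.inl (hpF x hx)))) hdis fun y hy => by
    rcases Finset.mem_union.1 hy with hy | hy
    · rw [Finset.mem_singleton.1 hy]
      exact ⟨x, by simp, w, by simp, Or.inl hwx.symm⟩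
    · exact ⟨p, by simp, y, by simp, Or.inl (hpF y (Finset.mem_of_mem_erase hy))⟩
  have hsub : {p, x} ∪ ({w} ∪ (G.nb w).erase x) ⊆ insert p (insert w (G.nb w)) := by
    intro z hz
    simp only [Finset.mem_insert, Finset.mem_singleton, Finset.mem_union, Finset.mem_erase]
      at hz ⊢
    rcases hz with (rfl | rfl) | rfl | hz
    · exact Or.inl rfl
    · exact Or.inr (Or.inr hx)
    · exact Or.inr (Or.inl rfl)
    · exact Or.inr (Or.inr hz.2)
  refine h.no_model ((h8.absorb hO (Finset.disjoint_of_subset_right hsub ?_)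
    (touch_of_mem_lab ha) (touch_of_mem_lab hb)).mono (Finset.union_subset (hsub.trans
      (Finset.insert_subset (hc.subset' hp) hc.subset)) hOA))
  rw [Finset.disjoint_insert_right]
  exact ⟨hpO, hOw⟩

theorem exists_fragment_of_dominating (hp : p ∈ U) (hpF : ∀ f ∈ G.nb w, G.Adj p f) (hpr : p ≠ r)
    (h3 : ∀ a ∈ G.nb w, ∀ b ∈ G.nb w, G.Adj a b → (G.nb a ∩ G.nb b ∩ G.nb w).card ≤ 3) :
    ∃ L R, G.Fragment K r w L R := by
  have hpw := Finset.disjoint_left.1 hc.disjoint hp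
  set W := insert r (K ∪ G.bdry K) \ insert p (insert w (G.nb w)) with hW
  have hmemW : ∀ x, x ∈ W ↔ x ∈ insert r (K ∪ G.bdry K) ∧ x ≠ p ∧ x ∉ insert w (G.nb w) := by
    intro x
    rw [hW, Finset.mem_sdiff, Finset.mem_insert (b := p), not_or]
  have hcl : ∀ C, G.IsComp W C → Disjoint C (insert w (G.nb w)) ∧ G.IsClique (G.lab w C) := by
    intro C hC
    have h1 : Disjoint C (insert w (G.nb w)) :=
      Finset.disjoint_left.2 fun x hx => ((hmemW x).1 (hC.subset hx)).2.2
    exact ⟨h1, hc.isClique_of_dominating h hp hpF hC.conn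
      (fun x hx => ((hmemW x).1 (hC.subset hx)).1) h1
      fun h' => ((hmemW p).1 (hC.subset h')).2.1 rfl⟩
  have hrW : r ∈ W := (hmemW r).2 ⟨by simp, hpr.symm, h.root_notMem_insert hc.mem⟩
  obtain ⟨C, hC, hrC⟩ := exists_isComp_of_mem (G := G) hrW
  by_cases hconn : ∃ v ∈ W, v ∉ C
  · obtain ⟨v, hv, hvC⟩ := hconn
    obtain ⟨D, hD, hvD⟩ := exists_isComp_of_mem (G := G) hv
    have hrD : r ∉ D := fun h' => hvC (hC.subset_of_mem hD.conn hD.subset hrC h' hvD)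
    obtain ⟨hDw, hDcl⟩ := hcl D hD
    have hDK : D ⊆ K := by
      intro s hs
      by_contra hsK
      have hsA := ((hmemW s).1 (hD.subset hs)).1
      rw [Finset.mem_insert, Finset.mem_union] at hsA
      rcases hsA with rfl | hsA | hsb
      · exact hrD hs
      · exact hsK hsA
      · exact hD.not_adj s hs r hrW hrD (h.root_adj s hsb).symm
    obtain ⟨f, hf, hfD⟩ := hc.exists_notMem_lab h hDcl
    refine ⟨_, _, hc.fragment_of_bdry_subset h (p := p) (X := ∅) hDK hD.conn.1 hDw hDcl ?_ hpw
      (by rw [Finset.union_empty]; exact conn_insert_of_subset_nb Finset.sdiff_subset)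
      (by simp) (by simp) ⟨f, by simp [hfD, mem_nb.1 hf], p, by simp, (hpF f hf).symm⟩⟩
    intro s hs
    obtain ⟨⟨x, hx, hxs⟩, hsD⟩ := mem_bdry.1 hs
    by_contra hno
    rw [Finset.mem_insert, mem_lab, not_or] at hno
    refine hD.not_adj x hx s ((hmemW s).2 ⟨Finset.mem_insert_of_mem
      (nb_subset (hDK hx) (mem_nb.2 hxs)), hno.1, ?_⟩) hsD hxs
    rw [Finset.mem_insert, mem_nb, not_or]
    refine ⟨?_, fun h' => hno.2 ⟨h', x, hx, hxs⟩⟩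
    rintro rfl
    exact Finset.disjoint_left.1 hDw hx (by simp [hxs.symm])
  · push Not at hconn
    exfalso
    obtain ⟨-, hCcl⟩ := hcl C hC
    have h4 := hc.card_le_of_isClique h hCcl
    obtain ⟨a, ha, haC⟩ := hc.exists_notMem_lab h hCcl
    obtain ⟨b, hb, hbC⟩ : ∃ b ∈ G.nb a ∩ G.nb w, b ∉ G.lab w C := by
      by_contra! hno
      have h5 := (hc.six_le h ha).trans (Finset.card_le_card hno)
      omega
    rw [Finset.mem_inter] at hb
    have haK : a ∈ K := by
      refine (Finset.mem_union.1 (nb_subset hc.mem ha)).resolve_right fun h' => haC ?_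
      exact mem_lab.2 ⟨mem_nb.1 ha, r, hrC, h.root_adj a h'⟩
    have hsub : G.nb a ∩ G.nb b ⊆ insert w (insert p (G.nb a ∩ G.nb b ∩ G.nb w)) := by
      intro u hu
      by_contra hno
      simp only [Finset.mem_insert, Finset.mem_inter, not_or, not_and] at hu hno
      refine haC (mem_lab.2 ⟨mem_nb.1 ha, u, hconn u ((hmemW u).2
        ⟨Finset.mem_insert_of_mem (nb_subset haK hu.1), hno.2.1, ?_⟩), (mem_nb.1 hu.1).symm⟩)
      rw [Finset.mem_insert, not_or]
      exact ⟨hno.1, hno.2.2 hu⟩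
    have h5 := (h.common a haK b (mem_nb.1 hb.1)).trans ((Finset.card_le_card hsub).trans
      (Finset.card_insert_le _ _))
    have h6 := Finset.card_insert_le p (G.nb a ∩ G.nb b ∩ G.nb w)
    have h7 := h3 a ha b hb.2 (mem_nb.1 hb.1)
    omega

end Center

/-- The graph contains an induced copy of `K22222` in the union of `K` and its boundary. -/
def HasOctahedron (G : SimpleGraph V) (K : Finset V) : Prop :=
  ∃ e : K22222 ↪g G, ∀ i, e i ∈ K ∪ G.bdry K

theorem k22222_adj (x y : Σ _ : Fin 5, Fin 2) : K22222.Adj x y ↔ x.1 ≠ y.1 := Iff.rfl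

theorem fourPairs_adj : ∀ i j : Fin 4, ∀ s t : Fin 2,
    ((2 * i + s : ℕ) ≠ 2 * j + t ∧ bit fourPairs (2 * i + s) (2 * j + t) = false) ↔ i ≠ j := by
  decide

omit [Fintype V] in
theorem exists_embedding {φ : ℕ → V} {F : Finset V} (hφ : Realizes G F 8 fourPairs φ) (hwp : w ≠ p)
    (hwp' : ¬ G.Adj w p) (hw : ∀ f ∈ F, G.Adj w f) (hp : ∀ f ∈ F, G.Adj p f) :
    ∃ e : K22222 ↪g G, ∀ i, e i ∈ insert w (insert p F) := by
  have hlt : ∀ (i : Fin 4) (s : Fin 2), (2 * i + s : ℕ) < 8 := fun i s => by omega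
  have hmem : ∀ (i : Fin 4) (s : Fin 2), φ (2 * i + s) ∈ F := fun i s =>
    (hφ.mem _).2 ⟨_, hlt i s, rfl⟩
  let g : (Σ _ : Fin 5, Fin 2) → V := fun x =>
    Fin.lastCases (motive := fun _ => V) (if x.2 = 0 then w else p)
      (fun i : Fin 4 => φ (2 * i + x.2)) x.1
  have hl : ∀ s, g ⟨Fin.last 4, s⟩ = if s = 0 then w else p := fun s => Fin.lastCases_last
  have hcs : ∀ (i : Fin 4) s, g ⟨i.castSucc, s⟩ = φ (2 * i + s) := fun i s => by simp [g]
  have hadj : ∀ x y, G.Adj (g x) (g y) ↔ K22222.Adj x y := by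
    rintro ⟨x, s⟩ ⟨y, t⟩
    rw [k22222_adj]
    induction x using Fin.lastCases with
    | last =>
      induction y using Fin.lastCases with
      | last =>
        rw [hl, hl]
        have hpw' : ¬ G.Adj p w := fun h' => hwp' h'.symm
        split_ifs <;> simp [hwp', hpw']
      | cast j =>
        rw [hl, hcs]
        have := hw _ (hmem j t)
        have := hp _ (hmem j t)
        have hne : Fin.last 4 ≠ j.castSucc := (Fin.castSucc_lt_last j).ne'
        split_ifs <;> exact iff_of_true (by assumption) hne
    | cast i =>
      induction y using Fin.lastCases with
      | last =>
        rw [hl, hcs]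
        have := (hw _ (hmem i s)).symm
        have := (hp _ (hmem i s)).symm
        have hne : i.castSucc ≠ Fin.last 4 := (Fin.castSucc_lt_last i).ne
        split_ifs <;> exact iff_of_true (by assumption) hne
      | cast j =>
        rw [hcs, hcs, hφ.adj _ (hlt i s) _ (hlt j t), fourPairs_adj]
        simp
  have hinj : Function.Injective g := by
    rintro ⟨x, s⟩ ⟨y, t⟩ hxy
    have hxy' : x = y := by
      by_contra hne
      have := (hadj ⟨x, s⟩ ⟨y, t⟩).2 hne
      rw [hxy] at this
      exact this.ne rfl
    subst hxy'
    induction x using Fin.lastCases with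
    | last =>
      rw [hl, hl] at hxy
      split_ifs at hxy with h1 h2 h2
      · rw [h1, h2]
      · exact absurd hxy hwp
      · exact absurd hxy.symm hwp
      · congr 1
        omega
    | cast i =>
      rw [hcs, hcs] at hxy
      have := hφ.inj _ (hlt i s) _ (hlt i t) hxy
      congr 1
      omega
  refine ⟨⟨⟨g, hinj⟩, fun {x y} => hadj x y⟩, fun ⟨x, s⟩ => ?_⟩
  change g ⟨x, s⟩ ∈ _
  induction x using Fin.lastCases with
  | last =>
    rw [hl]
    split_ifs <;> simp
  | cast i =>
    rw [hcs]
    simp [hmem i s]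

theorem Center.hasOctahedron_or_exists_fragment (h : G.Rooted K r) (hc : G.Center K r w U) :
    G.HasOctahedron K ∨ ∃ L R, G.Fragment K r w L R := by
  obtain ⟨p, hp, hcl⟩ := hc.exists_isClique_lab h
  by_cases hU : (U \ {p}).Nonempty ∧ ¬ G.Conn (U \ {p})
  · exact Or.inr (hc.exists_fragment_of_not_conn h hp hcl hU.1 hU.2)
  have hUcl : G.IsClique (G.lab w (U \ {p})) := by
    by_cases hne : (U \ {p}).Nonempty
    · exact hcl _ Finset.sdiff_subset (by simp) (not_not.1 (not_and.1 hU hne))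
    · rw [Finset.not_nonempty_iff_eq_empty.1 hne]
      intro a ha
      simp at ha
  have hpF : ∀ f ∈ G.nb w, G.Adj p f := by
    intro f hf
    have := hc.subset_lab h (S := {p}) (T := U \ {p}) (fun x hx => by
      by_cases hxp : x = p <;> simp [hxp, hx]) hUcl hf
    simpa using (mem_lab.1 this).2
  have hpr : p ≠ r := by
    rintro rfl
    have hsub : G.nb w ⊆ G.bdry K := h.bdry_subset_of_root (L := {w}) (by simpa using hc.mem)
      (fun s hs => by
        obtain ⟨⟨x, hx, hxs⟩, -⟩ := mem_bdry.1 hs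
        rw [Finset.mem_singleton.1 hx] at hxs
        exact mem_nb.2 (hpF s (mem_nb.2 hxs))) |>.trans' fun s hs =>
          mem_bdry.2 ⟨⟨w, by simp, mem_nb.1 hs⟩, by simpa using (mem_nb.1 hs).ne'⟩
    have := (hc.eight_le h).trans ((Finset.card_le_card hsub).trans h.card_bdry)
    omega
  have hpw := Finset.disjoint_left.1 hc.disjoint hp
  rw [Finset.mem_insert, mem_nb, not_or] at hpw
  rcases (hc.exceptional h).common_le_three with h3 | ⟨φ, hφ⟩
  · exact Or.inr (hc.exists_fragment_of_dominating h hp hpF hpr h3)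
  · obtain ⟨e, he⟩ := exists_embedding hφ (Ne.symm hpw.1) hpw.2 (fun f hf => mem_nb.1 hf) hpF
    refine Or.inl ⟨e, fun i => ?_⟩
    rcases Finset.mem_insert.1 (he i) with hi | hi
    · simp [hi, hc.mem]
    rcases Finset.mem_insert.1 hi with hi | hi
    · rw [hi]
      exact (Finset.mem_insert.1 (hc.subset' hp)).resolve_left hpr
    · exact nb_subset hc.mem hi

theorem Rooted.hasOctahedron (h : G.Rooted K r) : G.HasOctahedron K := by
  induction hn : K.card using Nat.strong_induction_on generalizing G K r with
  | _ n ih =>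
    obtain ⟨w, U, hc⟩ := h.exists_center
    rcases hc.hasOctahedron_or_exists_fragment h with ho | ⟨L, R, hf⟩
    · exact ho
    obtain ⟨H, hH, hb, hadj⟩ := h.fragment hf.subset hf.nonempty hf.card_le hf.conn
      hf.subset_insert hf.mem hf.disjoint hf.touch
    have hwL : w ∉ L := fun h' => hH.root_notMem h'
    have hlt : L.card < n := hn ▸ Finset.card_lt_card
      (Finset.ssubset_iff_subset_ne.2 ⟨hf.subset, fun h' => hwL (h' ▸ hc.mem)⟩)
    obtain ⟨e, he⟩ := ih _ hlt hH rfl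
    rw [hb] at he
    refine ⟨⟨e.toEmbedding, fun {x y} => ?_⟩, fun i => ?_⟩
    · exact (hadj _ (he x) _ (he y)).symm.trans e.map_adj_iff
    · exact Finset.union_subset (hf.subset.trans Finset.subset_union_left)
        (bdry_subset hf.subset) (he i)

end SimpleGraph

namespace SimpleGraph

variable {V : Type*} [Fintype V] [DecidableEq V] {G H : SimpleGraph V} {S T B O : Finset V}

/-- The graph `G[B]` on the vertex set `Option V`, in which all other vertices are isolated. -/
def someGraph (G : SimpleGraph V) (B : Finset V) : SimpleGraph (Option V) where
  Adj x y := ∃ a ∈ B, ∃ b ∈ B, x = some a ∧ y = some b ∧ G.Adj a b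
  symm := ⟨fun _ _ ⟨a, ha, b, hb, hxa, hyb, hab⟩ => ⟨b, hb, a, ha, hyb, hxa, hab.symm⟩⟩
  loopless := ⟨fun _ ⟨_, _, _, _, hxa, hxb, hab⟩ =>
    hab.ne (Option.some.inj (hxa.symm.trans hxb))⟩

omit [Fintype V] [DecidableEq V] in
theorem someGraph_adj {a b : V} :
    (G.someGraph B).Adj (some a) (some b) ↔ a ∈ B ∧ b ∈ B ∧ G.Adj a b := by
  simp [someGraph]

theorem nb_someGraph {a : V} (ha : a ∈ B) :
    (G.someGraph B).nb (some a) = (G.nb a ∩ B).map Function.Embedding.some := by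
  ext y
  cases y with
  | none => simp [someGraph]
  | some y => simp [someGraph_adj, ha, and_comm]

theorem ed_someGraph {C : Finset V} (hC : C ⊆ B) :
    (G.someGraph B).ed (C.map Function.Embedding.some) (C.map Function.Embedding.some) =
      G.ed C C := by
  unfold ed
  rw [Finset.sum_map]
  refine Finset.sum_congr rfl fun x hx => ?_
  rw [show Function.Embedding.some x = some x from rfl, nb_someGraph (hC hx),
    ← Finset.map_inter, Finset.card_map, Finset.inter_assoc, Finset.inter_eq_right.2 hC]

omit [Fintype V] in
theorem KModel.of_someGraph {A : Finset (Option V)} (h : (G.someGraph B).KModel 8 A) :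
    G.KModel 8 B := by
  obtain ⟨f, hf, hf'⟩ := h
  have key : ∀ i, ∀ x ∈ f i, ∃ a ∈ B, x = some a := fun i x hx => by
    obtain ⟨j, hj⟩ := exists_ne i
    obtain ⟨a, ha, b, hb, hab⟩ := (hf' i j hj.symm).2
    by_cases hxa : x = a
    · obtain ⟨a', ha', _, _, haa', -⟩ := hab
      exact ⟨a', ha', hxa.trans haa'⟩
    · obtain ⟨c, hc, d, _, hcd⟩ := (hf i).1.touch_inter (A := {x}) hx (by simp) ha
        (by simpa using Ne.symm hxa)
      obtain ⟨a', ha', _, _, haa', -⟩ := hcd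
      have : c = x := by simpa using (Finset.mem_inter.1 hc).2
      exact ⟨a', ha', this ▸ haa'⟩
  have h' : (G.someGraph B).KModel 8 (B.map Function.Embedding.some) :=
    ⟨f, fun i => ⟨(hf i).1, fun x hx => by
      obtain ⟨a, ha, rfl⟩ := key i x hx
      simpa using ha⟩, hf'⟩
  refine h'.lift (g := fun x => x.toFinset) (fun x hx => ?_) (fun x hx y hy hxy => ?_)
    fun x hx y hy hxy => ?_
  · obtain ⟨a, ha, rfl⟩ := Finset.mem_map.1 hx
    exact ⟨conn_singleton G a, by simpa using ha⟩
  · obtain ⟨a, ha, rfl⟩ := Finset.mem_map.1 hx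
    obtain ⟨b, hb, rfl⟩ := Finset.mem_map.1 hy
    simpa using fun h => hxy (congrArg some h)
  · obtain ⟨a, ha, rfl⟩ := Finset.mem_map.1 hx
    obtain ⟨b, hb, rfl⟩ := Finset.mem_map.1 hy
    exact ⟨a, by simp, b, by simp, (someGraph_adj.1 hxy).2.2⟩

theorem exists_octahedron (hne : ∃ a ∈ B, ∃ b ∈ B, G.Adj a b)
    (hcommon : ∀ x ∈ B, ∀ y ∈ B, G.Adj x y → 6 ≤ (G.nb x ∩ G.nb y ∩ B).card)
    (hmodel : ¬ G.KModel 8 B) (hsparse : ∀ C ⊆ B, 5 ≤ C.card → G.ed C C + 38 ≤ 12 * C.card) :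
    ∃ e : K22222 ↪g G, ∀ i, e i ∈ B := by
  set K : Finset (Option V) :=
    (B.filter fun a => (G.nb a ∩ B).Nonempty).map Function.Embedding.some with hK
  have hKmem : ∀ x ∈ K, ∃ a ∈ B, x = some a ∧ (G.nb a ∩ B).Nonempty := fun x hx => by
    obtain ⟨a, ha, rfl⟩ := Finset.mem_map.1 hx
    rw [Finset.mem_filter] at ha
    exact ⟨a, ha.1, rfl, ha.2⟩
  have hKB : K ⊆ B.map Function.Embedding.some := Finset.map_subset_map.2 (Finset.filter_subset _ _)
  have hb : (G.someGraph B).bdry K = ∅ := by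
    rw [Finset.eq_empty_iff_forall_notMem]
    intro y hy
    obtain ⟨⟨x, -, a, ha, b, hb, rfl, rfl, hab⟩, hyK⟩ := mem_bdry.1 hy
    exact hyK (by simpa [hK, hb] using ⟨a, by simp [ha, hab.symm]⟩)
  obtain ⟨e, he⟩ := Rooted.hasOctahedron (G := G.someGraph B) (K := K) (r := none)
    { nonempty := by
        obtain ⟨a, ha, b, hb, hab⟩ := hne
        exact ⟨some a, by simpa [hK, ha] using ⟨b, by simp [hb, hab]⟩⟩
      root_notMem := by simp [hK]
      root_adj := by simp [hb]
      root_notMem_bdry := by simp [hb]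
      card_bdry := by simp [hb]
      exists_adj := fun x hx => by
        obtain ⟨a, ha, rfl, b, hb⟩ := hKmem x hx
        rw [Finset.mem_inter, mem_nb] at hb
        exact ⟨some b, someGraph_adj.2 ⟨ha, hb.2, hb.1⟩⟩
      common := fun x _ y hxy => by
        obtain ⟨a, ha, b, hb, rfl, rfl, hab⟩ := hxy
        rw [nb_someGraph ha, nb_someGraph hb, ← Finset.map_inter, Finset.card_map,
          ← Finset.inter_inter_distrib_right]
        exact hcommon a ha b hb hab
      no_model := fun h => hmodel h.of_someGraph
      sparse := fun C hC h5 => by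
        rw [hb, Finset.union_empty] at hC
        obtain ⟨D, hD, rfl⟩ := Finset.subset_map_iff.1 (hC.trans hKB)
        rw [ed_someGraph hD, Finset.card_map] at *
        exact hsparse D hD h5 }
  rw [hb, Finset.union_empty] at he
  choose g hgB hg using fun i => hKmem _ (he i)
  refine ⟨⟨⟨g, fun i j hij => e.injective ?_⟩, fun {i j} => ?_⟩, hgB⟩
  · rw [(hg i).1, (hg j).1, hij]
  · have := e.map_adj_iff (v := i) (w := j)
    rw [(hg i).1, (hg j).1, someGraph_adj] at this
    change G.Adj (g i) (g j) ↔ _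
    simpa [hgB] using this

end SimpleGraph

namespace SimpleGraph

variable {V : Type*} [Fintype V] [DecidableEq V] {G H : SimpleGraph V} {S T B C O Q : Finset V}
  {x y v : V}

omit [Fintype V] in
theorem KModel.mono_graph {t : ℕ} (h : H.KModel t B)
    (hHG : ∀ a ∈ B, ∀ b ∈ B, H.Adj a b → G.Adj a b) : G.KModel t B :=
  h.lift (g := fun a => {a}) (fun a ha => ⟨conn_singleton G a, by simpa using ha⟩)
    (fun _ _ _ _ hab => by simpa using hab)
    fun a ha b hb hab => ⟨a, by simp, b, by simp, hHG a ha b hb hab⟩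

theorem ed_union_self (h : Disjoint S T) :
    G.ed (S ∪ T) (S ∪ T) = G.ed S S + 2 * G.ed S T + G.ed T T := by
  rw [ed_union_left h, ed_union_right h, ed_union_right h, ed_comm T S]
  ring

theorem ed_insert (hv : v ∉ B) :
    G.ed (insert v B) (insert v B) = G.ed B B + 2 * (G.nb v ∩ B).card := by
  rw [Finset.insert_eq, ed_union_self (by simpa using hv)]
  simp [ed]
  ring

theorem even_ed (B : Finset V) : Even (G.ed B B) := by
  induction B using Finset.induction_on with
  | empty => simp [ed]
  | insert v B hv ih =>
    rw [ed_insert hv]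
    exact ih.add (even_two_mul _)

theorem ed_mono (h : ∀ a ∈ S, ∀ b ∈ T, G.Adj a b → H.Adj a b) : G.ed S T ≤ H.ed S T := by
  refine Finset.sum_le_sum fun a ha => Finset.card_le_card fun b hb => ?_
  simp only [Finset.mem_inter, mem_nb] at hb ⊢
  exact ⟨h a ha b hb.2 hb.1, hb.2⟩

theorem ed_self_le (S : Finset V) : G.ed S S ≤ S.card * (S.card - 1) := by
  refine Finset.sum_le_card_nsmul S _ _ fun a ha => ?_
  rw [← Finset.card_erase_of_mem ha]
  refine Finset.card_le_card fun b hb => ?_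
  simp only [Finset.mem_inter, mem_nb, Finset.mem_erase] at hb ⊢
  exact ⟨hb.1.ne', hb.2⟩

theorem le_ed_of_isClique (hS : G.IsClique S) : S.card * (S.card - 1) ≤ G.ed S S := by
  rw [mul_comm]
  refine le_ed fun a ha => ?_
  rw [← Finset.card_erase_of_mem ha]
  refine Finset.card_le_card fun b hb => ?_
  simp only [Finset.mem_inter, mem_nb, Finset.mem_erase] at hb ⊢
  exact ⟨hS ha hb.2 hb.1.symm, hb.2⟩

theorem ed_le_ed_deleteEdges (hxy : G.Adj x y) (B : Finset V) :
    G.ed B B ≤ (G.deleteEdges {s(x, y)}).ed B B + 2 := by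
  have h : ∀ a ∈ B, (G.nb a ∩ B).card ≤ ((G.deleteEdges {s(x, y)}).nb a ∩ B).card +
      ((if a = x then 1 else 0) + if a = y then 1 else 0) := fun a _ => by
    have hne := hxy.ne
    by_cases hax : a = x
    · subst hax
      rw [if_pos rfl, if_neg hne]
      refine (Finset.card_le_card (t := insert y _) fun b hb => ?_).trans
        (Finset.card_insert_le y _)
      simp only [Finset.mem_inter, mem_nb, Finset.mem_insert, deleteEdges_adj,
        Set.mem_singleton_iff, Sym2.eq_iff] at hb ⊢
      grind
    · by_cases hay : a = y
      · subst hay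
        rw [if_pos rfl, if_neg hax]
        refine (Finset.card_le_card (t := insert x _) fun b hb => ?_).trans
          (Finset.card_insert_le x _)
        simp only [Finset.mem_inter, mem_nb, Finset.mem_insert, deleteEdges_adj,
          Set.mem_singleton_iff, Sym2.eq_iff] at hb ⊢
        grind
      · rw [if_neg hax, if_neg hay]
        refine Finset.card_le_card fun b hb => ?_
        simp only [Finset.mem_inter, mem_nb, deleteEdges_adj,
          Set.mem_singleton_iff, Sym2.eq_iff] at hb ⊢
        grind
  refine (Finset.sum_le_sum h).trans ?_
  rw [Finset.sum_add_distrib, Finset.sum_add_distrib, Finset.sum_ite_eq', Finset.sum_ite_eq']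
  unfold ed
  split_ifs <;> omega

theorem ed_comp_eq_zero (hQ : G.IsComp S Q) : G.ed Q (S \ Q) = 0 := by
  refine Finset.sum_eq_zero fun a ha => ?_
  rw [Finset.card_eq_zero, Finset.eq_empty_iff_forall_notMem]
  intro b hb
  simp only [Finset.mem_inter, mem_nb, Finset.mem_sdiff] at hb
  exact hQ.not_adj a ha b hb.2.1 hb.2.2 hb.1

theorem ed_add_le_of_isComp {c : ℕ}
    (h : ∀ Q, G.IsComp S Q → G.ed Q Q + 2 * G.ed Q O ≤ c * Q.card) :
    G.ed S S + 2 * G.ed S O ≤ c * S.card := by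
  induction hn : S.card using Nat.strong_induction_on generalizing S with
  | _ n ih =>
    rcases S.eq_empty_or_nonempty with rfl | ⟨v, hv⟩
    · simp [ed]
    obtain ⟨Q, hQ, hvQ⟩ := exists_isComp_of_mem (G := G) hv
    have hcard := Finset.card_sdiff_add_card_eq_card hQ.subset
    have hpos : 0 < Q.card := Finset.card_pos.2 ⟨v, hvQ⟩
    have h1 := ih (S \ Q).card (by omega) (S := S \ Q) (fun P hP => h P ⟨hP.subset.trans
      Finset.sdiff_subset, hP.conn, fun a ha b hb hbP hab => ?_⟩) rfl
    · have h2 := h Q hQ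
      have h3 := ed_union_self (G := G) (Finset.disjoint_sdiff (s := Q) (t := S))
      have h4 := ed_union_left (G := G) (B := O) (Finset.disjoint_sdiff (s := Q) (t := S))
      rw [Finset.union_sdiff_of_subset hQ.subset] at h3 h4
      rw [ed_comp_eq_zero hQ] at h3
      have h5 : c * n = c * (S \ Q).card + c * Q.card := by rw [← mul_add, hcard, hn]
      omega
    · by_cases hbQ : b ∈ Q
      · exact hQ.not_adj b hbQ a (Finset.mem_sdiff.1 (hP.subset ha)).1
          (Finset.mem_sdiff.1 (hP.subset ha)).2 hab.symm
      · exact hP.not_adj a ha b (Finset.mem_sdiff.2 ⟨hb, hbQ⟩) hbP hab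

/-- Contracting an edge in few triangles loses few edges. -/
theorem exists_contract (hx : x ∈ B) (hy : y ∈ B) (hxy : G.Adj x y)
    (ht : (G.nb x ∩ G.nb y ∩ B).card ≤ 5) :
    ∃ H : SimpleGraph V, G.ed B B ≤ H.ed (B.erase y) (B.erase y) + 12 ∧
      ∀ t, H.KModel t (B.erase y) → G.KModel t B := by
  set H : SimpleGraph V := G ⊔ fromRel fun a b => a = x ∧ G.Adj y b with hH
  have hadj : ∀ a b, H.Adj a b ↔ G.Adj a b ∨ a ≠ b ∧ (a = x ∧ G.Adj y b ∨ b = x ∧ G.Adj y a) :=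
    fun a b => by simp [hH]
  have hne := hxy.ne
  set D := (B.erase y).erase x with hD
  set N := (G.nb y ∩ D) \ G.nb x with hN
  have hxB : x ∈ B.erase y := Finset.mem_erase.2 ⟨hne, hx⟩
  have hBD : insert x D = B.erase y := Finset.insert_erase hxB
  have hxD : x ∉ D := by simp [hD]
  have h1 := ed_insert (G := G) (Finset.notMem_erase y B)
  rw [Finset.insert_erase hy] at h1
  have h2 := ed_insert (G := G) hxD
  have h3 := ed_insert (G := H) hxD
  rw [hBD] at h2 h3
  have h4 : G.ed D D ≤ H.ed D D := ed_mono fun a _ b _ hab => (hadj a b).2 (Or.inl hab)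
  have h5 : (G.nb x ∩ D).card + N.card ≤ (H.nb x ∩ D).card := by
    rw [← Finset.card_union_of_disjoint]
    · refine Finset.card_le_card fun b hb => ?_
      simp only [hN, Finset.mem_union, Finset.mem_inter, Finset.mem_sdiff, mem_nb, hadj] at hb ⊢
      grind
    · rw [Finset.disjoint_left]
      intro b hb hb'
      exact (Finset.mem_sdiff.1 hb').2 (Finset.mem_inter.1 hb).1
  have h6 : (G.nb y ∩ B.erase y).card ≤ 1 + (G.nb x ∩ G.nb y ∩ B).card + N.card := by
    have : G.nb y ∩ B.erase y ⊆ {x} ∪ (G.nb x ∩ G.nb y ∩ B) ∪ N := fun b hb => by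
      simp only [hN, hD, Finset.mem_union, Finset.mem_inter, Finset.mem_sdiff, mem_nb,
        Finset.mem_erase, Finset.mem_singleton] at hb ⊢
      tauto
    refine (Finset.card_le_card this).trans ((Finset.card_union_le _ _).trans ?_)
    have := Finset.card_union_le {x} (G.nb x ∩ G.nb y ∩ B)
    rw [Finset.card_singleton] at this
    omega
  refine ⟨H, by omega, fun t h => h.lift (g := fun a => if a = x then {x, y} else {a})
    (fun a ha => ?_) (fun a ha b hb hab => ?_) fun a ha b hb hab => ?_⟩
  · split_ifs
    · exact ⟨conn_pair (Or.inr hxy), by simp [Finset.insert_subset_iff, hx, hy]⟩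
    · exact ⟨conn_singleton G a, by simpa using (Finset.mem_erase.1 ha).2⟩
  · have ha' := (Finset.mem_erase.1 ha).1
    have hb' := (Finset.mem_erase.1 hb).1
    rw [Finset.disjoint_left]
    intro c hc hc'
    split_ifs at hc hc' <;> simp only [Finset.mem_insert, Finset.mem_singleton] at hc hc' <;> grind
  · have hmem : ∀ c, c ∈ (if c = x then {x, y} else {c} : Finset V) := fun c => by
      split_ifs with hc <;> simp [hc]
    rcases (hadj a b).1 hab with h' | ⟨-, ⟨rfl, h'⟩ | ⟨rfl, h'⟩⟩
    · exact ⟨a, hmem a, b, hmem b, h'⟩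
    · exact ⟨y, by simp, b, hmem b, h'⟩
    · exact ⟨a, hmem a, y, by simp, h'.symm⟩

end SimpleGraph

namespace SimpleGraph

variable {V : Type*} [Fintype V] [DecidableEq V] {G : SimpleGraph V} {B Q : Finset V} {m : ℕ}

theorem eq_of_div_of_mod : ∀ k < 10, ∀ l < 10, Fin.ofNat 5 (k / 2) = Fin.ofNat 5 (l / 2) →
    Fin.ofNat 2 k = Fin.ofNat 2 l → k = l := by
  decide

omit [Fintype V] in
theorem kModel_eight_of_octahedron (e : K22222 ↪g G) {i j : Σ _ : Fin 5, Fin 2}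
    (hij : i ≠ j) (hadj : ¬ G.Adj (e i) (e j)) (hB : ∀ i, e i ∈ B) :
    (G ⊔ edge (e i) (e j)).KModel 8 B := by
  obtain ⟨p, s⟩ := i
  obtain ⟨q, t⟩ := j
  rw [e.map_adj_iff, k22222_adj, not_not] at hadj
  obtain rfl : p = q := hadj
  have hst : t = s + 1 := by
    have h : s ≠ t := fun h => hij (by rw [h])
    clear hij
    revert s t
    decide
  refine kModel_of_bags (l := [(0, 0), (1, 1), (2, 2), (4, 4), (6, 6), (8, 8), (3, 5), (7, 9)])
    (n := 10) (r := fun k l => k / 2 ≠ l / 2 ∨ k = 0 ∧ l = 1 ∨ k = 1 ∧ l = 0)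
    (φ := fun k => e ⟨p + Fin.ofNat 5 (k / 2), s + Fin.ofNat 2 k⟩)
    (by unfold Bags; decide) (fun k hk l hl hkl => ?_) (fun k hk l hl hkl hr => ?_)
    fun _ _ => ⟨hB _, hB _⟩
  · have := Sigma.mk.inj (e.injective hkl)
    exact eq_of_div_of_mod k hk l hl (add_left_cancel this.1)
      (add_left_cancel (eq_of_heq this.2))
  · rcases hr with hr | ⟨rfl, rfl⟩ | ⟨rfl, rfl⟩
    · refine Or.inl (e.map_adj_iff.2 ((k22222_adj _ _).2 fun h => hr ?_))
      have h := add_left_cancel h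
      rw [Fin.ext_iff] at h
      simp only [Fin.ofNat] at h
      omega
    · have := adj_sup_edge (H := G) (e.injective.ne hij)
      simpa [hst] using this
    · have := (adj_sup_edge (H := G) (e.injective.ne hij)).symm
      simpa [hst] using this

theorem ed_octahedron_le (e : K22222 ↪g G) :
    G.ed (Finset.univ.map e.toEmbedding) (Finset.univ.map e.toEmbedding) ≤ 80 := by
  refine Finset.sum_le_card_nsmul _ _ 8 fun x hx => ?_
  obtain ⟨i, -, rfl⟩ := Finset.mem_map.1 hx
  have h8 : ∀ i : Σ _ : Fin 5, Fin 2,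
      (Finset.univ.filter fun j : Σ _ : Fin 5, Fin 2 => i.1 ≠ j.1).card = 8 := by decide
  rw [← h8 i, ← Finset.card_map e.toEmbedding]
  refine Finset.card_le_card fun y hy => ?_
  obtain ⟨hy, hyO⟩ := Finset.mem_inter.1 hy
  obtain ⟨j, -, rfl⟩ := Finset.mem_map.1 hyO
  refine Finset.mem_map_of_mem _ (Finset.mem_filter.2 ⟨Finset.mem_univ _, ?_⟩)
  exact (k22222_adj i j).1 (e.map_adj_iff.1 (mem_nb.1 hy))

theorem ed_comp_le (e : K22222 ↪g G) (hB : ∀ i, e i ∈ B) (hmodel : ¬ G.KModel 8 B)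
    (hsparse : ∀ C ⊆ B, C ≠ B → 5 ≤ C.card → G.ed C C + 40 ≤ 12 * C.card)
    (hQ : G.IsComp (B \ Finset.univ.map e.toEmbedding) Q) :
    G.ed Q Q + 2 * G.ed Q (Finset.univ.map e.toEmbedding) ≤ 12 * Q.card := by
  classical
  set O := Finset.univ.map e.toEmbedding with hO
  have hOB : O ⊆ B := fun x hx => by
    obtain ⟨i, -, rfl⟩ := Finset.mem_map.1 hx
    exact hB i
  have hQB : Q ⊆ B := hQ.subset.trans Finset.sdiff_subset
  have hdis : Disjoint Q O := Finset.disjoint_of_subset_left hQ.subset Finset.sdiff_disjoint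
  set T := O.filter fun b => G.Touch Q {b} with hT
  have hTO : T ⊆ O := Finset.filter_subset _ _
  have hcl : G.IsClique T := by
    intro a ha b hb hab
    rw [Finset.mem_coe, hT, Finset.mem_filter] at ha hb
    obtain ⟨⟨i, -, rfl⟩, hi⟩ := ha.imp_left Finset.mem_map.1
    obtain ⟨⟨j, -, rfl⟩, hj⟩ := hb.imp_left Finset.mem_map.1
    by_contra hadj
    refine hmodel (((kModel_eight_of_octahedron (B := O) e (fun h => hab (by rw [h])) hadj
      fun i => Finset.mem_map_of_mem _ (Finset.mem_univ i)).absorb hQ.conn hdis hi hj).mono ?_)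
    exact Finset.union_subset hOB hQB
  have hT5 : T.card ≤ 5 := by
    have hTe : ∀ x ∈ T, ∃ i, e i = x := fun x hx => by
      obtain ⟨i, -, hi⟩ := Finset.mem_map.1 (hTO hx)
      exact ⟨i, hi⟩
    choose! g hg using hTe
    rw [← Fintype.card_fin 5]
    refine Finset.card_le_card_of_injOn (fun x => (g x).1) (fun _ _ => Finset.mem_coe.2
      (Finset.mem_univ _)) fun x hx y hy hxy => ?_
    by_contra hne
    have := hcl hx hy hne
    rw [← hg x hx, ← hg y hy, e.map_adj_iff, k22222_adj] at this
    exact this hxy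
  have hQT : G.ed Q O = G.ed Q T := by
    refine Finset.sum_congr rfl fun x hx => congrArg _ (Finset.ext fun y => ?_)
    simp only [hT, Finset.mem_inter, Finset.mem_filter, mem_nb]
    exact ⟨fun h => ⟨h.1, h.2, x, hx, y, by simp, h.1⟩, fun h => ⟨h.1, h.2.1⟩⟩
  have hdisT : Disjoint Q T := Finset.disjoint_of_subset_right hTO hdis
  have hcard := Finset.card_union_of_disjoint hdisT
  have hO10 : O.card = 10 := by simp [hO]
  have hpos : 0 < Q.card := Finset.card_pos.2 hQ.conn.1
  rw [hQT]
  have h1 := le_ed_of_isClique hcl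
  have h2 := ed_self_le (G := G) Q
  have h3 : G.ed Q T ≤ Q.card * T.card :=
    Finset.sum_le_card_nsmul Q _ _ fun x _ => Finset.card_le_card Finset.inter_subset_right
  by_cases h5 : 5 ≤ Q.card + T.card
  · have h := hsparse (Q ∪ T) (Finset.union_subset hQB (hTO.trans hOB)) (fun h => ?_) (by omega)
    · rw [ed_union_self hdisT, hcard] at h
      interval_cases T.card <;> omega
    · have : O ⊆ T := fun x hx => (Finset.mem_union.1 (h ▸ hOB hx)).resolve_left fun hxQ =>
        Finset.disjoint_left.1 hdis hxQ hx
      have := Finset.card_le_card this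
      omega
  · have : Q.card ≤ 4 := by omega
    generalize Q.card = q at *
    generalize T.card = t at *
    interval_cases q <;> omega

/-- A graph on `m ≥ 5` vertices without a `K₈`-minor has fewer than `6 m - 19` edges. -/
theorem ed_add_lt_of_not_kModel (h5 : 5 ≤ B.card) (hmodel : ¬ G.KModel 8 B) :
    G.ed B B + 38 < 12 * B.card := by
  classical
  induction hm : B.card using Nat.strong_induction_on generalizing G B with
  | _ m ih =>
    by_contra! hge
    obtain ⟨H, ⟨hHG, hH⟩, hmin⟩ := (wellFounded_lt (α := SimpleGraph V)).has_min
      {H | H ≤ G ∧ 12 * m ≤ H.ed B B + 38} ⟨G, le_rfl, hge⟩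
    have hmodelH : ¬ H.KModel 8 B := fun h => hmodel (h.mono_graph fun _ _ _ _ hab => hHG hab)
    have hself := ed_self_le (G := H) B
    rw [hm] at hself h5
    have hm6 : 6 ≤ m := by
      by_contra hm6
      obtain rfl : m = 5 := by omega
      omega
    have hne : ∃ x ∈ B, ∃ y ∈ B, H.Adj x y := by
      by_contra! hno
      have : H.ed B B ≤ (⊥ : SimpleGraph V).ed B B := ed_mono fun x hx y hy hxy =>
        absurd hxy (hno x hx y hy)
      have h0 : (⊥ : SimpleGraph V).ed B B = 0 := by simp [ed, nb]
      omega
    have hle : H.ed B B + 38 ≤ 12 * m := by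
      obtain ⟨x, hx, y, hy, hxy⟩ := hne
      have h1 := ed_le_ed_deleteEdges hxy B
      have h2 := hmin (H.deleteEdges {s(x, y)})
      have h3 : H.deleteEdges {s(x, y)} < H := lt_of_le_of_ne (deleteEdges_le _) fun h => by
        rw [← h] at hxy
        simp at hxy
      have h4 : ¬ 12 * m ≤ (H.deleteEdges {s(x, y)}).ed B B + 38 := fun h =>
        h2 ⟨(deleteEdges_le _).trans hHG, h⟩ h3
      obtain ⟨k, hk⟩ := even_ed (G := H) B
      omega
    have hproper : ∀ C ⊆ B, C ≠ B → 5 ≤ C.card → H.ed C C + 40 ≤ 12 * C.card := fun C hC hCB hC5 => by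
      have hlt := Finset.card_lt_card (Finset.ssubset_iff_subset_ne.2 ⟨hC, hCB⟩)
      have := ih C.card (by omega) (G := H) hC5 (fun h => hmodelH (h.mono hC)) rfl
      obtain ⟨k, hk⟩ := even_ed (G := H) C
      omega
    obtain ⟨e, he⟩ := exists_octahedron hne (fun x hx y hy hxy => by
      by_contra! hlt
      obtain ⟨H', hH', hlift⟩ := exists_contract hx hy hxy (by omega)
      have hcard := Finset.card_erase_of_mem hy
      have := ih (m - 1) (by omega) (G := H') (B := B.erase y) (by omega)
        (fun h => hmodelH (hlift 8 h)) (by omega)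
      omega) hmodelH fun C hC hC5 => by
        by_cases hCB : C = B
        · rw [hCB, hm]
          exact hle
        · exact (Nat.add_le_add_left (by norm_num) _).trans (hproper C hC hCB hC5)
    have h1 := ed_add_le_of_isComp fun Q => ed_comp_le e he hmodelH hproper
    have h2 := ed_octahedron_le e
    have hO10 : (Finset.univ.map e.toEmbedding).card = 10 := by simp
    have hOB : Finset.univ.map e.toEmbedding ⊆ B := fun x hx => by
      obtain ⟨i, -, rfl⟩ := Finset.mem_map.1 hx
      exact he i
    have h3 := Finset.card_sdiff_add_card_eq_card hOB
    have h4 := ed_union_self (G := H) (Finset.sdiff_disjoint (s := Finset.univ.map e.toEmbedding) (t := B))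
    rw [Finset.sdiff_union_of_subset hOB] at h4
    omega

end SimpleGraph

namespace SimpleGraph

theorem Conn.connected_induce {V : Type*} [DecidableEq V] {G : SimpleGraph V} {S : Finset V}
    (h : G.Conn S) : (G.induce (S : Set V)).Connected := by
  classical
  rw [connected_iff_exists_forall_reachable]
  obtain ⟨v, hv⟩ := h.1
  refine ⟨⟨v, hv⟩, fun w => ?_⟩
  by_contra hw
  obtain ⟨a, ha, b, hb, hab⟩ := h.touch_inter
    (A := S.filter fun x => ∃ hx : x ∈ S, (G.induce (S : Set V)).Reachable ⟨v, hv⟩ ⟨x, hx⟩)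
    hv (Finset.mem_filter.2 ⟨hv, hv, .rfl⟩) w.2 fun h => hw (Finset.mem_filter.1 h).2.2
  obtain ⟨haS, hr⟩ := (Finset.mem_filter.1 (Finset.mem_inter.1 ha).2).2
  obtain ⟨hbS, hbA⟩ := Finset.mem_sdiff.1 hb
  exact hbA (Finset.mem_filter.2 ⟨hbS, hbS, hr.trans (Adj.reachable (by simpa using hab))⟩)

theorem KModel.minorOf {V : Type} [DecidableEq V] {G : SimpleGraph V} {B : Finset V} {t : ℕ}
    (h : G.KModel t B) : (⊤ : SimpleGraph (Fin t)).MinorOf G := by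
  obtain ⟨f, hf, hf'⟩ := h
  exact ⟨fun i => f i, fun i => (hf i).1.1, fun i => (hf i).1.connected_induce,
    fun i j hij => Finset.disjoint_coe.2 (hf' i j hij).1, fun i j hij => (hf' i j hij.ne).2⟩

end SimpleGraph

/-- Every finite simple graph with at least one edge, no `K_8`-minor and no
induced subgraph isomorphic to `K_{2,2,2,2,2}` has an edge belonging to at most
5 triangles. -/
theorem statement3 {V : Type} [Fintype V] (G : SimpleGraph V)
    (hedge : G.edgeSet.Nonempty)
    (hfree : ¬ (⊤ : SimpleGraph (Fin 8)).MinorOf G)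
    (hind : IsEmpty (K22222 ↪g G)) :
    ∃ u v : V, G.Adj u v ∧ (G.neighborSet u ∩ G.neighborSet v).ncard ≤ 5 := by
  classical
  by_contra! h
  have hmodel : ¬ G.KModel 8 Finset.univ := fun h => hfree h.minorOf
  obtain ⟨e, he⟩ := hedge
  induction e with
  | _ u v =>
    obtain ⟨f, -⟩ := exists_octahedron (G := G) (B := Finset.univ)
      ⟨u, Finset.mem_univ _, v, Finset.mem_univ _, he⟩
      (fun x _ y _ hxy => by
        rw [Finset.inter_univ, ← Set.ncard_coe_finset]
        refine (Nat.succ_le_of_lt (h x y hxy)).trans_eq (congrArg Set.ncard ?_)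
        ext z
        simp)
      hmodel fun C hC hC5 => (ed_add_lt_of_not_kModel hC5 fun h => hmodel (h.mono hC)).le
    exact hind.false f
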